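/- arXiv:2010.16133 — 10 statements merged into one kernel-verified Lean document; each statement's English description precedes it below -/
import Mathlib

section
/- For every s > 0 and all x, y ∈ [0,1], |w_s(x,y) − 2e^{−π²s/2}·sin(πx)·sin(πy)| ≤ 2e^{−π²s/2}·sin(πx)·sin(πy)·∑_{n=2}^∞ n²·e^{−π²(n²−1)s/2}. -/
open Real Filter

/-- The transition density of Brownian motion on `(0,1)` killed at the endpoints:
`w s x y = 2 ∑_{n=1}^∞ e^{-π² n² s / 2} sin(nπx) sin(nπy)`. -/
noncomputable def w (s x y : ℝ) : ℝ :=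
  2 * ∑' n : ℕ, Real.exp (-(Real.pi ^ 2 * ((n : ℝ) + 1) ^ 2 * s) / 2) *
    Real.sin (((n : ℝ) + 1) * Real.pi * x) * Real.sin (((n : ℝ) + 1) * Real.pi * y)

theorem abs_sin_nat_mul_le_mul_abs_sin (n : ℕ) (t : ℝ) :
    |Real.sin (n * t)| ≤ n * |Real.sin t| := by
  induction n with
  | zero => simp
  | succ n ih =>
    push_cast
    rw [add_mul, one_mul, Real.sin_add]
    calc |Real.sin (n * t) * Real.cos t + Real.cos (n * t) * Real.sin t|
        ≤ |Real.sin (n * t)| * |Real.cos t| + |Real.cos (n * t)| * |Real.sin t| := by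
          rw [← abs_mul, ← abs_mul]
          exact abs_add_le _ _
      _ ≤ |Real.sin (n * t)| * 1 + 1 * |Real.sin t| := by
          gcongr
          · exact Real.abs_cos_le_one t
          · exact Real.abs_cos_le_one _
      _ ≤ (n + 1) * |Real.sin t| := by linarith

theorem summable_sq_mul_exp_neg_sq_sub_one {s : ℝ} (hs : 0 < s) :
    Summable fun n : ℕ => ((n : ℝ) + 2) ^ 2 *
      Real.exp (-(Real.pi ^ 2 * (((n : ℝ) + 2) ^ 2 - 1) * s) / 2) := by
  have hr : 0 < Real.pi ^ 2 * s / 2 := by positivity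
  refine Summable.of_nonneg_of_le (fun n => by positivity) (fun n => ?_)
    ((summable_nat_add_iff 2).2 (Real.summable_pow_mul_exp_neg_nat_mul 2 hr))
  push_cast
  gcongr
  have hn : (n : ℝ) + 2 ≤ ((n : ℝ) + 2) ^ 2 - 1 := by
    nlinarith [(Nat.cast_nonneg n : (0 : ℝ) ≤ n)]
  nlinarith [mul_le_mul_of_nonneg_left hn hr.le]

theorem sin_pi_mul_nonneg {x : ℝ} (hx : x ∈ Set.Icc (0 : ℝ) 1) : 0 ≤ Real.sin (Real.pi * x) :=
  Real.sin_nonneg_of_nonneg_of_le_pi (mul_nonneg Real.pi_pos.le hx.1)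
    (mul_le_of_le_one_right Real.pi_pos.le hx.2)

theorem w_approx (s : ℝ) (hs : 0 < s) (x y : ℝ)
    (hx : x ∈ Set.Icc (0 : ℝ) 1) (hy : y ∈ Set.Icc (0 : ℝ) 1) :
    |w s x y - 2 * Real.exp (-(Real.pi ^ 2 * s) / 2) * Real.sin (Real.pi * x) *
        Real.sin (Real.pi * y)|
      ≤ 2 * Real.exp (-(Real.pi ^ 2 * s) / 2) * Real.sin (Real.pi * x) *
          Real.sin (Real.pi * y) *
          ∑' n : ℕ, ((n : ℝ) + 2) ^ 2 *
            Real.exp (-(Real.pi ^ 2 * (((n : ℝ) + 2) ^ 2 - 1) * s) / 2) := by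
  set f : ℕ → ℝ := fun n => Real.exp (-(Real.pi ^ 2 * ((n : ℝ) + 1) ^ 2 * s) / 2) *
    Real.sin (((n : ℝ) + 1) * Real.pi * x) * Real.sin (((n : ℝ) + 1) * Real.pi * y) with hf
  set g : ℕ → ℝ := fun n => ((n : ℝ) + 2) ^ 2 *
    Real.exp (-(Real.pi ^ 2 * (((n : ℝ) + 2) ^ 2 - 1) * s) / 2) with hg
  set E : ℝ := Real.exp (-(Real.pi ^ 2 * s) / 2) * Real.sin (Real.pi * x) *
    Real.sin (Real.pi * y) with hE
  have hgs : Summable g := summable_sq_mul_exp_neg_sq_sub_one hs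
  have hsin : ∀ (n : ℕ) {z : ℝ}, z ∈ Set.Icc (0 : ℝ) 1 →
      |Real.sin (((n : ℝ) + 2) * (Real.pi * z))| ≤ ((n : ℝ) + 2) * Real.sin (Real.pi * z) := by
    intro n z hz
    have h := abs_sin_nat_mul_le_mul_abs_sin (n + 2) (Real.pi * z)
    rw [abs_of_nonneg (sin_pi_mul_nonneg hz)] at h
    exact_mod_cast h
  have hbound : ∀ n, ‖f (n + 1)‖ ≤ E * g n := by
    intro n
    have hexp : Real.exp (-(Real.pi ^ 2 * ((n : ℝ) + 2) ^ 2 * s) / 2) =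
        Real.exp (-(Real.pi ^ 2 * s) / 2) *
          Real.exp (-(Real.pi ^ 2 * (((n : ℝ) + 2) ^ 2 - 1) * s) / 2) := by
      rw [← Real.exp_add]; ring_nf
    have hcast : ((n + 1 : ℕ) : ℝ) + 1 = (n : ℝ) + 2 := by push_cast; ring
    simp only [hf, hcast, Real.norm_eq_abs, abs_mul, Real.abs_exp, mul_assoc _ Real.pi]
    have hx0 := sin_pi_mul_nonneg hx
    calc _ ≤ Real.exp (-(Real.pi ^ 2 * ((n : ℝ) + 2) ^ 2 * s) / 2) *
          (((n : ℝ) + 2) * Real.sin (Real.pi * x)) *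
          (((n : ℝ) + 2) * Real.sin (Real.pi * y)) := by
          gcongr
          · exact hsin n hx
          · exact hsin n hy
      _ = E * g n := by rw [hexp, hE, hg]; ring
  have hfs : Summable f :=
    (summable_nat_add_iff 1).1 (Summable.of_norm_bounded (hgs.mul_left E) hbound)
  have hf0 : f 0 = E := by simp [hf, hE]
  have hw : w s x y = 2 * (E + ∑' n, f (n + 1)) := by
    rw [← hf0, ← hfs.tsum_eq_zero_add]; rfl
  have htail : |∑' n, f (n + 1)| ≤ E * ∑' n, g n :=
    tsum_of_norm_bounded (hgs.hasSum.mul_left E) hbound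
  calc _ = |2 * ∑' n, f (n + 1)| := by rw [hw, hE]; congr 1; ring
    _ = 2 * |∑' n, f (n + 1)| := by rw [abs_mul, abs_two]
    _ ≤ 2 * (E * ∑' n, g n) := by gcongr
    _ = _ := by rw [hE]; ring
end

section
/- For every s > 0 and all x, y ∈ (0,1), w_s(x,y) ≤ (2πs)^{−1/2}·e^{−(x−y)²/(2s)}·min(1, 2xy/s). -/
open Real

open HurwitzZeta in
/-- Poisson summation: `w` as the method-of-images difference of two periodised heat kernels. -/
lemma w_eq_evenKernel_sub (s : ℝ) (hs : 0 < s) (x y : ℝ) :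
    w s x y = (Real.sqrt (2 * Real.pi * s))⁻¹ *
      (evenKernel (((x - y) / 2 : ℝ) : UnitAddCircle) (2 / (Real.pi * s)) -
        evenKernel (((x + y) / 2 : ℝ) : UnitAddCircle) (2 / (Real.pi * s))) := by
  have ht : 0 < Real.pi * s / 2 := by positivity
  have h := ((hasSum_nat_cosKernel₀ ((x - y) / 2) ht).sub
    (hasSum_nat_cosKernel₀ ((x + y) / 2) ht)).mul_left (1 / 4)
  have hw : w s x y = (cosKernel (((x - y) / 2 : ℝ) : UnitAddCircle) (Real.pi * s / 2) -
      cosKernel (((x + y) / 2 : ℝ) : UnitAddCircle) (Real.pi * s / 2)) / 2 := by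
    have h' : HasSum (fun n : ℕ ↦ Real.exp (-(Real.pi ^ 2 * ((n : ℝ) + 1) ^ 2 * s) / 2) *
        Real.sin (((n : ℝ) + 1) * Real.pi * x) * Real.sin (((n : ℝ) + 1) * Real.pi * y))
        (1 / 4 * (cosKernel (((x - y) / 2 : ℝ) : UnitAddCircle) (Real.pi * s / 2) - 1 -
          (cosKernel (((x + y) / 2 : ℝ) : UnitAddCircle) (Real.pi * s / 2) - 1))) := by
      refine h.congr_fun fun n ↦ ?_
      rw [show 2 * Real.pi * ((x - y) / 2) * ((n : ℝ) + 1) =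
          ((n : ℝ) + 1) * Real.pi * x - ((n : ℝ) + 1) * Real.pi * y by ring,
        show 2 * Real.pi * ((x + y) / 2) * ((n : ℝ) + 1) =
          ((n : ℝ) + 1) * Real.pi * x + ((n : ℝ) + 1) * Real.pi * y by ring,
        Real.cos_sub, Real.cos_add,
        show -Real.pi * ((n : ℝ) + 1) ^ 2 * (Real.pi * s / 2) =
          -(Real.pi ^ 2 * ((n : ℝ) + 1) ^ 2 * s) / 2 by ring]
      ring
    rw [w, h'.tsum_eq]
    ring
  have hsqrt : Real.sqrt (2 * Real.pi * s) = 2 * Real.sqrt (Real.pi * s / 2) := by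
    rw [show 2 * Real.pi * s = 2 ^ 2 * (Real.pi * s / 2) by ring,
      Real.sqrt_mul (by positivity), Real.sqrt_sq (by norm_num)]
  have hinv : Real.sqrt (2 / (Real.pi * s)) = (Real.sqrt (Real.pi * s / 2))⁻¹ := by
    rw [← Real.sqrt_inv, inv_div]
  have hpos : 0 < Real.sqrt (Real.pi * s / 2) := Real.sqrt_pos.mpr ht
  rw [hw, evenKernel_functional_equation, evenKernel_functional_equation,
    ← Real.sqrt_eq_rpow, hinv, hsqrt, one_div_div]
  field_simp

/-- With `c = 2 / s` and `κ = 2 k / s`, this function is, up to a factor independent of `z`, the sum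
of the Gaussians of variance `s` at `2 k + z` and `2 k - z`. -/
lemma monotoneOn_exp_mul_cosh {c κ : ℝ} (hc : 1 ≤ c) (hκ : c ≤ κ) :
    MonotoneOn (fun z : ℝ ↦ Real.exp (-c * z ^ 2 / 4) * Real.cosh (κ * z)) (Set.Icc 0 1) := by
  have hd (z : ℝ) : HasDerivAt (fun z : ℝ ↦ Real.exp (-c * z ^ 2 / 4) * Real.cosh (κ * z))
      (Real.exp (-c * z ^ 2 / 4) * (κ * Real.sinh (κ * z) - c * z / 2 * Real.cosh (κ * z))) z := by
    have h1 : HasDerivAt (fun z : ℝ ↦ -c * z ^ 2 / 4) (-c * (2 * z) / 4) z := by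
      simpa using ((hasDerivAt_pow 2 z).const_mul (-c)).div_const 4
    have h2 : HasDerivAt (fun z : ℝ ↦ κ * z) κ z := by
      simpa using (hasDerivAt_id z).const_mul κ
    exact (h1.exp.mul h2.cosh).congr_deriv (by ring)
  refine monotoneOn_of_deriv_nonneg (convex_Icc 0 1)
    (fun z _ ↦ (hd z).continuousAt.continuousWithinAt)
    (fun z _ ↦ (hd z).differentiableAt.differentiableWithinAt) fun z hz ↦ ?_
  rw [interior_Icc] at hz
  obtain ⟨hz0, hz1⟩ := hz
  rw [(hd z).deriv]
  refine mul_nonneg (Real.exp_pos _).le ?_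
  have hm := Real.exp_pos (-(κ * z))
  have key : z * Real.cosh (κ * z) ≤ 2 * Real.sinh (κ * z) := by
    have h1 : 1 + 2 * z ≤ Real.exp (2 * (κ * z)) := by
      have := Real.add_one_le_exp (2 * (κ * z))
      nlinarith
    have h2 : Real.exp (κ * z) = Real.exp (2 * (κ * z)) * Real.exp (-(κ * z)) := by
      rw [← Real.exp_add]; ring_nf
    have h3 : 2 + z ≤ Real.exp (2 * (κ * z)) * (2 - z) := by nlinarith
    rw [Real.cosh_eq, Real.sinh_eq]
    nlinarith [mul_le_mul_of_nonneg_right h3 hm.le]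
  have hs : 0 ≤ Real.sinh (κ * z) := Real.sinh_nonneg_iff.mpr (by nlinarith)
  nlinarith [mul_le_mul_of_nonneg_right hκ hs]

lemma exp_mul_cosh_reflect {c κ v : ℝ} (hc : 1 ≤ c) (hκ : c ≤ κ) (hv0 : 0 ≤ v) (hv1 : v ≤ 1) :
    Real.exp (-c * (1 - v) ^ 2 / 4) * Real.cosh (κ * (1 - v)) ≤
      Real.exp (-c * (1 + v) ^ 2 / 4) * Real.cosh (κ * (1 + v)) := by
  have h1 : Real.exp (-c * (1 - v) ^ 2 / 4) =
      Real.exp (-c * (1 + v) ^ 2 / 4) * Real.exp (c * v) := by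
    rw [← Real.exp_add]; ring_nf
  rw [h1, mul_assoc]
  refine mul_le_mul_of_nonneg_left ?_ (Real.exp_pos _).le
  have h2 : Real.exp (c * v) ≤ Real.exp (κ * v) := Real.exp_le_exp.mpr (by nlinarith)
  refine (mul_le_mul_of_nonneg_right h2 (Real.cosh_pos _).le).trans ?_
  have hp2 : 2 ≤ Real.exp κ := by linarith [Real.add_one_le_exp κ]
  have hq1 : 1 ≤ Real.exp (κ * v) := Real.one_le_exp (by nlinarith)
  have hqp : Real.exp (κ * v) ≤ Real.exp κ := Real.exp_le_exp.mpr (by nlinarith)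
  rw [Real.cosh_eq, Real.cosh_eq,
    show κ * (1 - v) = κ - κ * v by ring, show κ * (1 + v) = κ + κ * v by ring,
    show -(κ - κ * v) = κ * v - κ by ring, Real.exp_neg, Real.exp_add, Real.exp_sub, Real.exp_sub]
  generalize Real.exp κ = p at *
  generalize Real.exp (κ * v) = q at *
  have hp : 0 < p := by linarith
  have hq : 0 < q := by linarith
  have key : 0 ≤ (q - 1) * (p ^ 2 * q - (q ^ 2 + q + 1)) := by
    refine mul_nonneg (by linarith) ?_
    have a1 : q * q ≤ p * q := mul_le_mul_of_nonneg_right hqp hq.le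
    have a2 : 2 * (p * q) ≤ p * (p * q) := mul_le_mul_of_nonneg_right hp2 (by positivity)
    have a3 : 2 * q ≤ p * q := mul_le_mul_of_nonneg_right hp2 hq.le
    nlinarith
  have e : (p * q + (p * q)⁻¹) / 2 - q * ((p / q + q / p) / 2) =
      (q - 1) * (p ^ 2 * q - (q ^ 2 + q + 1)) / (2 * p * q) := by
    field_simp
    ring
  have : 0 ≤ (q - 1) * (p ^ 2 * q - (q ^ 2 + q + 1)) / (2 * p * q) := by positivity
  linarith

lemma exp_mul_cosh_le {c κ d σ : ℝ} (hc : 1 ≤ c) (hκ : c ≤ κ) (hd : 0 ≤ d) (hdσ : d ≤ σ)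
    (hsum : d + σ ≤ 2) :
    Real.exp (-c * d ^ 2 / 4) * Real.cosh (κ * d) ≤
      Real.exp (-c * σ ^ 2 / 4) * Real.cosh (κ * σ) := by
  have hmono := monotoneOn_exp_mul_cosh hc hκ
  rcases le_total σ 1 with h | h
  · exact hmono ⟨hd, hdσ.trans h⟩ ⟨hd.trans hdσ, h⟩ hdσ
  · have h1 := hmono (a := d) (b := 2 - σ) ⟨hd, by linarith⟩ ⟨by linarith, by linarith⟩
      (by linarith)
    have h2 := exp_mul_cosh_reflect (v := σ - 1) hc hκ (by linarith) (by linarith)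
    rw [show 1 - (σ - 1) = 2 - σ by ring, show 1 + (σ - 1) = σ by ring] at h2
    exact h1.trans h2

open HurwitzZeta in
lemma hasSum_nat_evenKernel_div_two (s : ℝ) (hs : 0 < s) (z : ℝ) :
    HasSum (fun n : ℕ ↦ 2 * Real.exp (-2 * ((n : ℝ) + 1) ^ 2 / s) *
        (Real.exp (-(2 / s) * z ^ 2 / 4) * Real.cosh (2 * ((n : ℝ) + 1) / s * z)))
      (evenKernel ((z / 2 : ℝ) : UnitAddCircle) (2 / (Real.pi * s)) -
        Real.exp (-z ^ 2 / (2 * s))) := by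
  have h := (hasSum_int_evenKernel (z / 2)
    (show 0 < 2 / (Real.pi * s) by positivity)).nat_add_neg
  rw [← hasSum_nat_add_iff' 1] at h
  have e (a : ℝ) : -Real.pi * a ^ 2 * (2 / (Real.pi * s)) = -2 * a ^ 2 / s := by
    field_simp
  simp only [e] at h
  have e3 : -2 * (0 + z / 2) ^ 2 / s = -z ^ 2 / (2 * s) := by field_simp; ring
  simp only [Finset.sum_range_one, Nat.cast_zero, neg_zero, Int.cast_zero, e3,
    add_sub_add_right_eq_sub] at h
  refine h.congr_fun fun n ↦ ?_
  rw [Real.cosh_eq]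
  push_cast
  have e1 : Real.exp (-2 * ((n : ℝ) + 1 + z / 2) ^ 2 / s) =
      Real.exp (-2 * ((n : ℝ) + 1) ^ 2 / s) * Real.exp (-(2 / s) * z ^ 2 / 4) *
        Real.exp (-(2 * ((n : ℝ) + 1) / s * z)) := by
    rw [← Real.exp_add, ← Real.exp_add]; ring_nf
  have e2 : Real.exp (-2 * (-((n : ℝ) + 1) + z / 2) ^ 2 / s) =
      Real.exp (-2 * ((n : ℝ) + 1) ^ 2 / s) * Real.exp (-(2 / s) * z ^ 2 / 4) *
        Real.exp (2 * ((n : ℝ) + 1) / s * z) := by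
    rw [← Real.exp_add, ← Real.exp_add]; ring_nf
  rw [e1, e2]
  ring

/-- For small times, the killed kernel is at most the kernel on the half-line. -/
lemma w_le_of_le_two {s : ℝ} (hs : 0 < s) (hs2 : s ≤ 2) {x y : ℝ}
    (hx : x ∈ Set.Ioo (0 : ℝ) 1) (hy : y ∈ Set.Ioo (0 : ℝ) 1) :
    w s x y ≤ (Real.sqrt (2 * Real.pi * s))⁻¹ *
      (Real.exp (-(x - y) ^ 2 / (2 * s)) - Real.exp (-(x + y) ^ 2 / (2 * s))) := by
  obtain ⟨hx0, hx1⟩ := hx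
  obtain ⟨hy0, hy1⟩ := hy
  rw [w_eq_evenKernel_sub s hs]
  refine mul_le_mul_of_nonneg_left ?_ (by positivity)
  have hle := hasSum_le (fun n ↦ ?_) (hasSum_nat_evenKernel_div_two s hs (x - y))
    (hasSum_nat_evenKernel_div_two s hs (x + y))
  · linarith
  · refine mul_le_mul_of_nonneg_left ?_ (by positivity)
    have hc : 1 ≤ 2 / s := by rwa [le_div_iff₀ hs, one_mul]
    have hκ : 2 / s ≤ 2 * ((n : ℝ) + 1) / s := by
      gcongr
      linarith [n.cast_nonneg (α := ℝ)]
    have hκ0 : 0 < 2 * ((n : ℝ) + 1) / s := by positivity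
    have h := exp_mul_cosh_le (d := |x - y|) (σ := x + y) hc hκ (abs_nonneg _)
      (abs_le.mpr ⟨by linarith, by linarith⟩) ?_
    · rwa [sq_abs, ← abs_of_pos hκ0, ← abs_mul, Real.cosh_abs, abs_of_pos hκ0] at h
    · rcases abs_cases (x - y) with h | h <;> linarith

lemma w_le_of_two_le {s : ℝ} (hs : 2 ≤ s) {x y : ℝ} (hx : 0 ≤ x) (hy : 0 ≤ y) :
    w s x y ≤ 4 * Real.pi ^ 2 * (x * y) * Real.exp (1 - 9 / 2 * s) := by
  set q := Real.exp (1 - 9 / 2 * s) with hq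
  have hq0 : 0 < q := Real.exp_pos _
  have hq2 : q ≤ 1 / 2 := by
    have h : q ≤ Real.exp (-1) := Real.exp_le_exp.mpr (by linarith)
    rw [Real.exp_neg] at h
    refine h.trans ?_
    rw [one_div]
    exact inv_anti₀ (by norm_num) (by linarith [Real.add_one_le_exp (1 : ℝ)])
  have hgeom := (hasSum_geometric_of_lt_one hq0.le (by linarith)).mul_left
    (Real.pi ^ 2 * (x * y) * q)
  have hbound (n : ℕ) : ‖Real.exp (-(Real.pi ^ 2 * ((n : ℝ) + 1) ^ 2 * s) / 2) *
      Real.sin (((n : ℝ) + 1) * Real.pi * x) * Real.sin (((n : ℝ) + 1) * Real.pi * y)‖ ≤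
      Real.pi ^ 2 * (x * y) * q * q ^ n := by
    have hn : (0 : ℝ) ≤ n := n.cast_nonneg
    have hsin {z : ℝ} (hz : 0 ≤ z) : |Real.sin (((n : ℝ) + 1) * Real.pi * z)| ≤
        ((n : ℝ) + 1) * Real.pi * z := by
      refine Real.abs_sin_le_abs.trans (abs_of_nonneg ?_).le
      positivity
    have hexp : ((n : ℝ) + 1) ^ 2 * Real.exp (-(Real.pi ^ 2 * ((n : ℝ) + 1) ^ 2 * s) / 2) ≤
        q * q ^ n := by
      have h1 : ((n : ℝ) + 1) ^ 2 ≤ Real.exp (((n : ℝ) + 1) ^ 2) := by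
        linarith [Real.add_one_le_exp (((n : ℝ) + 1) ^ 2)]
      refine (mul_le_mul_of_nonneg_right h1 (Real.exp_pos _).le).trans ?_
      rw [← pow_succ', hq, ← Real.exp_nat_mul, ← Real.exp_add]
      refine Real.exp_le_exp.mpr ?_
      push_cast
      have hpi : 9 ≤ Real.pi ^ 2 := by nlinarith [Real.pi_gt_three]
      have h2 : 9 * (((n : ℝ) + 1) ^ 2 * s) ≤ Real.pi ^ 2 * (((n : ℝ) + 1) ^ 2 * s) :=
        mul_le_mul_of_nonneg_right hpi (by positivity)
      have h3 : (n : ℝ) + 1 ≤ ((n : ℝ) + 1) ^ 2 := by nlinarith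
      have h4 : ((n : ℝ) + 1) * (9 / 2 * s - 1) ≤ ((n : ℝ) + 1) ^ 2 * (9 / 2 * s - 1) :=
        mul_le_mul_of_nonneg_right h3 (by linarith)
      linarith
    rw [norm_mul, norm_mul, Real.norm_eq_abs, Real.norm_eq_abs, Real.norm_eq_abs, Real.abs_exp]
    calc _ ≤ Real.exp (-(Real.pi ^ 2 * ((n : ℝ) + 1) ^ 2 * s) / 2) *
          (((n : ℝ) + 1) * Real.pi * x) * (((n : ℝ) + 1) * Real.pi * y) := by
          gcongr
          · exact hsin hx
          · exact hsin hy
      _ = Real.pi ^ 2 * (x * y) * (((n : ℝ) + 1) ^ 2 *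
          Real.exp (-(Real.pi ^ 2 * ((n : ℝ) + 1) ^ 2 * s) / 2)) := by ring
      _ ≤ Real.pi ^ 2 * (x * y) * (q * q ^ n) := by gcongr
      _ = _ := by ring
  have h := (le_abs_self _).trans (tsum_of_norm_bounded hgeom hbound)
  have hinv : (1 - q)⁻¹ ≤ 2 := by
    rw [inv_le_comm₀ (by linarith) (by norm_num)]
    linarith
  have h2 : Real.pi ^ 2 * (x * y) * q * (1 - q)⁻¹ ≤ Real.pi ^ 2 * (x * y) * q * 2 := by gcongr
  rw [w]
  linarith

lemma four_pi_sq_mul_exp_le {s : ℝ} (hs : 2 ≤ s) :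
    4 * Real.pi ^ 2 * Real.exp (1 - 9 / 2 * s) ≤
      (Real.sqrt (2 * Real.pi * s))⁻¹ * Real.exp (-(1 / 4)) * (2 / s) := by
  have hs0 : 0 < s := by linarith
  have hpi := Real.pi_lt_d2
  have hpi3 := Real.pi_gt_three
  have hsqrt : Real.sqrt (2 * Real.pi * s) ≤ 4 * s :=
    Real.sqrt_le_iff.mpr ⟨by positivity, by nlinarith⟩
  have hsp : 0 < Real.sqrt (2 * Real.pi * s) := by positivity
  have hexp3 : 19 ≤ Real.exp 3 := by
    have : Real.exp 3 = Real.exp 1 ^ 3 := by rw [← Real.exp_nat_mul]; norm_num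
    rw [this]
    calc (19 : ℝ) ≤ 2.7 ^ 3 := by norm_num
      _ ≤ _ := by gcongr; linarith [Real.exp_one_gt_d9]
  have hroot : 9 * s ≤ Real.exp (3 / 2 * s) := by
    have h1 : Real.exp (3 / 2 * s) = Real.exp 3 * Real.exp (3 / 2 * s - 3) := by
      rw [← Real.exp_add]; ring_nf
    rw [h1]
    nlinarith [Real.add_one_le_exp (3 / 2 * s - 3)]
  have hsq : 80 * s ^ 2 ≤ Real.exp (9 / 2 * s - 5 / 4) := by
    calc 80 * s ^ 2 ≤ (9 * s) ^ 2 := by nlinarith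
      _ ≤ Real.exp (3 / 2 * s) ^ 2 := by gcongr
      _ = Real.exp (3 * s) := by rw [← Real.exp_nat_mul]; push_cast; ring_nf
      _ ≤ _ := Real.exp_le_exp.mpr (by linarith)
  have hsplit : Real.exp (-(1 / 4)) = Real.exp (9 / 2 * s - 5 / 4) * Real.exp (1 - 9 / 2 * s) := by
    rw [← Real.exp_add]; ring_nf
  calc 4 * Real.pi ^ 2 * Real.exp (1 - 9 / 2 * s) ≤ 40 * Real.exp (1 - 9 / 2 * s) := by
        gcongr; nlinarith
    _ = (4 * s)⁻¹ * (80 * s ^ 2 * Real.exp (1 - 9 / 2 * s)) * (2 / s) := by field_simp; norm_num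
    _ ≤ _ := by rw [hsplit]; gcongr

theorem w_le_heat_kernel_min (s : ℝ) (hs : 0 < s) (x y : ℝ)
    (hx : x ∈ Set.Ioo (0 : ℝ) 1) (hy : y ∈ Set.Ioo (0 : ℝ) 1) :
    w s x y ≤ (Real.sqrt (2 * Real.pi * s))⁻¹ *
      Real.exp (-(x - y) ^ 2 / (2 * s)) * min 1 (2 * x * y / s) := by
  have hx' := hx
  have hy' := hy
  obtain ⟨hx0, hx1⟩ := hx'
  obtain ⟨hy0, hy1⟩ := hy'
  rcases le_total s 2 with h2 | h2
  · refine (w_le_of_le_two hs h2 hx hy).trans ?_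
    have e : Real.exp (-(x + y) ^ 2 / (2 * s)) =
        Real.exp (-(x - y) ^ 2 / (2 * s)) * Real.exp (-(2 * x * y / s)) := by
      rw [← Real.exp_add]
      congr 1
      field_simp
      ring
    rw [e, ← mul_one_sub, ← mul_assoc]
    refine mul_le_mul_of_nonneg_left (le_min ?_ ?_) (by positivity)
    · linarith [Real.exp_pos (-(2 * x * y / s))]
    · linarith [Real.add_one_le_exp (-(2 * x * y / s))]
  · have hmin : min 1 (2 * x * y / s) = 2 / s * (x * y) := by
      rw [min_eq_right]
      · ring
      · rw [div_le_one hs]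
        nlinarith [mul_lt_one_of_nonneg_of_lt_one_left hx0.le hx1 hy1.le]
    have hexp : Real.exp (-(1 / 4)) ≤ Real.exp (-(x - y) ^ 2 / (2 * s)) := by
      refine Real.exp_le_exp.mpr ?_
      rw [le_div_iff₀ (by positivity)]
      nlinarith [mul_pos hx0 hy0, mul_nonneg (sub_nonneg.mpr hx1.le) (sub_nonneg.mpr hy1.le)]
    rw [hmin]
    calc w s x y ≤ 4 * Real.pi ^ 2 * (x * y) * Real.exp (1 - 9 / 2 * s) :=
          w_le_of_two_le h2 hx0.le hy0.le
      _ = 4 * Real.pi ^ 2 * Real.exp (1 - 9 / 2 * s) * (x * y) := by ring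
      _ ≤ (Real.sqrt (2 * Real.pi * s))⁻¹ * Real.exp (-(1 / 4)) * (2 / s) * (x * y) :=
          mul_le_mul_of_nonneg_right (four_pi_sq_mul_exp_le h2) (by positivity)
      _ ≤ (Real.sqrt (2 * Real.pi * s))⁻¹ * Real.exp (-(x - y) ^ 2 / (2 * s)) * (2 / s) *
          (x * y) := by gcongr
      _ = _ := by ring
end

section
/- There exists a constant C > 0 such that for every s > 0 and all x, y ∈ (0,1), |∫_0^s e^{π²r/2}·w_r(x,y) dr − 2s·sin(πx)·sin(πy)| ≤ C·min(x,y)·(1 − max(x,y)). -/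
open Real intervalIntegral

open Finset in
/-- The **Abel inequality** for sums against a nonnegative antitone sequence. -/
lemma abs_sum_mul_le_of_antitone {f g : ℕ → ℝ} {B : ℝ} (hf : Antitone f) (hf0 : ∀ i, 0 ≤ f i)
    (hg : ∀ k, |∑ i ∈ range k, g i| ≤ B) (N : ℕ) :
    |∑ i ∈ range N, f i * g i| ≤ f 0 * B := by
  have hB : 0 ≤ B := by simpa using hg 0
  rcases N with _ | N
  · simpa using mul_nonneg (hf0 0) hB
  have parts : ∑ i ∈ range (N + 1), f i * g i = f N * ∑ i ∈ range (N + 1), g i +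
      ∑ i ∈ range N, (f i - f (i + 1)) * ∑ j ∈ range (i + 1), g j := by
    induction N with
    | zero => simp
    | succ N ih =>
      rw [sum_range_succ, ih, sum_range_succ (fun i => (f i - f (i + 1)) * _) N,
        sum_range_succ g (N + 1)]
      ring
  rw [parts]
  calc _ ≤ |f N * ∑ i ∈ range (N + 1), g i| +
        ∑ i ∈ range N, |(f i - f (i + 1)) * ∑ j ∈ range (i + 1), g j| :=
        (abs_add_le _ _).trans (by gcongr; exact abs_sum_le_sum_abs _ _)
    _ ≤ f N * B + ∑ i ∈ range N, (f i - f (i + 1)) * B := by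
        gcongr with i
        · rw [abs_mul, abs_of_nonneg (hf0 N)]
          exact mul_le_mul_of_nonneg_left (hg _) (hf0 N)
        · have h : 0 ≤ f i - f (i + 1) := sub_nonneg.2 (hf i.le_succ)
          rw [abs_mul, abs_of_nonneg h]
          exact mul_le_mul_of_nonneg_left (hg _) h
    _ = f 0 * B := by
        rw [← sum_mul, sum_range_sub']
        ring

open Finset in
lemma abs_sin_half_mul_abs_sum_sin_le (α φ : ℝ) (K : ℕ) :
    |sin (φ / 2)| * |∑ i ∈ range K, sin (α + i * φ)| ≤ 1 := by
  have h : 2 * (sin (φ / 2) * ∑ i ∈ range K, sin (α + i * φ)) =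
      cos (α - φ / 2) - cos (α + K * φ - φ / 2) := by
    induction K with
    | zero => simp
    | succ K ih =>
      rw [sum_range_succ, mul_add, mul_add, ih]
      have e : α + ((K + 1 : ℕ) : ℝ) * φ - φ / 2 = (α + K * φ) + φ / 2 := by push_cast; ring
      rw [e, cos_add, cos_sub (α + K * φ)]
      ring
  rw [← abs_mul]
  have h1 := abs_le.1 (abs_cos_le_one (α - φ / 2))
  have h2 := abs_le.1 (abs_cos_le_one (α + K * φ - φ / 2))
  rw [abs_le]
  constructor <;> linarith

lemma abs_sin_nat_mul_le_mul_abs_sin_s5 (n : ℕ) (φ : ℝ) : |sin (n * φ)| ≤ n * |sin φ| := by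
  induction n with
  | zero => simp
  | succ n ih =>
    rw [show ((n + 1 : ℕ) : ℝ) * φ = n * φ + φ by push_cast; ring, sin_add]
    calc _ ≤ |sin (n * φ)| * |cos φ| + |cos (n * φ)| * |sin φ| := by
          rw [← abs_mul, ← abs_mul]; exact abs_add_le _ _
      _ ≤ n * |sin φ| * 1 + 1 * |sin φ| := by
          gcongr
          · exact abs_cos_le_one _
          · exact abs_cos_le_one _
      _ = _ := by push_cast; ring

open Finset in
/-- The partial sums of the sawtooth series are uniformly bounded. -/
lemma abs_sum_sin_div_le (N : ℕ) (φ : ℝ) :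
    |∑ i ∈ range N, sin (((i : ℝ) + 1) * φ) / ((i : ℝ) + 1)| ≤ 3 := by
  set σ := |sin (φ / 2)| with hσ
  have term (i : ℕ) : |sin (((i : ℝ) + 1) * φ) / ((i : ℝ) + 1)| ≤ 2 * σ := by
    have h1 := abs_sin_nat_mul_le_mul_abs_sin_s5 (i + 1) φ
    have h2 : |sin φ| ≤ 2 * σ := by
      rw [show sin φ = 2 * sin (φ / 2) * cos (φ / 2) by rw [← sin_two_mul]; congr 1; ring,
        abs_mul, abs_mul, abs_two]
      exact mul_le_of_le_one_right (by positivity) (abs_cos_le_one _)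
    have hi : (0 : ℝ) < i + 1 := by positivity
    rw [abs_div, abs_of_pos hi, div_le_iff₀ hi]
    push_cast at h1
    nlinarith
  have head (M : ℕ) : |∑ i ∈ range M, sin (((i : ℝ) + 1) * φ) / ((i : ℝ) + 1)| ≤ M * (2 * σ) := by
    refine (abs_sum_le_sum_abs _ _).trans ((sum_le_sum fun i _ => term i).trans ?_)
    simp
  rcases (abs_nonneg (sin (φ / 2))).eq_or_lt with h0 | h0
  · have := head N
    rw [hσ, ← h0] at this
    linarith
  rw [← hσ] at h0
  set M := ⌊1 / σ⌋₊ with hM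
  have hMle : M * σ ≤ 1 := (le_div_iff₀ h0).1 (Nat.floor_le (by positivity))
  have hMlt : 1 ≤ (M + 1) * σ := ((div_lt_iff₀ h0).1 (Nat.lt_floor_add_one (1 / σ))).le
  rcases le_total N M with hN | hN
  · have h1 : (N : ℝ) ≤ M := by exact_mod_cast hN
    have := head N
    nlinarith
  obtain ⟨K, rfl⟩ := Nat.exists_eq_add_of_le hN
  rw [sum_range_add]
  have tail : |∑ i ∈ range K, sin (((M + i : ℕ) + 1 : ℝ) * φ) / ((M + i : ℕ) + 1 : ℝ)| ≤ 1 := by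
    have h := abs_sum_mul_le_of_antitone (f := fun i : ℕ => 1 / ((M : ℝ) + i + 1))
      (g := fun i : ℕ => sin ((M + 1) * φ + i * φ)) (B := 1 / σ)
      (fun i j hij => by
        have : (i : ℝ) ≤ j := by exact_mod_cast hij
        dsimp only
        gcongr) (fun i => by positivity)
      (fun k => by
        rw [le_div_iff₀ h0, mul_comm]
        exact abs_sin_half_mul_abs_sum_sin_le _ _ _) K
    have e : ∑ i ∈ range K, sin (((M + i : ℕ) + 1 : ℝ) * φ) / ((M + i : ℕ) + 1 : ℝ) =
        ∑ i ∈ range K, 1 / ((M : ℝ) + i + 1) * sin ((M + 1) * φ + i * φ) := by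
      refine sum_congr rfl fun i _ => ?_
      rw [show ((M + i : ℕ) + 1 : ℝ) * φ = (M + 1) * φ + i * φ by push_cast; ring]
      push_cast
      ring
    rw [e]
    refine h.trans ?_
    rw [Nat.cast_zero, add_zero, div_mul_div_comm, one_mul, div_le_one (by positivity)]
    exact hMlt
  have := head M
  refine (abs_add_le _ _).trans ?_
  linarith

open Finset in
/-- The mixed partial sums `∑ sin(na) cos(nb) / n` are uniformly bounded. -/
lemma abs_sum_sin_mul_cos_div_le (N : ℕ) (a b : ℝ) :
    |∑ i ∈ range N, sin (((i : ℝ) + 1) * a) * cos (((i : ℝ) + 1) * b) / ((i : ℝ) + 1)| ≤ 3 := by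
  have e : ∑ i ∈ range N, sin (((i : ℝ) + 1) * a) * cos (((i : ℝ) + 1) * b) / ((i : ℝ) + 1) =
      (∑ i ∈ range N, sin (((i : ℝ) + 1) * (a + b)) / ((i : ℝ) + 1) +
        ∑ i ∈ range N, sin (((i : ℝ) + 1) * (a - b)) / ((i : ℝ) + 1)) / 2 := by
    rw [← sum_add_distrib, sum_div]
    refine sum_congr rfl fun i _ => ?_
    rw [mul_add, mul_sub, sin_add, sin_sub]
    ring
  have h1 := abs_le.1 (abs_sum_sin_div_le N (a + b))
  have h2 := abs_le.1 (abs_sum_sin_div_le N (a - b))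
  rw [e, abs_le]
  constructor <;> linarith

open Finset in
lemma abs_sum_cos_le (N : ℕ) {φ : ℝ} (h1 : π / 3 ≤ φ) (h2 : φ ≤ 5 * π / 3) :
    |∑ i ∈ range N, cos (((i : ℝ) + 1) * φ)| ≤ 2 := by
  have hs : 1 / 2 ≤ sin (φ / 2) := by
    have hc : cos (π / 3) ≤ cos |φ / 2 - π / 2| :=
      cos_le_cos_of_nonneg_of_le_pi (abs_nonneg _) (by linarith [pi_pos])
        (abs_le.2 ⟨by linarith, by linarith⟩)
    rwa [cos_abs, cos_sub_pi_div_two, cos_pi_div_three] at hc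
  have h := abs_sin_half_mul_abs_sum_sin_le (φ + π / 2) φ N
  have e : ∑ i ∈ range N, cos (((i : ℝ) + 1) * φ) =
      ∑ i ∈ range N, sin (φ + π / 2 + i * φ) := by
    refine sum_congr rfl fun i _ => ?_
    rw [← sin_add_pi_div_two]
    congr 1
    ring
  rw [abs_of_nonneg (by linarith : 0 ≤ sin (φ / 2)), ← e] at h
  nlinarith [abs_nonneg (∑ i ∈ range N, cos (((i : ℝ) + 1) * φ))]

open Finset in
lemma hasDerivAt_sum_sin_mul_cos_div (N : ℕ) (a b : ℝ) :
    HasDerivAt (fun a => ∑ i ∈ range N, sin (((i : ℝ) + 1) * a) * cos (((i : ℝ) + 1) * b) /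
      ((i : ℝ) + 1))
      (∑ i ∈ range N, cos (((i : ℝ) + 1) * a) * cos (((i : ℝ) + 1) * b)) a := by
  refine HasDerivAt.fun_sum fun i _ => ?_
  have hi : (i : ℝ) + 1 ≠ 0 := by positivity
  have h := ((((hasDerivAt_id a).const_mul ((i : ℝ) + 1)).sin).mul_const
    (cos (((i : ℝ) + 1) * b))).div_const ((i : ℝ) + 1)
  refine h.congr_deriv ?_
  simp only [id]
  field_simp

open Finset in
lemma hasDerivAt_sum_sin_mul_sin_div_sq (N : ℕ) (a b : ℝ) :
    HasDerivAt (fun b => ∑ i ∈ range N, sin (((i : ℝ) + 1) * a) * sin (((i : ℝ) + 1) * b) /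
      ((i : ℝ) + 1) ^ 2)
      (∑ i ∈ range N, sin (((i : ℝ) + 1) * a) * cos (((i : ℝ) + 1) * b) / ((i : ℝ) + 1)) b := by
  refine HasDerivAt.fun_sum fun i _ => ?_
  have hi : (i : ℝ) + 1 ≠ 0 := by positivity
  have h := ((((hasDerivAt_id b).const_mul ((i : ℝ) + 1)).sin).const_mul
    (sin (((i : ℝ) + 1) * a))).div_const (((i : ℝ) + 1) ^ 2)
  refine h.congr_deriv ?_
  simp only [id]
  field_simp

open Finset in
lemma abs_sum_sin_mul_cos_div_le_two_mul (N : ℕ) {a b : ℝ} (ha : 0 ≤ a) (hb : b ≤ π)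
    (hab : a + (π - b) ≤ 2 * π / 3) :
    |∑ i ∈ range N, sin (((i : ℝ) + 1) * a) * cos (((i : ℝ) + 1) * b) / ((i : ℝ) + 1)|
      ≤ 2 * a := by
  have h := (convex_Icc 0 a).norm_image_sub_le_of_norm_hasDerivWithin_le (C := 2)
    (fun u _ => (hasDerivAt_sum_sin_mul_cos_div N u b).hasDerivWithinAt)
    (fun u hu => by
      obtain ⟨hu0, hua⟩ := hu
      have h1 := abs_le.1 (abs_sum_cos_le N (φ := b + u) (by linarith) (by linarith))
      have h2 := abs_le.1 (abs_sum_cos_le N (φ := b - u) (by linarith) (by linarith))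
      have e : ∑ i ∈ range N, cos (((i : ℝ) + 1) * u) * cos (((i : ℝ) + 1) * b) =
          (∑ i ∈ range N, cos (((i : ℝ) + 1) * (b + u)) +
            ∑ i ∈ range N, cos (((i : ℝ) + 1) * (b - u))) / 2 := by
        rw [← sum_add_distrib, sum_div]
        refine sum_congr rfl fun i _ => ?_
        rw [mul_add, mul_sub, cos_add, cos_sub]
        ring
      rw [norm_eq_abs, e, abs_le]
      constructor <;> linarith)
    (Set.left_mem_Icc.2 ha) (Set.right_mem_Icc.2 ha)
  simpa [abs_of_nonneg ha] using h

open Finset in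
lemma abs_sum_sin_mul_sin_div_sq_le_left (N : ℕ) (a b : ℝ) :
    |∑ i ∈ range N, sin (((i : ℝ) + 1) * a) * sin (((i : ℝ) + 1) * b) / ((i : ℝ) + 1) ^ 2|
      ≤ 3 * |b| := by
  have h := convex_univ.norm_image_sub_le_of_norm_hasDerivWithin_le (C := 3)
    (fun u _ => (hasDerivAt_sum_sin_mul_sin_div_sq N a u).hasDerivWithinAt)
    (fun u _ => abs_sum_sin_mul_cos_div_le N a u) (Set.mem_univ 0) (Set.mem_univ b)
  simpa using h

lemma sin_nat_add_one_mul_pi (i : ℕ) : sin (((i : ℝ) + 1) * π) = 0 := by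
  exact_mod_cast sin_nat_mul_pi (i + 1)

open Finset in
lemma abs_sum_sin_mul_sin_div_sq_le_right (N : ℕ) (a b : ℝ) :
    |∑ i ∈ range N, sin (((i : ℝ) + 1) * a) * sin (((i : ℝ) + 1) * b) / ((i : ℝ) + 1) ^ 2|
      ≤ 3 * |b - π| := by
  have h := convex_univ.norm_image_sub_le_of_norm_hasDerivWithin_le (C := 3)
    (fun u _ => (hasDerivAt_sum_sin_mul_sin_div_sq N a u).hasDerivWithinAt)
    (fun u _ => abs_sum_sin_mul_cos_div_le N a u) (Set.mem_univ π) (Set.mem_univ b)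
  simpa [sin_nat_add_one_mul_pi] using h

open Finset in
/-- The partial Fourier sums of the Green function of the interval `(0, π)` are bounded by a
multiple of the Green function. -/
lemma abs_sum_sin_mul_sin_div_sq_le (N : ℕ) {a b : ℝ} (ha : 0 ≤ a) (hb : b ≤ π) :
    |∑ i ∈ range N, sin (((i : ℝ) + 1) * a) * sin (((i : ℝ) + 1) * b) / ((i : ℝ) + 1) ^ 2|
      ≤ 3 * a * (π - b) := by
  rcases le_total (a + (π - b)) (2 * π / 3) with hab | hab
  · have h := (convex_Icc b π).norm_image_sub_le_of_norm_hasDerivWithin_le (C := 2 * a)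
      (fun u _ => (hasDerivAt_sum_sin_mul_sin_div_sq N a u).hasDerivWithinAt)
      (fun u hu => abs_sum_sin_mul_cos_div_le_two_mul N ha hu.2 (by linarith [hu.1]))
      (Set.right_mem_Icc.2 hb) (Set.left_mem_Icc.2 hb)
    have h' : |∑ i ∈ range N, sin (((i : ℝ) + 1) * a) * sin (((i : ℝ) + 1) * b) /
        ((i : ℝ) + 1) ^ 2| ≤ 2 * a * |b - π| := by
      simpa [sin_nat_add_one_mul_pi] using h
    rw [abs_sub_comm, abs_of_nonneg (sub_nonneg.2 hb)] at h'
    nlinarith [mul_nonneg ha (sub_nonneg.2 hb)]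
  have hπ := pi_gt_three
  rcases le_total (π / 3) a with ha1 | ha1
  · have h := abs_sum_sin_mul_sin_div_sq_le_right N a b
    rw [abs_sub_comm, abs_of_nonneg (sub_nonneg.2 hb)] at h
    nlinarith [sub_nonneg.2 hb]
  · have h := abs_sum_sin_mul_sin_div_sq_le_left N b a
    simp_rw [mul_comm (sin (_ * b))] at h
    rw [abs_of_nonneg ha] at h
    nlinarith

open Finset in
lemma abs_sum_sub_exp_mul_sin_mul_sin_div_le {c a b : ℝ} (hc : 0 ≤ c) (ha : 0 ≤ a) (hb : b ≤ π)
    (N : ℕ) :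
    |∑ i ∈ range N, (1 - exp (-(c * (((i : ℝ) + 2) ^ 2 - 1)))) / (((i : ℝ) + 2) ^ 2 - 1) *
      (sin (((i : ℝ) + 2) * a) * sin (((i : ℝ) + 2) * b))| ≤ 16 * a * (π - b) := by
  have hq (i : ℕ) : (0 : ℝ) < ((i : ℝ) + 2) ^ 2 - 1 := by
    nlinarith [(Nat.cast_nonneg i : (0 : ℝ) ≤ i)]
  set d : ℕ → ℝ := fun i => sin (((i : ℝ) + 2) * a) * sin (((i : ℝ) + 2) * b) / ((i : ℝ) + 2) ^ 2
  set q : ℕ → ℝ := fun i => 1 + 1 / (((i : ℝ) + 2) ^ 2 - 1)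
  set e : ℕ → ℝ := fun i => exp (-(c * (((i : ℝ) + 2) ^ 2 - 1)))
  have hd (k : ℕ) : |∑ i ∈ range k, d i| ≤ 6 * a * (π - b) := by
    have h1 := abs_sum_sin_mul_sin_div_sq_le 1 ha hb
    have h2 := abs_sum_sin_mul_sin_div_sq_le (k + 1) ha hb
    have hs : ∑ i ∈ range k, d i = ∑ i ∈ range k, sin ((((i + 1 : ℕ) : ℝ) + 1) * a) *
        sin ((((i + 1 : ℕ) : ℝ) + 1) * b) / (((i + 1 : ℕ) : ℝ) + 1) ^ 2 := by
      refine sum_congr rfl fun i _ => ?_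
      have : ((i + 1 : ℕ) : ℝ) + 1 = i + 2 := by push_cast; ring
      rw [this]
    rw [sum_range_succ', ← hs] at h2
    rw [sum_range_one] at h1
    rw [abs_le] at *
    constructor <;> linarith
  have hqd (k : ℕ) : |∑ i ∈ range k, q i * d i| ≤ 8 * a * (π - b) := by
    refine (abs_sum_mul_le_of_antitone (fun i j hij => ?_) (fun i => ?_) hd k).trans_eq ?_
    · have : (i : ℝ) ≤ j := by exact_mod_cast hij
      have := hq i
      dsimp only [q]
      gcongr
    · have := hq i
      dsimp only [q]
      positivity
    · norm_num [q]
      ring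
  have hab : 0 ≤ 8 * a * (π - b) := by simpa using hqd 0
  have he : |∑ i ∈ range N, e i * (q i * d i)| ≤ 8 * a * (π - b) := by
    refine (abs_sum_mul_le_of_antitone (fun i j hij => ?_) (fun i => (exp_pos _).le)
      hqd N).trans ?_
    · have : (i : ℝ) ≤ j := by exact_mod_cast hij
      gcongr
    · refine mul_le_of_le_one_left hab (exp_le_one_iff.2 ?_)
      exact neg_nonpos.2 (mul_nonneg hc (hq 0).le)
  have hsum : ∑ i ∈ range N, (1 - exp (-(c * (((i : ℝ) + 2) ^ 2 - 1)))) /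
      (((i : ℝ) + 2) ^ 2 - 1) * (sin (((i : ℝ) + 2) * a) * sin (((i : ℝ) + 2) * b)) =
      ∑ i ∈ range N, q i * d i - ∑ i ∈ range N, e i * (q i * d i) := by
    rw [← sum_sub_distrib]
    refine sum_congr rfl fun i _ => ?_
    have h1 := (hq i).ne'
    have h2 : (i : ℝ) + 2 ≠ 0 := by positivity
    dsimp only [q, d, e]
    field_simp
    ring
  have := hqd N
  rw [hsum]
  rw [abs_le] at *
  constructor <;> linarith

lemma integral_exp_neg_mul {k : ℝ} (hk : k ≠ 0) (s : ℝ) :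
    ∫ r in (0 : ℝ)..s, exp (-(k * r)) = (1 - exp (-(k * s))) / k := by
  have h (r : ℝ) : HasDerivAt (fun r => -exp (-(k * r)) / k) (exp (-(k * r))) r := by
    have h := ((((hasDerivAt_id r).const_mul k).fun_neg.exp).fun_neg).div_const k
    refine h.congr_deriv ?_
    simp only [id]
    field_simp
  rw [integral_eq_sub_of_hasDerivAt (fun r _ => h r)
    (Continuous.intervalIntegrable (by fun_prop) _ _)]
  simp only [mul_zero, neg_zero, exp_zero]
  ring

/-- The `n`-th Fourier mode, `n = i + 1`, of `e^{π² r / 2} w_r(x, y)`. -/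
noncomputable def tiltedMode (x y : ℝ) (i : ℕ) (r : ℝ) : ℝ :=
  2 * exp (-(π ^ 2 / 2 * (((i : ℝ) + 1) ^ 2 - 1) * r)) *
    (sin (((i : ℝ) + 1) * π * x) * sin (((i : ℝ) + 1) * π * y))

lemma exp_mul_w_eq_tsum (x y r : ℝ) :
    exp (π ^ 2 * r / 2) * w r x y = ∑' i, tiltedMode x y i r := by
  rw [w, ← mul_assoc, ← tsum_mul_left]
  refine tsum_congr fun i => ?_
  rw [tiltedMode, show -(π ^ 2 / 2 * (((i : ℝ) + 1) ^ 2 - 1) * r) =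
    π ^ 2 * r / 2 + -(π ^ 2 * ((i : ℝ) + 1) ^ 2 * r) / 2 by ring, exp_add]
  ring

lemma integral_tiltedMode_zero (x y s : ℝ) :
    ∫ r in (0 : ℝ)..s, tiltedMode x y 0 r = 2 * s * sin (π * x) * sin (π * y) := by
  simp [tiltedMode]
  ring

lemma integral_tiltedMode_succ (x y s : ℝ) (i : ℕ) :
    ∫ r in (0 : ℝ)..s, tiltedMode x y (i + 1) r =
      4 / π ^ 2 * ((1 - exp (-(π ^ 2 / 2 * s * (((i : ℝ) + 2) ^ 2 - 1)))) /
        (((i : ℝ) + 2) ^ 2 - 1) *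
        (sin (((i : ℝ) + 2) * (π * x)) * sin (((i : ℝ) + 2) * (π * y)))) := by
  have hq : ((i : ℝ) + 2) ^ 2 - 1 ≠ 0 := by
    nlinarith [(Nat.cast_nonneg i : (0 : ℝ) ≤ i)]
  have hk : π ^ 2 / 2 * (((i : ℝ) + 2) ^ 2 - 1) ≠ 0 := by positivity
  have hi : ((i + 1 : ℕ) : ℝ) + 1 = i + 2 := by push_cast; ring
  simp_rw [tiltedMode, hi, mul_assoc ((i : ℝ) + 2)]
  rw [integral_mul_const, integral_const_mul, integral_exp_neg_mul hk,
    mul_right_comm _ _ s]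
  field_simp
  ring

open MeasureTheory in
lemma hasSum_integral_tiltedMode (x y : ℝ) {s : ℝ} (hs : 0 ≤ s) :
    HasSum (fun i => ∫ r in (0 : ℝ)..s, tiltedMode x y i r)
      (∫ r in (0 : ℝ)..s, exp (π ^ 2 * r / 2) * w r x y) := by
  simp_rw [exp_mul_w_eq_tsum, integral_of_le hs]
  have hcont (i : ℕ) : Continuous (tiltedMode x y i) := by unfold tiltedMode; fun_prop
  refine hasSum_integral_of_summable_integral_norm
    (fun i => (hcont i).integrableOn_Ioc) ?_
  rw [← summable_nat_add_iff 1]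
  have hsum : Summable fun i : ℕ => 4 / π ^ 2 * (1 / ((i + 1 : ℕ) : ℝ) ^ 2) :=
    ((summable_nat_add_iff 1).2 (Real.summable_one_div_nat_pow.2 one_lt_two)).mul_left _
  refine Summable.of_nonneg_of_le (fun i => integral_nonneg fun r => norm_nonneg _)
    (fun i => ?_) hsum
  have hi0 : (0 : ℝ) ≤ i := Nat.cast_nonneg i
  set q : ℝ := (((i + 1 : ℕ) : ℝ) + 1) ^ 2 - 1 with hq
  have hqle : ((i + 1 : ℕ) : ℝ) ^ 2 ≤ q := by rw [hq]; push_cast; nlinarith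
  have hqpos : 0 < q := lt_of_lt_of_le (by positivity) hqle
  have hk : 0 < π ^ 2 / 2 * q := by positivity
  calc ∫ r in Set.Ioc 0 s, ‖tiltedMode x y (i + 1) r‖
      ≤ ∫ r in Set.Ioc 0 s, 2 * exp (-(π ^ 2 / 2 * q * r)) := by
        refine integral_mono (hcont _).norm.integrableOn_Ioc
          (Continuous.integrableOn_Ioc (by fun_prop)) fun r => ?_
        dsimp only
        rw [tiltedMode, norm_mul, norm_of_nonneg (by positivity : 0 ≤ 2 * exp _), norm_eq_abs,
          abs_mul]
        exact mul_le_of_le_one_right (by positivity)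
          (mul_le_one₀ (abs_sin_le_one _) (abs_nonneg _) (abs_sin_le_one _))
    _ = 2 * ((1 - exp (-(π ^ 2 / 2 * q * s))) / (π ^ 2 / 2 * q)) := by
        rw [← integral_of_le hs, intervalIntegral.integral_const_mul, integral_exp_neg_mul hk.ne']
    _ ≤ 2 * (1 / (π ^ 2 / 2 * q)) := by
        gcongr
        linarith [exp_pos (-(π ^ 2 / 2 * q * s))]
    _ = 4 / π ^ 2 * (1 / q) := by
        field_simp
        norm_num
    _ ≤ _ := by gcongr

open Finset Filter in
lemma abs_integral_exp_mul_w_sub_le {s x y : ℝ} (hs : 0 ≤ s) (hx : 0 ≤ x) (hy : y ≤ 1) :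
    |(∫ r in (0 : ℝ)..s, exp (π ^ 2 * r / 2) * w r x y) - 2 * s * sin (π * x) * sin (π * y)|
      ≤ 64 * x * (1 - y) := by
  have hlim := ((tendsto_add_atTop_iff_nat 1).2
    (hasSum_integral_tiltedMode x y hs).tendsto_sum_nat).sub_const
    (2 * s * sin (π * x) * sin (π * y))
  refine le_of_tendsto hlim.abs (Eventually.of_forall fun N => ?_)
  have h := abs_sum_sub_exp_mul_sin_mul_sin_div_le (c := π ^ 2 / 2 * s) (a := π * x) (b := π * y)
    (by positivity) (by positivity) (mul_le_of_le_one_right pi_pos.le hy) N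
  rw [sum_range_succ', integral_tiltedMode_zero, add_sub_cancel_right]
  simp_rw [integral_tiltedMode_succ]
  rw [← mul_sum, abs_mul, abs_of_nonneg (by positivity : 0 ≤ 4 / π ^ 2)]
  refine (mul_le_mul_of_nonneg_left h (by positivity)).trans_eq ?_
  field_simp
  ring

lemma w_comm (r x y : ℝ) : w r x y = w r y x := by
  simp only [w, mul_right_comm]

theorem integral_exp_mul_w_approx :
    ∃ C : ℝ, 0 < C ∧ ∀ s : ℝ, 0 < s → ∀ x y : ℝ,
      x ∈ Set.Ioo (0 : ℝ) 1 → y ∈ Set.Ioo (0 : ℝ) 1 →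
      |(∫ r in (0 : ℝ)..s, Real.exp (Real.pi ^ 2 * r / 2) * w r x y) -
          2 * s * Real.sin (Real.pi * x) * Real.sin (Real.pi * y)|
        ≤ C * min x y * (1 - max x y) := by
  refine ⟨64, by norm_num, fun s hs x y hx hy => ?_⟩
  rcases le_total x y with h | h
  · rw [min_eq_left h, max_eq_right h]
    exact abs_integral_exp_mul_w_sub_le hs.le hx.1.le hy.2.le
  · rw [min_eq_right h, max_eq_left h, mul_right_comm]
    simp_rw [w_comm _ x y]
    exact abs_integral_exp_mul_w_sub_le hs.le hy.1.le hx.2.le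
end

section
/- There exists a constant C > 0 such that for every s > 0 and every x ∈ (0,1), |∫_0^s e^{π²r/2}·π·∑_{n=1}^∞ (−1)^{n+1}·n·e^{−π²n²r/2}·sin(nπx) dr − πs·sin(πx)| ≤ C·x. -/
open Real intervalIntegral

open Filter Topology MeasureTheory

/-- The heat flow out of the boundary point `1` at time `r`, for Brownian motion on `(0,1)` started
at `x` and killed at the endpoints. -/
noncomputable def boundaryFlow (r x : ℝ) : ℝ :=
  π * ∑' n : ℕ, (-1 : ℝ) ^ n * ((n : ℝ) + 1) * exp (-(π ^ 2 * ((n : ℝ) + 1) ^ 2 * r) / 2) *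
    sin (((n : ℝ) + 1) * π * x)

/-- The sine series, for `r > 0`, of the probability that Brownian motion started at `x` leaves
`(0,1)` through `1` before time `r`. -/
noncomputable def exitProb (r x : ℝ) : ℝ :=
  x - 2 / π * ∑' n : ℕ, (-1 : ℝ) ^ n / ((n : ℝ) + 1) *
    exp (-(π ^ 2 * ((n : ℝ) + 1) ^ 2 * r) / 2) * sin (((n : ℝ) + 1) * π * x)

theorem summable_pow_mul_gaussian (k : ℕ) {r : ℝ} (hr : 0 < r) :
    Summable fun n : ℕ ↦ ((n : ℝ) + 1) ^ k * exp (-(π ^ 2 * ((n : ℝ) + 1) ^ 2 * r) / 2) := by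
  have h := (summable_nat_add_iff 1).mpr
    (summable_pow_mul_exp_neg_nat_mul k (r := π ^ 2 * r / 2) (by positivity))
  refine h.of_nonneg_of_le (fun n ↦ by positivity) fun n ↦ ?_
  push_cast
  gcongr
  have : (0 : ℝ) ≤ n := n.cast_nonneg
  have h2 : (n : ℝ) + 1 ≤ (n + 1) ^ 2 := by nlinarith
  have h3 : 0 < π ^ 2 * r := by positivity
  nlinarith

theorem norm_alternating_mul_gaussian_mul_le {a b c : ℝ} (n : ℕ) (ha : 0 ≤ a) (hb : 0 ≤ b)
    (hc : |c| ≤ 1) : ‖(-1 : ℝ) ^ n * a * b * c‖ ≤ a * b := by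
  rw [norm_eq_abs, abs_mul, abs_mul, abs_mul, abs_pow, abs_neg, abs_one, one_pow, one_mul,
    abs_of_nonneg ha, abs_of_nonneg hb]
  exact mul_le_of_le_one_right (by positivity) hc

theorem summable_boundaryFlow {r : ℝ} (hr : 0 < r) (x : ℝ) :
    Summable fun n : ℕ ↦ (-1 : ℝ) ^ n * ((n : ℝ) + 1) *
      exp (-(π ^ 2 * ((n : ℝ) + 1) ^ 2 * r) / 2) * sin (((n : ℝ) + 1) * π * x) := by
  refine .of_norm_bounded (summable_pow_mul_gaussian 1 hr) fun n ↦ ?_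
  rw [pow_one]
  exact norm_alternating_mul_gaussian_mul_le n (by positivity) (by positivity) (abs_sin_le_one _)

theorem summable_exitProb {r : ℝ} (hr : 0 < r) (x : ℝ) :
    Summable fun n : ℕ ↦ (-1 : ℝ) ^ n / ((n : ℝ) + 1) *
      exp (-(π ^ 2 * ((n : ℝ) + 1) ^ 2 * r) / 2) * sin (((n : ℝ) + 1) * π * x) := by
  refine .of_norm_bounded (summable_pow_mul_gaussian 0 hr) fun n ↦ ?_
  rw [div_eq_mul_inv]
  refine (norm_alternating_mul_gaussian_mul_le n (by positivity) (by positivity)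
    (abs_sin_le_one _)).trans ?_
  gcongr
  rw [pow_zero]
  exact inv_le_one_of_one_le₀ (by linarith [n.cast_nonneg (α := ℝ)])

theorem hasDerivAt_exitProb_time {r : ℝ} (hr : 0 < r) (x : ℝ) :
    HasDerivAt (fun r ↦ exitProb r x) (boundaryFlow r x) r := by
  have h := hasDerivAt_tsum_of_isPreconnected (summable_pow_mul_gaussian 1 (half_pos hr)
      |>.mul_left (π ^ 2 / 2)) (isOpen_Ioi (a := r / 2)) isPreconnected_Ioi
    (g := fun (n : ℕ) (r : ℝ) ↦ (-1 : ℝ) ^ n / ((n : ℝ) + 1) *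
      exp (-(π ^ 2 * ((n : ℝ) + 1) ^ 2 * r) / 2) * sin (((n : ℝ) + 1) * π * x))
    (g' := fun (n : ℕ) (r : ℝ) ↦ -(π ^ 2 / 2) * ((-1 : ℝ) ^ n * ((n : ℝ) + 1) *
      exp (-(π ^ 2 * ((n : ℝ) + 1) ^ 2 * r) / 2) * sin (((n : ℝ) + 1) * π * x)))
    (y₀ := r) (y := r) ?_ ?_ (by simpa using hr) (summable_exitProb hr x) (by simpa using hr)
  · refine ((h.const_mul (2 / π)).const_sub x).congr_deriv ?_
    have hc (S : ℝ) : -(2 / π * (-(π ^ 2 / 2) * S)) = π * S := by field_simp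
    rw [tsum_mul_left, boundaryFlow, hc]
  · intro n t _
    have h1 : HasDerivAt (fun t : ℝ ↦ -(π ^ 2 * ((n : ℝ) + 1) ^ 2 * t) / 2)
        (-(π ^ 2 * ((n : ℝ) + 1) ^ 2) / 2) t := by
      simpa using (((hasDerivAt_id t).const_mul (π ^ 2 * ((n : ℝ) + 1) ^ 2)).neg.div_const 2)
    refine ((h1.exp.const_mul _).mul_const _).congr_deriv ?_
    have : (n : ℝ) + 1 ≠ 0 := by positivity
    field_simp
  · intro n t ht
    rw [norm_mul, norm_neg, norm_of_nonneg (by positivity : 0 ≤ π ^ 2 / 2), pow_one]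
    gcongr
    refine (norm_alternating_mul_gaussian_mul_le n (by positivity) (by positivity)
      (abs_sin_le_one _)).trans ?_
    gcongr
    exact le_of_lt ht

theorem hasDerivAt_exitProb_space {r : ℝ} (hr : 0 < r) (x : ℝ) :
    HasDerivAt (exitProb r) (HurwitzZeta.cosKernel (((x + 1) / 2 : ℝ)) (π * r / 2)) x := by
  have h := hasDerivAt_tsum (summable_pow_mul_gaussian 0 hr |>.mul_left π)
    (g := fun (n : ℕ) (x : ℝ) ↦ (-1 : ℝ) ^ n / ((n : ℝ) + 1) *
      exp (-(π ^ 2 * ((n : ℝ) + 1) ^ 2 * r) / 2) * sin (((n : ℝ) + 1) * π * x))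
    (g' := fun (n : ℕ) (x : ℝ) ↦ π * ((-1 : ℝ) ^ n * 1 *
      exp (-(π ^ 2 * ((n : ℝ) + 1) ^ 2 * r) / 2) * cos (((n : ℝ) + 1) * π * x)))
    (y₀ := x) ?_ ?_ (summable_exitProb hr x) x
  · refine ((hasDerivAt_id x).sub (h.const_mul (2 / π))).congr_deriv ?_
    have hk := HurwitzZeta.hasSum_nat_cosKernel₀ ((x + 1) / 2) (t := π * r / 2) (by positivity)
    rw [tsum_mul_left, ← mul_assoc, div_mul_cancel₀ _ pi_ne_zero, sub_eq_iff_eq_add,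
      ← sub_eq_iff_eq_add', ← neg_inj, neg_sub, ← tsum_mul_left, ← hk.tsum_eq, ← tsum_neg]
    refine tsum_congr fun n ↦ ?_
    have h1 : 2 * π * ((x + 1) / 2) * ((n : ℝ) + 1)
        = (n + 1) * π * x + (n + 1 : ℕ) * π := by push_cast; ring
    have h2 : -π * ((n : ℝ) + 1) ^ 2 * (π * r / 2) = -(π ^ 2 * ((n : ℝ) + 1) ^ 2 * r) / 2 := by
      ring
    rw [h1, h2, cos_add_nat_mul_pi]
    ring
  · intro n t
    have h1 : HasDerivAt (fun t : ℝ ↦ ((n : ℝ) + 1) * π * t) (((n : ℝ) + 1) * π) t := by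
      simpa using (hasDerivAt_id t).const_mul (((n : ℝ) + 1) * π)
    refine (h1.sin.const_mul _).congr_deriv ?_
    have : (n : ℝ) + 1 ≠ 0 := by positivity
    field_simp
  · intro n t
    rw [norm_mul, norm_of_nonneg pi_pos.le, pow_zero]
    gcongr
    exact norm_alternating_mul_gaussian_mul_le n zero_le_one (by positivity) (abs_cos_le_one _)

theorem exp_neg_le_two_div_sq {u : ℝ} (hu : 0 < u) : exp (-u) ≤ 2 / u ^ 2 := by
  have h := quadratic_le_exp_of_nonneg hu.le
  rw [exp_neg, inv_eq_one_div, div_le_div_iff₀ (exp_pos _) (by positivity)]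
  linarith

namespace HurwitzZeta

theorem cosKernel_eq_rpow_mul_evenKernel (a : UnitAddCircle) {t : ℝ} (ht : 0 < t) :
    cosKernel a t = (1 / t) ^ (1 / 2 : ℝ) * evenKernel a (1 / t) := by
  rw [evenKernel_functional_equation, one_div_one_div, ← mul_assoc, mul_one_div_cancel, one_mul]
  positivity

theorem evenKernel_nonneg (a : ℝ) {t : ℝ} (ht : 0 < t) : 0 ≤ evenKernel a t :=
  (hasSum_int_evenKernel a ht).nonneg fun _ ↦ (exp_pos _).le

theorem cosKernel_nonneg (a : ℝ) {t : ℝ} (ht : 0 < t) : 0 ≤ cosKernel a t := by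
  rw [cosKernel_eq_rpow_mul_evenKernel _ ht]
  exact mul_nonneg (by positivity) (evenKernel_nonneg a (by positivity))

theorem cosKernel_le_cosKernel_zero (a : ℝ) {t : ℝ} (ht : 0 < t) :
    cosKernel a t ≤ cosKernel (0 : ℝ) t := by
  have h := hasSum_le (fun n : ℕ ↦ ?_) (hasSum_nat_cosKernel₀ a ht) (hasSum_nat_cosKernel₀ 0 ht)
  · linarith
  · gcongr
    simpa using cos_le_one _

theorem evenKernel_le_evenKernel_zero (a : ℝ) {t : ℝ} (ht : 0 < t) :
    evenKernel a t ≤ evenKernel (0 : ℝ) t := by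
  rw [evenKernel_functional_equation, evenKernel_functional_equation (0 : ℝ)]
  gcongr
  exact cosKernel_le_cosKernel_zero a (by positivity)

theorem cosKernel_le_mul_of_le_abs {a d t : ℝ} (hd : 0 < d) (had : ∀ n : ℤ, d ≤ |n + a|)
    (ht : 0 < t) (ht1 : t ≤ 1) : cosKernel a t ≤ evenKernel (0 : ℝ) (1 / 2) / d ^ 4 * t := by
  have h1 : evenKernel a (1 / t) ≤ exp (-(π * d ^ 2 / (2 * t))) * evenKernel a (1 / 2) := by
    refine hasSum_le (fun n ↦ ?_) (hasSum_int_evenKernel a (by positivity))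
      ((hasSum_int_evenKernel a one_half_pos).mul_left _)
    rw [← exp_add, exp_le_exp]
    have hsq : d ^ 2 ≤ (n + a) ^ 2 := by
      rw [← sq_abs ((n : ℝ) + a)]
      gcongr
      exact had n
    have h2 : π * d ^ 2 / (2 * t) ≤ π * (n + a) ^ 2 / (2 * t) := by gcongr
    have h3 : π * (n + a) ^ 2 / 2 ≤ π * (n + a) ^ 2 / (2 * t) := by
      gcongr
      linarith
    have h4 : -π * (n + a) ^ 2 * (1 / t)
        = -(π * (n + a) ^ 2 / (2 * t)) - π * (n + a) ^ 2 / (2 * t) := by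
      field_simp
      ring
    linarith
  have h2 : exp (-(π * d ^ 2 / (2 * t))) ≤ t ^ 2 / d ^ 4 := by
    refine (exp_neg_le_two_div_sq (by positivity)).trans ?_
    rw [div_pow, div_div_eq_mul_div, div_le_div_iff₀ (by positivity) (by positivity)]
    have h3 : 8 ≤ π ^ 2 := by nlinarith [pi_gt_three]
    have h4 : 0 ≤ t ^ 2 * d ^ 4 := by positivity
    nlinarith
  have h3 : (1 / t) ^ (1 / 2 : ℝ) ≤ 1 / t := by
    have h : 1 ≤ 1 / t := by rwa [le_div_iff₀ ht, one_mul]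
    simpa using rpow_le_rpow_of_exponent_le h (by norm_num : (1 / 2 : ℝ) ≤ 1)
  have hK := evenKernel_le_evenKernel_zero a one_half_pos
  have h0 := evenKernel_nonneg a one_half_pos
  calc cosKernel a t = (1 / t) ^ (1 / 2 : ℝ) * evenKernel a (1 / t) :=
        cosKernel_eq_rpow_mul_evenKernel _ ht
    _ ≤ 1 / t * (t ^ 2 / d ^ 4 * evenKernel (0 : ℝ) (1 / 2)) := by
        gcongr
        · exact evenKernel_nonneg a (by positivity)
        · exact h1.trans (by gcongr)
    _ = _ := by field_simp

theorem tendsto_sinKernel_nhdsGT_zero (a : UnitAddCircle) :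
    Tendsto (sinKernel a) (𝓝[>] 0) (𝓝 0) := by
  have h1 : Tendsto (fun x : ℝ ↦ x ^ (3 / 2 : ℝ) * oddKernel a x) atTop (𝓝 0) := by
    obtain ⟨p, hp, h⟩ := isBigO_atTop_oddKernel a
    exact ((Asymptotics.isBigO_refl (fun x : ℝ ↦ x ^ (3 / 2 : ℝ)) atTop).mul h).trans_tendsto
      (tendsto_rpow_mul_exp_neg_mul_atTop_nhds_zero _ _ hp)
  refine (h1.comp tendsto_inv_nhdsGT_zero).congr' ?_
  filter_upwards [self_mem_nhdsWithin] with t ht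
  have ht : 0 < t := ht
  simp only [Function.comp_apply]
  rw [oddKernel_functional_equation, ← mul_assoc, mul_one_div_cancel (by positivity), one_mul,
    one_div, inv_inv]

theorem continuousOn_sinKernel_Ici (a : UnitAddCircle) :
    ContinuousOn (sinKernel a) (Set.Ici 0) := by
  intro t ht
  rcases (show 0 ≤ t from ht).eq_or_lt with rfl | ht
  · rw [← Set.Ioi_insert, continuousWithinAt_insert_self, ContinuousWithinAt,
      sinKernel_undef a le_rfl]
    exact tendsto_sinKernel_nhdsGT_zero a
  · exact ((continuousOn_sinKernel a).continuousAt (Ioi_mem_nhds ht)).continuousWithinAt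

end HurwitzZeta

theorem boundaryFlow_eq_sinKernel {r : ℝ} (hr : 0 < r) (x : ℝ) :
    boundaryFlow r x = -(π / 2) * HurwitzZeta.sinKernel (((x + 1) / 2 : ℝ)) (π * r / 2) := by
  have h := HurwitzZeta.hasSum_nat_sinKernel ((x + 1) / 2) (t := π * r / 2) (by positivity)
  rw [← h.tsum_eq, h.summable.tsum_eq_zero_add, boundaryFlow, ← tsum_mul_left]
  simp only [Nat.cast_zero, mul_zero, zero_mul, zero_add]
  rw [← tsum_mul_left]
  refine tsum_congr fun n ↦ ?_
  have h1 : 2 * π * ((x + 1) / 2) * ((n + 1 : ℕ) : ℝ)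
      = (n + 1) * π * x + (n + 1 : ℕ) * π := by push_cast; ring
  have h2 : -π * ((n + 1 : ℕ) : ℝ) ^ 2 * (π * r / 2) = -(π ^ 2 * ((n : ℝ) + 1) ^ 2 * r) / 2 := by
    push_cast; ring
  rw [h1, h2, sin_add_nat_mul_pi]
  push_cast
  ring

theorem intervalIntegrable_boundaryFlow {s : ℝ} (hs : 0 ≤ s) (x : ℝ) :
    IntervalIntegrable (fun r ↦ boundaryFlow r x) volume 0 s := by
  have h : ContinuousOn (fun r ↦ -(π / 2) *
      HurwitzZeta.sinKernel (((x + 1) / 2 : ℝ)) (π * r / 2)) (Set.uIcc 0 s) := by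
    refine continuousOn_const.mul ((HurwitzZeta.continuousOn_sinKernel_Ici _).comp
      (by fun_prop) fun r hr ↦ ?_)
    rw [Set.uIcc_of_le hs] at hr
    have := hr.1
    exact Set.mem_Ici.mpr (by positivity)
  refine h.intervalIntegrable.congr fun r hr ↦ ?_
  rw [Set.uIoc_of_le hs] at hr
  exact (boundaryFlow_eq_sinKernel hr.1 x).symm

theorem exitProb_zero_right (r : ℝ) : exitProb r 0 = 0 := by
  simp [exitProb]

theorem exitProb_one_right (r : ℝ) : exitProb r 1 = 1 := by
  have h (n : ℕ) : sin (((n : ℝ) + 1) * π) = 0 := by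
    exact_mod_cast sin_nat_mul_pi (n + 1)
  simp [exitProb, h]

theorem monotone_exitProb {r : ℝ} (hr : 0 < r) : Monotone (exitProb r) :=
  monotone_of_hasDerivAt_nonneg (hasDerivAt_exitProb_space hr)
    fun _ ↦ HurwitzZeta.cosKernel_nonneg _ (by positivity)

theorem exitProb_nonneg {r x : ℝ} (hr : 0 < r) (hx : 0 ≤ x) : 0 ≤ exitProb r x :=
  (exitProb_zero_right r).symm.trans_le (monotone_exitProb hr hx)

theorem exitProb_le_one {r x : ℝ} (hr : 0 < r) (hx : x ≤ 1) : exitProb r x ≤ 1 :=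
  (monotone_exitProb hr hx).trans_eq (exitProb_one_right r)

theorem half_one_sub_le_abs_int_add {x y : ℝ} (hy : 0 ≤ y) (hyx : y ≤ x) (n : ℤ) :
    (1 - x) / 2 ≤ |(n : ℝ) + (y + 1) / 2| := by
  rcases le_or_gt 0 n with hn | hn
  · have : (0 : ℝ) ≤ n := by exact_mod_cast hn
    exact le_abs.mpr (.inl (by linarith))
  · have : (n : ℝ) ≤ -1 := by exact_mod_cast Int.le_sub_one_of_lt hn
    exact le_abs.mpr (.inr (by linarith))

theorem exitProb_le_time_mul {r x : ℝ} (hr : 0 < r) (hr1 : r ≤ 2 / π) (hx0 : 0 ≤ x) (hx1 : x < 1) :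
    exitProb r x ≤
      HurwitzZeta.evenKernel (0 : ℝ) (1 / 2) / ((1 - x) / 2) ^ 4 * (π * r / 2) * x := by
  have ht : π * r / 2 ≤ 1 := by
    rw [le_div_iff₀ pi_pos] at hr1
    linarith
  have h := norm_image_sub_le_of_norm_deriv_le_segment'
    (fun y _ ↦ (hasDerivAt_exitProb_space hr y).hasDerivWithinAt) (a := 0) (b := x)
    (C := HurwitzZeta.evenKernel (0 : ℝ) (1 / 2) / ((1 - x) / 2) ^ 4 * (π * r / 2))
    (fun y hy ↦ ?_) x ⟨hx0, le_rfl⟩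
  · rw [exitProb_zero_right, sub_zero, sub_zero] at h
    exact (le_abs_self _).trans h
  · rw [norm_of_nonneg (HurwitzZeta.cosKernel_nonneg _ (by positivity))]
    exact HurwitzZeta.cosKernel_le_mul_of_le_abs (by linarith)
      (half_one_sub_le_abs_int_add hy.1 hy.2.le) (by positivity) ht

theorem exists_exitProb_le_mul :
    ∃ B : ℝ, 0 < B ∧ ∀ r : ℝ, 0 < r → r ≤ 2 / π → ∀ x ∈ Set.Ioo (0 : ℝ) 1,
      exitProb r x ≤ B * x := by
  have hK := HurwitzZeta.evenKernel_nonneg 0 one_half_pos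
  refine ⟨256 * HurwitzZeta.evenKernel (0 : ℝ) (1 / 2) + 2, by positivity,
    fun r hr hr1 x ⟨hx0, hx1⟩ ↦ ?_⟩
  rcases le_or_gt x (1 / 2) with hx | hx
  · refine (exitProb_le_time_mul hr hr1 hx0.le hx1).trans ?_
    have ht : π * r / 2 ≤ 1 := by
      rw [le_div_iff₀ pi_pos] at hr1
      linarith
    have hd : (1 / 4 : ℝ) ^ 4 ≤ ((1 - x) / 2) ^ 4 := by
      refine pow_le_pow_left₀ (by norm_num) ?_ 4
      linarith
    gcongr
    calc _ ≤ HurwitzZeta.evenKernel (0 : ℝ) (1 / 2) / (1 / 4) ^ 4 * 1 := by gcongr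
      _ = 256 * HurwitzZeta.evenKernel (0 : ℝ) (1 / 2) := by ring
      _ ≤ _ := by linarith
  · have := exitProb_le_one hr hx1.le
    nlinarith

/-- The function `r ↦ exitProb r x`, extended by its limit `0` to `r ≤ 0`. -/
noncomputable def exitProbExt (x r : ℝ) : ℝ :=
  if 0 < r then exitProb r x else 0

theorem hasDerivAt_exitProbExt {r : ℝ} (hr : 0 < r) (x : ℝ) :
    HasDerivAt (exitProbExt x) (boundaryFlow r x) r := by
  refine (hasDerivAt_exitProb_time hr x).congr_of_eventuallyEq ?_
  filter_upwards [Ioi_mem_nhds hr] with t ht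
  exact if_pos ht

theorem exitProbExt_nonneg {x : ℝ} (hx : 0 ≤ x) (r : ℝ) : 0 ≤ exitProbExt x r := by
  unfold exitProbExt
  split_ifs with h
  exacts [exitProb_nonneg h hx, le_rfl]

theorem continuousOn_exitProbExt {x : ℝ} (hx0 : 0 ≤ x) (hx1 : x < 1) :
    ContinuousOn (exitProbExt x) (Set.Ici 0) := by
  intro r hr
  rcases (show 0 ≤ r from hr).eq_or_lt with rfl | hr
  · rw [ContinuousWithinAt, exitProbExt, if_neg (lt_irrefl _)]
    set M := HurwitzZeta.evenKernel (0 : ℝ) (1 / 2) / ((1 - x) / 2) ^ 4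
    have hM : Tendsto (fun r ↦ M * (π * r / 2) * x) (𝓝[≥] 0) (𝓝 0) := by
      have : Continuous fun r ↦ M * (π * r / 2) * x := by fun_prop
      simpa using (this.tendsto 0).mono_left nhdsWithin_le_nhds
    refine squeeze_zero' (.of_forall (exitProbExt_nonneg hx0)) ?_ hM
    filter_upwards [self_mem_nhdsWithin,
      mem_nhdsWithin_of_mem_nhds (Iic_mem_nhds (by positivity : 0 < 2 / π))] with t ht0 ht1
    rcases (show 0 ≤ t from ht0).eq_or_lt with rfl | ht0
    · simp [exitProbExt]
    · rw [exitProbExt, if_pos ht0]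
      exact exitProb_le_time_mul ht0 ht1 hx0 hx1
  · exact (hasDerivAt_exitProbExt hr x).continuousAt.continuousWithinAt

theorem intervalIntegrable_exp_mul_boundaryFlow {s : ℝ} (hs : 0 ≤ s) (x : ℝ) :
    IntervalIntegrable (fun r ↦ exp (π ^ 2 * r / 2) * boundaryFlow r x) volume 0 s :=
  (intervalIntegrable_boundaryFlow hs x).continuousOn_mul (by fun_prop)

theorem abs_integral_exp_mul_boundaryFlow_le {B s x : ℝ} (hs0 : 0 ≤ s) (hs1 : s ≤ 2 / π)
    (hx : x ∈ Set.Ioo (0 : ℝ) 1)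
    (hB : ∀ r : ℝ, 0 < r → r ≤ 2 / π → exitProb r x ≤ B * x) (hB0 : 0 ≤ B) :
    |∫ r in (0 : ℝ)..s, exp (π ^ 2 * r / 2) * boundaryFlow r x| ≤
      exp π * (1 + π) * B * x := by
  have hBx : 0 ≤ B * x := mul_nonneg hB0 hx.1.le
  have hext {r : ℝ} (hr : r ≤ s) : |exitProbExt x r| ≤ B * x := by
    rw [abs_of_nonneg (exitProbExt_nonneg hx.1.le r), exitProbExt]
    split_ifs with h
    exacts [hB r h (hr.trans hs1), hBx]
  have hexponent {r : ℝ} (hr : r ≤ s) : π ^ 2 * r / 2 ≤ π := by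
    have := hr.trans hs1
    rw [le_div_iff₀ pi_pos] at this
    nlinarith [pi_pos]
  have hderiv (r : ℝ) : HasDerivAt (fun r ↦ exp (π ^ 2 * r / 2))
      (π ^ 2 / 2 * exp (π ^ 2 * r / 2)) r := by
    have h : HasDerivAt (fun r : ℝ ↦ π ^ 2 * r / 2) (π ^ 2 / 2) r := by
      simpa using ((hasDerivAt_id r).const_mul (π ^ 2)).div_const 2
    exact h.exp.congr_deriv (mul_comm _ _)
  have hparts := integral_mul_deriv_eq_deriv_mul_of_hasDerivAt
    (a := 0) (b := s) (u := fun r ↦ exp (π ^ 2 * r / 2)) (v := exitProbExt x)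
    (v' := fun r ↦ boundaryFlow r x) (by fun_prop)
    ((continuousOn_exitProbExt hx.1.le hx.2).mono
      (by rw [Set.uIcc_of_le hs0]; exact Set.Icc_subset_Ici_self))
    (fun r _ ↦ hderiv r)
    (fun r hr ↦ hasDerivAt_exitProbExt (by rw [min_eq_left hs0] at hr; exact hr.1) x)
    (by apply Continuous.intervalIntegrable; fun_prop)
    (intervalIntegrable_boundaryFlow hs0 x)
  have hbound : ‖∫ r in (0 : ℝ)..s, π ^ 2 / 2 * exp (π ^ 2 * r / 2) * exitProbExt x r‖ ≤
      π ^ 2 / 2 * exp π * (B * x) * |s - 0| := by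
    refine norm_integral_le_of_norm_le_const fun r hr ↦ ?_
    rw [Set.uIoc_of_le hs0] at hr
    rw [norm_mul, norm_of_nonneg (by positivity), norm_eq_abs]
    gcongr
    exacts [hexponent hr.2, hext hr.2]
  rw [hparts, show exitProbExt x 0 = 0 from if_neg (lt_irrefl _), mul_zero, sub_zero]
  refine (abs_sub _ _).trans ?_
  have h1 : |exp (π ^ 2 * s / 2) * exitProbExt x s| ≤ exp π * (B * x) := by
    rw [abs_mul, abs_of_pos (exp_pos _)]
    gcongr
    exacts [hexponent le_rfl, hext le_rfl]
  have h2 : π ^ 2 / 2 * exp π * (B * x) * |s - 0| ≤ π * exp π * (B * x) := by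
    rw [sub_zero, abs_of_nonneg hs0]
    calc _ ≤ π ^ 2 / 2 * exp π * (B * x) * (2 / π) := by gcongr
      _ = _ := by field_simp
  rw [norm_eq_abs] at hbound
  linarith

theorem exists_abs_exp_mul_boundaryFlow_sub_le :
    ∃ D : ℝ, 0 < D ∧ ∀ r : ℝ, 1 / 2 ≤ r → ∀ x : ℝ, 0 ≤ x →
      |exp (π ^ 2 * r / 2) * boundaryFlow r x - π * sin (π * x)| ≤ D * exp (-r) * x := by
  have hsum : Summable fun n : ℕ ↦ ((n + 2 : ℕ) : ℝ) ^ 2 * exp (-(1 / 2) * (n + 2 : ℕ)) :=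
    (summable_nat_add_iff 2).mpr (summable_pow_mul_exp_neg_nat_mul 2 one_half_pos)
  refine ⟨π ^ 2 * (∑' n : ℕ, ((n + 2 : ℕ) : ℝ) ^ 2 * exp (-(1 / 2) * (n + 2 : ℕ))),
    mul_pos (by positivity) (hsum.tsum_pos (fun n ↦ by positivity) 0 (by positivity)),
    fun r hr x hx ↦ ?_⟩
  have hr0 : 0 < r := one_half_pos.trans_le hr
  have hsplit : exp (π ^ 2 * r / 2) * boundaryFlow r x - π * sin (π * x) =
      π * ∑' n : ℕ, exp (π ^ 2 * r / 2) * ((-1 : ℝ) ^ (n + 1) * (((n + 1 : ℕ) : ℝ) + 1) *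
        exp (-(π ^ 2 * (((n + 1 : ℕ) : ℝ) + 1) ^ 2 * r) / 2) *
        sin ((((n + 1 : ℕ) : ℝ) + 1) * π * x)) := by
    rw [boundaryFlow, (summable_boundaryFlow hr0 x).tsum_eq_zero_add, tsum_mul_left]
    have he : exp (π ^ 2 * r / 2) * exp (-(π ^ 2 * r) / 2) = 1 := by
      rw [← exp_add, exp_eq_one_iff]
      ring
    simp only [Nat.cast_zero, zero_add, pow_zero, one_mul, one_pow, mul_one]
    linear_combination π * sin (π * x) * he
  have hterm (n : ℕ) : ‖exp (π ^ 2 * r / 2) * ((-1 : ℝ) ^ (n + 1) * (((n + 1 : ℕ) : ℝ) + 1) *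
      exp (-(π ^ 2 * (((n + 1 : ℕ) : ℝ) + 1) ^ 2 * r) / 2) *
      sin ((((n + 1 : ℕ) : ℝ) + 1) * π * x))‖ ≤
      π * exp (-r) * x * (((n + 2 : ℕ) : ℝ) ^ 2 * exp (-(1 / 2) * (n + 2 : ℕ))) := by
    have hcast : ((n + 1 : ℕ) : ℝ) + 1 = (n + 2 : ℕ) := by push_cast; ring
    have hm : (2 : ℝ) ≤ (n + 2 : ℕ) := by push_cast; linarith [n.cast_nonneg (α := ℝ)]
    rw [hcast]
    generalize ((n + 2 : ℕ) : ℝ) = m at hm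
    have hexponent : π ^ 2 * r / 2 + -(π ^ 2 * m ^ 2 * r) / 2 ≤ -r + -(1 / 2) * m := by
      have h1 : 8 ≤ π ^ 2 := by nlinarith [pi_gt_three]
      have h2 : 0 ≤ r * (m ^ 2 - 1) := mul_nonneg hr0.le (by nlinarith)
      have h3 : 1 / 2 * (4 * m ^ 2 - 5) ≤ r * (4 * m ^ 2 - 5) :=
        mul_le_mul_of_nonneg_right hr (by nlinarith)
      nlinarith
    have hsin : |sin (m * π * x)| ≤ m * π * x :=
      abs_sin_le_abs.trans_eq (abs_of_nonneg (by positivity))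
    rw [norm_eq_abs, abs_mul, abs_mul, abs_mul, abs_mul, abs_pow, abs_neg, abs_one, one_pow,
      one_mul, abs_of_pos (exp_pos _), abs_of_pos (exp_pos _),
      abs_of_nonneg (by linarith : 0 ≤ m)]
    calc _ ≤ exp (π ^ 2 * r / 2) * (m * exp (-(π ^ 2 * m ^ 2 * r) / 2) * (m * π * x)) := by
          gcongr
      _ = exp (π ^ 2 * r / 2 + -(π ^ 2 * m ^ 2 * r) / 2) * (m ^ 2 * π * x) := by
          rw [exp_add]; ring
      _ ≤ exp (-r + -(1 / 2) * m) * (m ^ 2 * π * x) := by gcongr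
      _ = _ := by rw [exp_add]; ring
  have hle := tsum_of_norm_bounded (hsum.hasSum.mul_left (π * exp (-r) * x)) hterm
  rw [hsplit, abs_mul, abs_of_pos pi_pos, ← norm_eq_abs]
  exact (mul_le_mul_of_nonneg_left hle pi_pos.le).trans_eq (by ring)

theorem integral_exp_neg_le_one {a b : ℝ} (ha : 0 ≤ a) :
    ∫ r in a..b, exp (-r) ≤ 1 := by
  rw [integral_comp_neg fun r ↦ exp r, integral_exp]
  have := exp_le_one_iff.mpr (neg_nonpos.mpr ha)
  linarith [exp_pos (-b)]

theorem integral_exp_mul_boundary_flow_approx :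
    ∃ C : ℝ, 0 < C ∧ ∀ s : ℝ, 0 < s → ∀ x : ℝ, x ∈ Set.Ioo (0 : ℝ) 1 →
      |(∫ r in (0 : ℝ)..s, Real.exp (Real.pi ^ 2 * r / 2) *
            (Real.pi * ∑' n : ℕ, (-1 : ℝ) ^ n * ((n : ℝ) + 1) *
              Real.exp (-(Real.pi ^ 2 * ((n : ℝ) + 1) ^ 2 * r) / 2) *
              Real.sin (((n : ℝ) + 1) * Real.pi * x))) -
          Real.pi * s * Real.sin (Real.pi * x)|
        ≤ C * x := by
  obtain ⟨B, hB, hexit⟩ := exists_exitProb_le_mul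
  obtain ⟨D, hD, htail⟩ := exists_abs_exp_mul_boundaryFlow_sub_le
  refine ⟨exp π * (1 + π) * B + 2 * π + D, by positivity, fun s hs x hx ↦ ?_⟩
  change |(∫ r in (0 : ℝ)..s, exp (π ^ 2 * r / 2) * boundaryFlow r x) - π * s * sin (π * x)| ≤ _
  have hx0 := hx.1
  have hshort {u : ℝ} (hu0 : 0 ≤ u) (hu : u ≤ 2 / π) :
      |(∫ r in (0 : ℝ)..u, exp (π ^ 2 * r / 2) * boundaryFlow r x) - π * u * sin (π * x)| ≤
        (exp π * (1 + π) * B + 2 * π) * x := by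
    have h1 := abs_integral_exp_mul_boundaryFlow_le hu0 hu hx
      (fun r hr hr1 ↦ hexit r hr hr1 x hx) hB.le
    have h2 : |π * u * sin (π * x)| ≤ 2 * π * x := by
      have hsin : |sin (π * x)| ≤ π * x :=
        abs_sin_le_abs.trans_eq (abs_of_nonneg (by positivity))
      rw [abs_mul, abs_of_nonneg (by positivity)]
      calc _ ≤ π * (2 / π) * (π * x) := by gcongr
        _ = _ := by field_simp
    linarith [abs_sub (∫ r in (0 : ℝ)..u, exp (π ^ 2 * r / 2) * boundaryFlow r x)
      (π * u * sin (π * x))]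
  rcases le_or_gt s (2 / π) with hs1 | hs1
  · exact (hshort hs.le hs1).trans (by nlinarith [mul_pos hD hx0])
  · have hu0 : 0 < 2 / π := by positivity
    have hu : 1 / 2 ≤ 2 / π := by
      rw [div_le_div_iff₀ two_pos pi_pos]
      linarith [pi_le_four]
    have hi := intervalIntegrable_exp_mul_boundaryFlow hs.le x
    have hi1 := intervalIntegrable_exp_mul_boundaryFlow hu0.le x
    have hi2 := hi1.symm.trans hi
    have hlong : |∫ r in (2 / π)..s, (exp (π ^ 2 * r / 2) * boundaryFlow r x - π * sin (π * x))| ≤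
        D * x := by
      rw [← norm_eq_abs]
      calc _ ≤ ∫ r in (2 / π)..s, D * x * exp (-r) :=
            norm_integral_le_of_norm_le hs1.le
              (.of_forall fun r hr ↦ (htail r (hu.trans hr.1.le) x hx0.le).trans_eq (by ring))
              (by apply Continuous.intervalIntegrable; fun_prop)
        _ ≤ D * x * 1 := by
            rw [intervalIntegral.integral_const_mul]
            gcongr
            exact integral_exp_neg_le_one hu0.le
        _ = D * x := mul_one _
    rw [integral_sub hi2 (by simp), intervalIntegral.integral_const, smul_eq_mul] at hlong
    rw [← integral_add_adjacent_intervals hi1 hi2]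
    have := abs_add_le
      ((∫ r in (0 : ℝ)..(2 / π), exp (π ^ 2 * r / 2) * boundaryFlow r x) -
        π * (2 / π) * sin (π * x))
      ((∫ r in (2 / π)..s, exp (π ^ 2 * r / 2) * boundaryFlow r x) -
        (s - 2 / π) * (π * sin (π * x)))
    calc _ = _ := by congr 1; ring
      _ ≤ _ := this
      _ ≤ _ := by linarith [hshort hu0.le le_rfl]
end

section
/- There exists a constant C > 0 such that for every s > 0, every x ∈ (0,1), and every y ∈ (0, 1/2], ∫_0^s e^{π²r/2}·(sup_{y' ∈ [0,y]} w_r(x,y')) dr ≤ C·y·(s·sin(πx) + (1 − x)). -/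
open Real intervalIntegral

/-! ### Bounds from the sine series -/

lemma sum_range_one_div_one_add_mul_sq_le {q : ℝ} (hq : 0 < q) (n : ℕ) :
    ∑ i ∈ Finset.range n, 1 / (1 + ((i : ℝ) + 1) * q) ^ 2 ≤ 1 / q * (1 - 1 / (1 + n * q)) := by
  induction n with
  | zero => simp
  | succ n ih =>
    rw [Finset.sum_range_succ]
    have h1 : 0 < 1 + (n : ℝ) * q := by positivity
    have h2 : 0 < 1 + ((n : ℝ) + 1) * q := by positivity
    have h3 : 1 / (1 + ((n : ℝ) + 1) * q) ^ 2 ≤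
        1 / q * (1 / (1 + n * q) - 1 / (1 + ((n : ℝ) + 1) * q)) := by
      have h4 : 1 / q * (1 / (1 + n * q) - 1 / (1 + ((n : ℝ) + 1) * q)) =
          1 / ((1 + n * q) * (1 + ((n : ℝ) + 1) * q)) := by
        field_simp
        ring
      rw [h4]
      apply one_div_le_one_div_of_le (by positivity)
      nlinarith
    push_cast
    calc _ ≤ _ := add_le_add ih h3
      _ = _ := by ring

lemma abs_tsum_le_of_abs_le_div_one_add_mul_sq {f : ℕ → ℝ} {K q : ℝ} (hK : 0 ≤ K) (hq : 0 < q)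
    (hf : ∀ n : ℕ, |f n| ≤ K / (1 + ((n : ℝ) + 1) * q) ^ 2) : |∑' n, f n| ≤ K / q := by
  have hb (n : ℕ) : ∑ i ∈ Finset.range n, 1 / (1 + ((i : ℝ) + 1) * q) ^ 2 ≤ 1 / q := by
    refine (sum_range_one_div_one_add_mul_sq_le hq n).trans ?_
    apply mul_le_of_le_one_right (by positivity)
    have : 0 ≤ 1 / (1 + (n : ℝ) * q) := by positivity
    linarith
  have hpos (n : ℕ) : 0 ≤ 1 / (1 + ((n : ℝ) + 1) * q) ^ 2 := by positivity
  have hs := summable_of_sum_range_le hpos hb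
  have h1 := tsum_of_norm_bounded (hs.hasSum.mul_left K)
    (fun n => (by simpa [div_eq_mul_inv] using hf n : ‖f n‖ ≤ _))
  refine h1.trans ?_
  rw [div_eq_mul_one_div]
  exact mul_le_mul_of_nonneg_left (Real.tsum_le_of_sum_range_le hpos hb) hK

lemma four_le_pi_sq_div_two : 4 ≤ π ^ 2 / 2 := by
  nlinarith [Real.pi_gt_three]

lemma exp_neg_pi_sq_mul_sq_le {t : ℝ} (ht : 0 ≤ t) :
    rexp (-(π ^ 2 * t ^ 2) / 2) ≤ 2 / (1 + t) ^ 2 := by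
  rw [neg_div, Real.exp_neg, ← one_div, div_le_div_iff₀ (Real.exp_pos _) (by positivity)]
  have h := Real.add_one_le_exp (π ^ 2 * t ^ 2 / 2)
  have h2 := mul_le_mul_of_nonneg_right four_le_pi_sq_div_two (sq_nonneg t)
  nlinarith [sq_nonneg (t - 1)]

lemma sq_mul_exp_neg_pi_sq_mul_sq_le {t : ℝ} (ht : 0 ≤ t) :
    t ^ 2 * rexp (-(π ^ 2 * t ^ 2) / 2) ≤ 2 / (1 + t) ^ 2 := by
  rw [neg_div, Real.exp_neg, ← div_eq_mul_inv, div_le_div_iff₀ (Real.exp_pos _) (by positivity)]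
  have h2 : 4 * t ^ 2 ≤ π ^ 2 * t ^ 2 / 2 := by
    have := mul_le_mul_of_nonneg_right four_le_pi_sq_div_two (sq_nonneg t)
    linarith
  have h := Real.quadratic_le_exp_of_nonneg (x := π ^ 2 * t ^ 2 / 2) (by positivity)
  have h3 : (4 * t ^ 2) ^ 2 ≤ (π ^ 2 * t ^ 2 / 2) ^ 2 := by gcongr
  nlinarith [sq_nonneg (t - 1), mul_nonneg (sq_nonneg t) (sq_nonneg (t - 1)), sq_nonneg (t ^ 2)]

lemma abs_sin_natCast_mul_le (n : ℕ) (x : ℝ) : |Real.sin (n * x)| ≤ n * |Real.sin x| := by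
  induction n with
  | zero => simp
  | succ n ih =>
    push_cast
    rw [add_mul, one_mul, Real.sin_add]
    calc |Real.sin (n * x) * Real.cos x + Real.cos (n * x) * Real.sin x|
        ≤ |Real.sin (n * x)| * |Real.cos x| + |Real.cos (n * x)| * |Real.sin x| := by
          rw [← abs_mul, ← abs_mul]; exact abs_add_le _ _
      _ ≤ n * |Real.sin x| * 1 + 1 * |Real.sin x| := by
          gcongr
          · exact Real.abs_cos_le_one x
          · exact Real.abs_cos_le_one _
      _ = _ := by ring

lemma abs_sin_succ_mul_pi_mul_le (n : ℕ) (x : ℝ) :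
    |Real.sin (((n : ℝ) + 1) * π * x)| ≤ ((n : ℝ) + 1) * |Real.sin (π * x)| := by
  have := abs_sin_natCast_mul_le (n + 1) (π * x)
  push_cast at this
  rwa [← mul_assoc] at this

lemma abs_sin_succ_mul_pi_mul_le_mul (n : ℕ) {x : ℝ} (hx : 0 ≤ x) :
    |Real.sin (((n : ℝ) + 1) * π * x)| ≤ ((n : ℝ) + 1) * (π * x) := by
  refine (abs_sin_succ_mul_pi_mul_le n x).trans ?_
  gcongr
  exact Real.abs_sin_le_abs.trans_eq (abs_of_nonneg (by positivity))

lemma w_sq_le_four_div {q : ℝ} (hq : 0 < q) (x y : ℝ) : w (q ^ 2) x y ≤ 4 / q := by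
  have h := abs_tsum_le_of_abs_le_div_one_add_mul_sq (K := 2) (q := q)
    (f := fun n : ℕ => Real.exp (-(Real.pi ^ 2 * ((n : ℝ) + 1) ^ 2 * q ^ 2) / 2) *
      Real.sin (((n : ℝ) + 1) * Real.pi * x) * Real.sin (((n : ℝ) + 1) * Real.pi * y))
    (by norm_num) hq (fun n => by
      have h1 := exp_neg_pi_sq_mul_sq_le (t := ((n : ℝ) + 1) * q) (by positivity)
      rw [mul_pow, ← mul_assoc] at h1
      refine le_trans ?_ h1
      rw [abs_mul, abs_mul, abs_of_pos (Real.exp_pos _), mul_assoc]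
      apply mul_le_of_le_one_right (Real.exp_pos _).le
      exact mul_le_one₀ (Real.abs_sin_le_one _) (abs_nonneg _) (Real.abs_sin_le_one _))
  unfold w
  have := (le_abs_self _).trans h
  calc _ ≤ 2 * (2 / q) := by gcongr
    _ = _ := by ring

lemma w_sq_le_mul_div_cube {q : ℝ} (hq : 0 < q) {x y : ℝ} (hx : 0 ≤ x) (hy : 0 ≤ y) :
    w (q ^ 2) x y ≤ 4 * π ^ 2 * (x * y / q ^ 3) := by
  have h := abs_tsum_le_of_abs_le_div_one_add_mul_sq (K := 2 * (π ^ 2 * (x * y) / q ^ 2)) (q := q)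
    (f := fun n : ℕ => Real.exp (-(Real.pi ^ 2 * ((n : ℝ) + 1) ^ 2 * q ^ 2) / 2) *
      Real.sin (((n : ℝ) + 1) * Real.pi * x) * Real.sin (((n : ℝ) + 1) * Real.pi * y))
    (by positivity) hq (fun n => by
      have h1 := sq_mul_exp_neg_pi_sq_mul_sq_le (t := ((n : ℝ) + 1) * q) (by positivity)
      rw [mul_pow, ← mul_assoc (π ^ 2)] at h1
      rw [abs_mul, abs_mul, abs_of_pos (Real.exp_pos _), mul_assoc]
      calc _ ≤ rexp (-(π ^ 2 * ((n : ℝ) + 1) ^ 2 * q ^ 2) / 2) *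
            ((((n : ℝ) + 1) * (π * x)) * (((n : ℝ) + 1) * (π * y))) := by
            gcongr
            · exact abs_sin_succ_mul_pi_mul_le_mul n hx
            · exact abs_sin_succ_mul_pi_mul_le_mul n hy
        _ = (π ^ 2 * (x * y) / q ^ 2) * (((n : ℝ) + 1) ^ 2 * q ^ 2 *
              rexp (-(π ^ 2 * ((n : ℝ) + 1) ^ 2 * q ^ 2) / 2)) := by field_simp
        _ ≤ (π ^ 2 * (x * y) / q ^ 2) * (2 / (1 + ((n : ℝ) + 1) * q) ^ 2) := by gcongr
        _ = _ := by ring)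
  unfold w
  have := (le_abs_self _).trans h
  calc _ ≤ 2 * (2 * (π ^ 2 * (x * y) / q ^ 2) / q) := by gcongr
    _ = _ := by field_simp; ring

lemma exp_mul_w_le_of_one_le {r : ℝ} (hr : 1 ≤ r) (x : ℝ) {y : ℝ} (hy : 0 ≤ y) :
    rexp (π ^ 2 * r / 2) * w r x y ≤ 4 * π * rexp (π ^ 2 / 2) * (y * |Real.sin (π * x)|) := by
  have h := abs_tsum_le_of_abs_le_div_one_add_mul_sq
    (K := 2 * (rexp (π ^ 2 / 2) * (π * (y * |Real.sin (π * x)|)))) (q := 1)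
    (f := fun n : ℕ => rexp (π ^ 2 * r / 2) *
      (Real.exp (-(Real.pi ^ 2 * ((n : ℝ) + 1) ^ 2 * r) / 2) *
      Real.sin (((n : ℝ) + 1) * Real.pi * x) * Real.sin (((n : ℝ) + 1) * Real.pi * y)))
    (by positivity) one_pos (fun n => by
      have h1 := sq_mul_exp_neg_pi_sq_mul_sq_le (t := (n : ℝ) + 1) (by positivity)
      have h2 : rexp (π ^ 2 * r / 2) * rexp (-(π ^ 2 * ((n : ℝ) + 1) ^ 2 * r) / 2) ≤
          rexp (π ^ 2 / 2) * rexp (-(π ^ 2 * ((n : ℝ) + 1) ^ 2) / 2) := by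
        rw [← Real.exp_add, ← Real.exp_add]
        apply Real.exp_le_exp.mpr
        have h3 : 0 ≤ π ^ 2 * ((((n : ℝ) + 1) ^ 2 - 1) * (r - 1)) := by
          apply mul_nonneg (by positivity) (mul_nonneg _ (by linarith))
          nlinarith [(n.cast_nonneg : (0 : ℝ) ≤ n)]
        nlinarith
      rw [abs_mul, abs_mul, abs_mul, abs_of_pos (Real.exp_pos _), abs_of_pos (Real.exp_pos _),
        mul_assoc, ← mul_assoc, mul_one]
      calc _ ≤ rexp (π ^ 2 / 2) * rexp (-(π ^ 2 * ((n : ℝ) + 1) ^ 2) / 2) *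
            ((((n : ℝ) + 1) * |Real.sin (π * x)|) * (((n : ℝ) + 1) * (π * y))) := by
            gcongr
            · exact abs_sin_succ_mul_pi_mul_le n x
            · exact abs_sin_succ_mul_pi_mul_le_mul n hy
        _ = (rexp (π ^ 2 / 2) * (π * (y * |Real.sin (π * x)|))) * (((n : ℝ) + 1) ^ 2 *
              rexp (-(π ^ 2 * ((n : ℝ) + 1) ^ 2) / 2)) := by ring
        _ ≤ (rexp (π ^ 2 / 2) * (π * (y * |Real.sin (π * x)|))) *
              (2 / (1 + ((n : ℝ) + 1)) ^ 2) := by gcongr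
        _ = _ := by ring)
  rw [tsum_mul_left] at h
  unfold w
  have := (le_abs_self _).trans h
  linarith

/-! ### The method of images -/

lemma cosKernel_sub_cosKernel {r : ℝ} (hr : 0 < r) (x y : ℝ) :
    HurwitzZeta.cosKernel (((x - y) / 2 : ℝ)) (π * r / 2) -
      HurwitzZeta.cosKernel (((x + y) / 2 : ℝ)) (π * r / 2) = 2 * w r x y := by
  have ht : 0 < π * r / 2 := by positivity
  have h := (HurwitzZeta.hasSum_nat_cosKernel₀ ((x - y) / 2) ht).sub
    (HurwitzZeta.hasSum_nat_cosKernel₀ ((x + y) / 2) ht)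
  rw [sub_sub_sub_cancel_right] at h
  rw [← h.tsum_eq, w, ← mul_assoc, ← tsum_mul_left]
  congr 1
  ext n
  have h1 : 2 * π * ((x - y) / 2) * ((n : ℝ) + 1) =
      ((n : ℝ) + 1) * π * x - ((n : ℝ) + 1) * π * y := by ring
  have h2 : 2 * π * ((x + y) / 2) * ((n : ℝ) + 1) =
      ((n : ℝ) + 1) * π * x + ((n : ℝ) + 1) * π * y := by ring
  have h3 : -π * ((n : ℝ) + 1) ^ 2 * (π * r / 2) = -(π ^ 2 * ((n : ℝ) + 1) ^ 2 * r) / 2 := by ring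
  rw [h1, h2, h3, Real.cos_sub, Real.cos_add]
  ring

lemma hasSum_images {r : ℝ} (hr : 0 < r) (x y : ℝ) :
    HasSum (fun k : ℤ => Real.exp (-(x + 2 * k - y) ^ 2 / (2 * r)) -
      Real.exp (-(x + 2 * k + y) ^ 2 / (2 * r))) (√(π * r / 2) * (2 * w r x y)) := by
  have ht : 0 < π * r / 2 := by positivity
  have ht' : 0 < 1 / (π * r / 2) := by positivity
  have hfun (a : UnitAddCircle) : HurwitzZeta.evenKernel a (1 / (π * r / 2)) =
      √(π * r / 2) * HurwitzZeta.cosKernel a (π * r / 2) := by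
    rw [HurwitzZeta.evenKernel_functional_equation, one_div_one_div, ← Real.sqrt_eq_rpow,
      Real.sqrt_div zero_le_one, Real.sqrt_one, one_div_one_div]
  have h := (HurwitzZeta.hasSum_int_evenKernel ((x - y) / 2) ht').sub
    (HurwitzZeta.hasSum_int_evenKernel ((x + y) / 2) ht')
  rw [hfun, hfun, ← mul_sub, cosKernel_sub_cosKernel hr] at h
  have e (z : ℝ) : -(2 * z) ^ 2 / (2 * r) = -π * z ^ 2 * (1 / (π * r / 2)) := by
    field_simp
  refine Eq.mp (congrArg (HasSum · _) (funext fun k => ?_)) h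
  rw [← e, ← e]
  ring_nf

/-- The lattice sum through which all bounds on image sums are expressed. -/
noncomputable def latticeSum : ℝ := ∑' k : ℤ, 1 / (1 + (k : ℝ) ^ 2)

lemma summable_one_div_one_add_int_sq : Summable fun k : ℤ => 1 / (1 + (k : ℝ) ^ 2) := by
  have h : Summable fun k : ℤ => 1 / (k : ℝ) ^ 2 :=
    Real.summable_one_div_int_pow.mpr one_lt_two
  refine Summable.of_norm_bounded_eventually h ?_
  rw [Filter.eventually_cofinite]
  refine (Set.finite_singleton (0 : ℤ)).subset fun k hk => ?_
  by_contra hk0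
  have hk0' : (k : ℝ) ≠ 0 := by exact_mod_cast hk0
  apply hk
  rw [Real.norm_of_nonneg (by positivity)]
  apply one_div_le_one_div_of_le (by positivity)
  linarith

lemma latticeSum_nonneg : 0 ≤ latticeSum := tsum_nonneg fun k => by positivity

lemma w_sq_le_of_hasSum_le {f : ℤ → ℝ} {q x y M : ℝ} (hq : 0 < q) (hM : 0 ≤ M)
    (hf : HasSum f (√(π * q ^ 2 / 2) * (2 * w (q ^ 2) x y)))
    (h : ∀ k : ℤ, f k ≤ M * (1 / (1 + (k : ℝ) ^ 2))) : w (q ^ 2) x y ≤ M * latticeSum / q := by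
  have h1 := hasSum_le h hf (summable_one_div_one_add_int_sq.hasSum.mul_left M)
  change _ ≤ M * latticeSum at h1
  have h0 : 0 ≤ M * latticeSum := mul_nonneg hM latticeSum_nonneg
  rcases le_or_gt (w (q ^ 2) x y) 0 with hw | hw
  · exact hw.trans (by positivity)
  · rw [le_div_iff₀ hq]
    have h2 : q ≤ √(π * q ^ 2 / 2) := by
      apply Real.le_sqrt_of_sq_le
      nlinarith [Real.pi_gt_three, sq_nonneg q]
    have h3 : q * (2 * w (q ^ 2) x y) ≤ √(π * q ^ 2 / 2) * (2 * w (q ^ 2) x y) := by gcongr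
    nlinarith [mul_pos hq hw]

lemma exp_neg_le_two_div_sq_s7 {t : ℝ} (ht : 0 < t) : rexp (-t) ≤ 2 / t ^ 2 := by
  have := Real.pow_div_factorial_le_exp t ht.le 2
  rw [Real.exp_neg, ← one_div, div_le_div_iff₀ (Real.exp_pos _) (by positivity)]
  norm_num [Nat.factorial] at this
  linarith

lemma exp_neg_le_six_div_cube {t : ℝ} (ht : 0 < t) : rexp (-t) ≤ 6 / t ^ 3 := by
  have := Real.pow_div_factorial_le_exp t ht.le 3
  rw [Real.exp_neg, ← one_div, div_le_div_iff₀ (Real.exp_pos _) (by positivity)]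
  norm_num [Nat.factorial] at this
  linarith

lemma exp_sub_exp_le (a b : ℝ) : rexp a - rexp b ≤ rexp a * (a - b) := by
  have h := Real.add_one_le_exp (b - a)
  have h1 : rexp b = rexp a * rexp (b - a) := by rw [← Real.exp_add]; ring_nf
  rw [h1]
  nlinarith [Real.exp_pos a]

lemma image_term_le {q x y : ℝ} (hq : 0 < q) (hq1 : q ≤ 1) (hqx : q ≤ x)
    (hx1 : x ≤ 1) (hy : 0 ≤ y) (hyx : 2 * y ≤ x) (k : ℤ) :
    Real.exp (-(x + 2 * k - y) ^ 2 / (2 * q ^ 2)) - Real.exp (-(x + 2 * k + y) ^ 2 / (2 * q ^ 2)) ≤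
      512 * (y / x) * (1 / (1 + (k : ℝ) ^ 2)) := by
  have hx : 0 < x := hq.trans_le hqx
  rcases le_or_gt 0 k with hk | hk
  · have hk' : (0 : ℝ) ≤ k := by exact_mod_cast hk
    set z : ℝ := x + 2 * k with hz
    have hzx : x ≤ z := by linarith
    have hz0 : 0 < z := by linarith
    have hzq : q ^ 2 * (1 + (k : ℝ) ^ 2) ≤ 2 * z ^ 2 := by
      nlinarith [mul_nonneg (sq_nonneg (k : ℝ)) (by nlinarith : 0 ≤ 1 - q ^ 2),
        mul_nonneg hk' hx.le, sq_nonneg (k : ℝ)]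
    have h1 := exp_sub_exp_le (-(z - y) ^ 2 / (2 * q ^ 2)) (-(z + y) ^ 2 / (2 * q ^ 2))
    have h2 : -(z - y) ^ 2 / (2 * q ^ 2) - -(z + y) ^ 2 / (2 * q ^ 2) = 2 * z * y / q ^ 2 := by
      field_simp
      ring
    have h3 : rexp (-(z - y) ^ 2 / (2 * q ^ 2)) ≤ 2 / (z ^ 2 / (8 * q ^ 2)) ^ 2 := by
      refine le_trans (Real.exp_le_exp.mpr ?_) (exp_neg_le_two_div_sq_s7 (by positivity))
      rw [neg_div, neg_le_neg_iff, div_le_div_iff₀ (by positivity) (by positivity)]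
      have : (z / 2) ^ 2 ≤ (z - y) ^ 2 := by
        apply pow_le_pow_left₀ (by positivity)
        linarith
      nlinarith [sq_nonneg q]
    rw [h2] at h1
    calc _ ≤ _ := h1
      _ ≤ 2 / (z ^ 2 / (8 * q ^ 2)) ^ 2 * (2 * z * y / q ^ 2) := by gcongr
      _ = 256 * (y / z) * (q ^ 2 / z ^ 2) := by field_simp; norm_num; ring
      _ ≤ 256 * (y / x) * (2 / (1 + (k : ℝ) ^ 2)) := by
        gcongr 256 * (y / ?_) * ?_
        rw [div_le_div_iff₀ (by positivity) (by positivity)]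
        exact hzq
      _ = _ := by ring
  · have hk' : (k : ℝ) ≤ -1 := by exact_mod_cast (by omega : k ≤ -1)
    refine le_trans (sub_nonpos.mpr ?_) (by positivity)
    apply Real.exp_le_exp.mpr
    apply div_le_div_of_nonneg_right _ (by positivity)
    nlinarith

lemma w_sq_le_of_two_mul_le {q x y : ℝ} (hq : 0 < q) (hq1 : q ≤ 1) (hqx : q ≤ x) (hx1 : x ≤ 1)
    (hy : 0 ≤ y) (hyx : 2 * y ≤ x) : w (q ^ 2) x y ≤ 512 * latticeSum * (y / x / q) := by
  have hx : 0 < x := hq.trans_le hqx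
  have := w_sq_le_of_hasSum_le hq (M := 512 * (y / x)) (by positivity)
    (hasSum_images (by positivity) x y) (image_term_le hq hq1 hqx hx1 hy hyx)
  exact this.trans_eq (by ring)

lemma abs_exp_sub_exp_neg_le (a : ℝ) : |rexp a - rexp (-a)| ≤ 2 * |a| * rexp |a| := by
  wlog ha : 0 ≤ a generalizing a
  · have := this (-a) (by linarith)
    rwa [neg_neg, abs_neg, abs_sub_comm] at this
  have h := exp_sub_exp_le a (-a)
  rw [abs_of_nonneg ha, abs_of_nonneg (sub_nonneg.mpr (Real.exp_le_exp.mpr (by linarith)))]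
  linarith

lemma paired_exp_le {q h y : ℝ} (m : ℝ) (hq : 0 < q) (hh : 0 ≤ h) (hy : 0 ≤ y) :
    rexp (-(m - h - y) ^ 2 / (2 * q ^ 2)) - rexp (-(m - h + y) ^ 2 / (2 * q ^ 2)) +
      (rexp (-(-m - h - y) ^ 2 / (2 * q ^ 2)) - rexp (-(-m - h + y) ^ 2 / (2 * q ^ 2))) ≤
    4 * (m ^ 2 * h * y / q ^ 4) * rexp (-(|m| - (h + y)) ^ 2 / (2 * q ^ 2)) := by
  set A := m * h / q ^ 2 with hA
  set B := m * y / q ^ 2 with hB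
  set U := -(m ^ 2 + (h + y) ^ 2) / (2 * q ^ 2) with hU
  set V := -(m ^ 2 + (h - y) ^ 2) / (2 * q ^ 2) with hV
  have e1 : -(m - h - y) ^ 2 / (2 * q ^ 2) = U + (A + B) := by
    rw [hA, hB, hU]; field_simp; ring
  have e2 : -(m - h + y) ^ 2 / (2 * q ^ 2) = V + (A - B) := by
    rw [hA, hB, hV]; field_simp; ring
  have e3 : -(-m - h - y) ^ 2 / (2 * q ^ 2) = U + (-A + -B) := by
    rw [hA, hB, hU]; field_simp; ring
  have e4 : -(-m - h + y) ^ 2 / (2 * q ^ 2) = V + (-A - -B) := by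
    rw [hA, hB, hV]; field_simp; ring
  have hUV : U ≤ V := by
    apply div_le_div_of_nonneg_right _ (by positivity)
    nlinarith [mul_nonneg hh hy]
  have hA' : |A| = |m| * h / q ^ 2 := by
    rw [hA, abs_div, abs_mul, abs_of_nonneg hh, abs_of_pos (by positivity : 0 < q ^ 2)]
  have hB' : |B| = |m| * y / q ^ 2 := by
    rw [hB, abs_div, abs_mul, abs_of_nonneg hy, abs_of_pos (by positivity : 0 < q ^ 2)]
  have e5 : -(|m| - (h + y)) ^ 2 / (2 * q ^ 2) = U + (|A| + |B|) := by
    rw [hA', hB', hU, ← sq_abs m]; field_simp; ring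
  have e6 : m ^ 2 * h * y / q ^ 4 = |A| * |B| := by
    rw [hA', hB', ← sq_abs m]; field_simp
  rw [e1, e2, e3, e4, e5, e6]
  have h1 : rexp U * (rexp (A - B) + rexp (-A - -B)) ≤ rexp V * (rexp (A - B) + rexp (-A - -B)) := by
    gcongr
  have h2 : (rexp A - rexp (-A)) * (rexp B - rexp (-B)) ≤
      (2 * |A| * rexp |A|) * (2 * |B| * rexp |B|) := by
    refine (le_abs_self _).trans ?_
    rw [abs_mul]
    gcongr
    · exact abs_exp_sub_exp_neg_le A
    · exact abs_exp_sub_exp_neg_le B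
  have h3 := mul_le_mul_of_nonneg_left h2 (Real.exp_pos U).le
  simp only [sub_eq_add_neg, Real.exp_add, neg_neg] at h1 h3 ⊢
  nlinarith

lemma paired_image_term_le {q h y : ℝ} (hq : 0 < q) (hq1 : q ≤ 1) (hh : 0 ≤ h)
    (hh1 : h ≤ 1 / 4) (hy : 0 ≤ y) (hy1 : y ≤ 1 / 2) (k : ℤ) :
    let m : ℝ := 2 * k + 1
    rexp (-(m - h - y) ^ 2 / (2 * q ^ 2)) - rexp (-(m - h + y) ^ 2 / (2 * q ^ 2)) +
      (rexp (-(-m - h - y) ^ 2 / (2 * q ^ 2)) - rexp (-(-m - h + y) ^ 2 / (2 * q ^ 2))) ≤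
    48 * 32 ^ 3 * (h * y * q) * (1 / (1 + (k : ℝ) ^ 2)) := by
  intro m
  refine (paired_exp_le m hq hh hy).trans ?_
  have hkk : 0 ≤ (7 * (k : ℝ) + 1) * (k + 1) := by
    have : 0 ≤ (7 * k + 1) * (k + 1) := by
      rcases le_or_gt 0 k with h | h
      · positivity
      · exact mul_nonneg_of_nonpos_of_nonpos (by omega) (by omega)
    exact_mod_cast this
  have hm2 : 1 + (k : ℝ) ^ 2 ≤ 2 * m ^ 2 := by
    simp only [m]
    nlinarith
  have hm1 : 1 ≤ |m| := by
    have : 1 ≤ |2 * k + 1| := Int.one_le_abs (by omega)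
    simp only [m]
    exact_mod_cast this
  have hm1' : 1 ≤ m ^ 2 := by
    rw [← sq_abs]
    nlinarith
  have hm0 : m ≠ 0 := by
    rintro h0
    rw [h0] at hm1'
    norm_num at hm1'
  have h3 : rexp (-(|m| - (h + y)) ^ 2 / (2 * q ^ 2)) ≤ 6 / (m ^ 2 / (32 * q ^ 2)) ^ 3 := by
    refine le_trans (Real.exp_le_exp.mpr ?_) (exp_neg_le_six_div_cube (by positivity))
    rw [neg_div, neg_le_neg_iff, div_le_div_iff₀ (by positivity) (by positivity)]
    have : (|m| / 4) ^ 2 ≤ (|m| - (h + y)) ^ 2 := by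
      apply pow_le_pow_left₀ (by positivity)
      linarith
    rw [div_pow, sq_abs] at this
    nlinarith [sq_nonneg q]
  calc _ ≤ 4 * (m ^ 2 * h * y / q ^ 4) * (6 / (m ^ 2 / (32 * q ^ 2)) ^ 3) := by gcongr
    _ = 24 * 32 ^ 3 * (h * y * (q * q)) * (1 / (m ^ 2 * m ^ 2)) := by field_simp; ring
    _ ≤ 24 * 32 ^ 3 * (h * y * (q * 1)) * (2 / (1 + (k : ℝ) ^ 2)) := by
      have : 1 / (m ^ 2 * m ^ 2) ≤ 2 / (1 + (k : ℝ) ^ 2) := by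
        rw [div_le_div_iff₀ (by positivity) (by positivity)]
        nlinarith
      gcongr
    _ = _ := by ring

lemma w_sq_le_of_three_quarters_le {q x y : ℝ} (hq : 0 < q) (hq1 : q ≤ 1) (hx : 3 / 4 ≤ x)
    (hx1 : x ≤ 1) (hy : 0 ≤ y) (hy1 : y ≤ 1 / 2) :
    w (q ^ 2) x y ≤ 24 * 32 ^ 3 * latticeSum * ((1 - x) * y) := by
  have hs := hasSum_images (sq_pos_of_pos hq) x y
  let e : ℤ ≃ ℤ := ⟨fun k => -1 - k, fun k => -1 - k, fun k => by simp, fun k => by simp⟩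
  have hs2 := ((hs.add (e.hasSum_iff.mpr hs)).mul_left (1 / 2))
  rw [← two_mul, ← mul_assoc, one_div_mul_cancel two_ne_zero, one_mul] at hs2
  have hx0 : 0 ≤ 1 - x := by linarith
  have := w_sq_le_of_hasSum_le hq (M := 24 * 32 ^ 3 * ((1 - x) * y * q)) (by positivity) hs2
    (fun k => by
      have h := paired_image_term_le hq hq1 hx0 (by linarith) hy hy1 k
      have e1 : (2 * (k : ℝ) + 1) - (1 - x) = x + 2 * k := by ring
      have e2 : -(2 * (k : ℝ) + 1) - (1 - x) = x + 2 * ((-1 - k : ℤ) : ℝ) := by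
        push_cast; ring
      simp only [e1, e2] at h
      simp only [Function.comp, e, Equiv.coe_fn_mk]
      linarith)
  exact this.trans_eq (by field_simp)

/-! ### Integration of the pointwise bounds -/

lemma exists_w_sq_le : ∃ K : ℝ, 0 < K ∧ ∀ q x y y' : ℝ, 0 < q → q ≤ 1 → 0 < x → x < 1 →
    0 < y → y ≤ 1 / 2 → 0 ≤ y' → y' ≤ y →
    w (q ^ 2) x y' ≤ K * ((1 - x) * (y / max x y) *
      (max x y ^ 2 / ((max x y + q) ^ 2 * (2 * q)))) := by
  have hS := latticeSum_nonneg
  refine ⟨64 * (4 + 4 * π ^ 2 + 512 * latticeSum + 24 * 32 ^ 3 * latticeSum), by positivity, ?_⟩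
  set K := 4 + 4 * π ^ 2 + 512 * latticeSum + 24 * 32 ^ 3 * latticeSum with hK
  have hK1 : 4 ≤ K := by nlinarith [sq_nonneg π]
  have hK2 : 4 * π ^ 2 ≤ K := by nlinarith [sq_nonneg π]
  have hK3 : 512 * latticeSum ≤ K := by nlinarith [sq_nonneg π]
  have hK4 : 24 * 32 ^ 3 * latticeSum ≤ K := by nlinarith [sq_nonneg π]
  clear_value K
  intro q x y y' hq hq1 hx hx1 hy hy1 hy' hyy
  have hx0 : 0 < 1 - x := by linarith
  set m := max x y with hm
  have hmx : x ≤ m := le_max_left _ _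
  have hmy : y ≤ m := le_max_right _ _
  have hm1 : m ≤ 1 := max_le hx1.le (by linarith)
  have hm0 : 0 < m := hx.trans_le hmx
  rcases le_or_gt (3 / 4) x with h34 | h34
  · have h1 : (1 : ℝ) / 32 ≤ m / ((m + q) ^ 2 * (2 * q)) := by
      have h2 : (m + q) ^ 2 * (2 * q) ≤ (1 + 1) ^ 2 * (2 * 1) := by gcongr
      rw [div_le_div_iff₀ (by norm_num) (by positivity)]
      linarith
    calc w (q ^ 2) x y' ≤ 24 * 32 ^ 3 * latticeSum * ((1 - x) * y') :=
          w_sq_le_of_three_quarters_le hq hq1 h34 hx1.le hy' (hyy.trans hy1)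
      _ ≤ K * ((1 - x) * y) := by gcongr
      _ ≤ 64 * K * ((1 - x) * y * (1 / 32)) := by
        have : 0 ≤ K * ((1 - x) * y) := by positivity
        linarith
      _ ≤ 64 * K * ((1 - x) * y * (m / ((m + q) ^ 2 * (2 * q)))) := by gcongr
      _ = _ := by field_simp
  · have h14 : 1 / 4 ≤ 1 - x := by linarith
    rcases le_or_gt m q with hmq | hmq
    · calc w (q ^ 2) x y' ≤ 4 * π ^ 2 * (x * y' / q ^ 3) := w_sq_le_mul_div_cube hq hx.le hy'
        _ ≤ K * (m * y / q ^ 3) := by gcongr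
        _ ≤ 2 * (K * (m * y / q ^ 3)) := by
          have : 0 ≤ K * (m * y / q ^ 3) := by positivity
          linarith
        _ = 64 * K * (1 / 4 * (y / m) * (m ^ 2 / ((q + q) ^ 2 * (2 * q)))) := by
          field_simp; norm_num
        _ ≤ _ := by gcongr
    · have key : w (q ^ 2) x y' ≤ K * (2 * (y / m / q)) := by
        rcases le_or_gt x (2 * y) with hxy | hxy
        · have h12 : 1 / 2 ≤ y / m := by
            rw [div_le_div_iff₀ two_pos hm0]
            have : m ≤ 2 * y := max_le hxy (by linarith)
            linarith
          calc w (q ^ 2) x y' ≤ 4 / q := w_sq_le_four_div hq x y'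
            _ = 4 * (2 * (1 / 2 / q)) := by ring
            _ ≤ _ := by gcongr
        · have hmx' : m = x := max_eq_left (by linarith)
          rw [hmx'] at hmq ⊢
          calc w (q ^ 2) x y' ≤ 512 * latticeSum * (y' / x / q) :=
                w_sq_le_of_two_mul_le hq hq1 hmq.le hx1.le hy' (by linarith)
            _ ≤ K * (y / x / q) := by gcongr
            _ ≤ K * (2 * (y / x / q)) := by
              have : 0 ≤ y / x / q := by positivity
              gcongr
              linarith
      calc _ ≤ _ := key
        _ = 64 * K * (1 / 4 * (y / m) * (m ^ 2 / ((m + m) ^ 2 * (2 * q)))) := by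
          field_simp; norm_num
        _ ≤ _ := by gcongr

lemma intervalIntegrable_and_integral_le {m s : ℝ} (hm : 0 < m) (hs : 0 ≤ s) :
    IntervalIntegrable (fun r => m ^ 2 / ((m + √r) ^ 2 * (2 * √r))) MeasureTheory.volume 0 s ∧
      ∫ r in (0 : ℝ)..s, m ^ 2 / ((m + √r) ^ 2 * (2 * √r)) ≤ m := by
  have hpos (r : ℝ) : 0 < m + √r := by positivity
  have hcont : Continuous fun r => m * √r / (m + √r) :=
    (by fun_prop : Continuous fun r => m * √r).div (by fun_prop) fun r => (hpos r).ne'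
  have hderiv (r : ℝ) (hr : r ∈ Set.Ioo 0 s) : HasDerivAt (fun r => m * √r / (m + √r))
      (m ^ 2 / ((m + √r) ^ 2 * (2 * √r))) r := by
    have h := Real.hasDerivAt_sqrt hr.1.ne'
    have hr' : 0 < √r := Real.sqrt_pos.mpr hr.1
    refine ((h.const_mul m).div (h.const_add m) (hpos r).ne').congr_deriv ?_
    field_simp
    ring
  have hint : IntervalIntegrable (fun r => m ^ 2 / ((m + √r) ^ 2 * (2 * √r)))
      MeasureTheory.volume 0 s := by
    apply intervalIntegrable_deriv_of_nonneg hcont.continuousOn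
    · rwa [min_eq_left hs, max_eq_right hs]
    · intro r _
      positivity
  refine ⟨hint, ?_⟩
  rw [integral_eq_sub_of_hasDerivAt_of_le hs hcont.continuousOn hderiv hint]
  simp only [Real.sqrt_zero, mul_zero, zero_div, sub_zero]
  rw [div_le_iff₀ (hpos s)]
  nlinarith

lemma intervalIntegral_le_of_le_Ioo {f g : ℝ → ℝ} {a b : ℝ} (hab : a ≤ b)
    (hg : IntervalIntegrable g MeasureTheory.volume a b) (hg0 : ∀ r ∈ Set.Ioo a b, 0 ≤ g r)
    (hfg : ∀ r ∈ Set.Ioo a b, f r ≤ g r) : ∫ r in a..b, f r ≤ ∫ r in a..b, g r := by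
  by_cases hf : IntervalIntegrable f MeasureTheory.volume a b
  · exact integral_mono_on_of_le_Ioo hab hf hg hfg
  · rw [integral_undef hf]
    simpa using integral_mono_on_of_le_Ioo hab (f := fun _ => (0 : ℝ)) (by simp) hg hg0

theorem integral_exp_mul_sup_w_le :
    ∃ C : ℝ, 0 < C ∧ ∀ s : ℝ, 0 < s → ∀ x : ℝ, x ∈ Set.Ioo (0 : ℝ) 1 →
      ∀ y : ℝ, y ∈ Set.Ioc (0 : ℝ) (1 / 2) →
      (∫ r in (0 : ℝ)..s, Real.exp (Real.pi ^ 2 * r / 2) *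
          (⨆ y' : Set.Icc (0 : ℝ) y, w r x (y' : ℝ)))
        ≤ C * y * (s * Real.sin (Real.pi * x) + (1 - x)) := by
  obtain ⟨K, hK, hw⟩ := exists_w_sq_le
  refine ⟨rexp (π ^ 2 / 2) * (K + 4 * π), by positivity, ?_⟩
  rintro s hs x ⟨hx, hx1⟩ y ⟨hy, hy1⟩
  have hx0 : 0 < 1 - x := by linarith
  have hsin : 0 < Real.sin (π * x) :=
    Real.sin_pos_of_pos_of_lt_pi (by positivity) (by nlinarith [Real.pi_pos])
  set m := max x y with hm
  have hm0 : 0 < m := hx.trans_le (le_max_left _ _)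
  obtain ⟨hint, hle⟩ := intervalIntegrable_and_integral_le hm0 hs.le
  set c := rexp (π ^ 2 / 2) * K * ((1 - x) * (y / m)) with hc
  set d := rexp (π ^ 2 / 2) * (4 * π) * (y * Real.sin (π * x)) with hd
  have hc0 : 0 ≤ c := by positivity
  have hd0 : 0 ≤ d := by positivity
  have hmajor : ∀ r ∈ Set.Ioo 0 s,
      rexp (π ^ 2 * r / 2) * (⨆ y' : Set.Icc (0 : ℝ) y, w r x (y' : ℝ)) ≤
        c * (m ^ 2 / ((m + √r) ^ 2 * (2 * √r))) + d := by
    intro r hr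
    have hr0 : 0 < √r := Real.sqrt_pos.mpr hr.1
    rw [mul_comm, ← le_div_iff₀ (Real.exp_pos _)]
    have : Nonempty (Set.Icc (0 : ℝ) y) := ⟨⟨0, le_rfl, hy.le⟩⟩
    refine ciSup_le ?_
    rintro ⟨y', hy', hyy⟩
    rw [le_div_iff₀ (Real.exp_pos _), mul_comm]
    have hD : 0 ≤ c * (m ^ 2 / ((m + √r) ^ 2 * (2 * √r))) := by positivity
    rcases le_or_gt 1 r with hr1 | hr1
    · have h1 := exp_mul_w_le_of_one_le hr1 x hy'
      rw [abs_of_pos hsin] at h1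
      have h2 : 4 * π * rexp (π ^ 2 / 2) * (y' * Real.sin (π * x)) ≤ d := by
        rw [hd, mul_comm (rexp _)]
        gcongr
      linarith
    · have h1 := hw (√r) x y y' hr0 (Real.sqrt_le_one.mpr hr1.le) hx hx1 hy hy1 hy' hyy
      rw [Real.sq_sqrt hr.1.le] at h1
      calc _ ≤ rexp (π ^ 2 * r / 2) * (K * ((1 - x) * (y / m) *
              (m ^ 2 / ((m + √r) ^ 2 * (2 * √r))))) := by gcongr
        _ ≤ rexp (π ^ 2 * 1 / 2) * (K * ((1 - x) * (y / m) *
              (m ^ 2 / ((m + √r) ^ 2 * (2 * √r))))) := by gcongr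
        _ = c * (m ^ 2 / ((m + √r) ^ 2 * (2 * √r))) := by rw [hc, mul_one]; ring
        _ ≤ _ := by linarith
  have hint' := (hint.const_mul c).add
    (intervalIntegrable_const (μ := MeasureTheory.volume) (a := 0) (b := s) (c := d))
  refine (intervalIntegral_le_of_le_Ioo hs.le hint' (fun r _ => by positivity) hmajor).trans ?_
  rw [integral_add (hint.const_mul c) intervalIntegrable_const, integral_const_mul,
    integral_const, smul_eq_mul, sub_zero]
  have h1 : c * m = rexp (π ^ 2 / 2) * K * ((1 - x) * y) := by
    rw [hc]; field_simp
  have h2 := mul_le_mul_of_nonneg_left hle hc0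
  have h3 : 0 ≤ rexp (π ^ 2 / 2) * K * (y * (s * Real.sin (π * x))) := by positivity
  have h4 : 0 ≤ rexp (π ^ 2 / 2) * (4 * π) * (y * (1 - x)) := by positivity
  rw [h1] at h2
  rw [hd]
  linarith
end

section
/- There exists a constant C > 0 such that for every s > 0 and every x ∈ (0,1), ∫_0^s e^{π²r/2}·(∫_0^1 w_r(x,y) dy) dr ≤ C·(s·sin(πx) + (1 − x)). -/
open Real intervalIntegral

/-- The coefficients of the sine-series expansion of `∫ y in 0..1, w r x y`. -/
noncomputable def sineCoeff (x : ℝ) (n : ℕ) : ℝ :=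
  2 * Real.sin (((n : ℝ) + 1) * Real.pi * x) *
    ∫ y in (0 : ℝ)..1, Real.sin (((n : ℝ) + 1) * Real.pi * y)

lemma integral_sin_mul_pi_mul {k : ℝ} (hk : k ≠ 0) :
    ∫ y in (0 : ℝ)..1, Real.sin (k * Real.pi * y) =
      (1 - Real.cos (k * Real.pi)) / (k * Real.pi) := by
  have h : k * Real.pi ≠ 0 := mul_ne_zero hk Real.pi_ne_zero
  rw [intervalIntegral.integral_comp_mul_left (fun y => Real.sin y) h, integral_sin]
  simp [div_eq_inv_mul]

lemma abs_integral_sin_mul_pi_mul_le {k : ℝ} (hk : 0 < k) :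
    |∫ y in (0 : ℝ)..1, Real.sin (k * Real.pi * y)| ≤ 2 / (k * Real.pi) := by
  have h : 0 < k * Real.pi := mul_pos hk Real.pi_pos
  rw [integral_sin_mul_pi_mul hk.ne', abs_div, abs_of_pos h]
  gcongr
  rw [abs_le]
  constructor <;> linarith [Real.cos_le_one (k * Real.pi), Real.neg_one_le_cos (k * Real.pi)]

lemma abs_sin_nat_mul_pi_mul_le (k : ℕ) {x : ℝ} (hx : x ≤ 1) :
    |Real.sin ((k : ℝ) * Real.pi * x)| ≤ k * Real.pi * (1 - x) := by
  have h : (k : ℝ) * Real.pi * x = k * Real.pi - k * Real.pi * (1 - x) := by ring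
  rw [h, Real.sin_nat_mul_pi_sub, abs_neg, abs_mul, abs_pow, abs_neg, abs_one, one_pow, one_mul]
  refine Real.abs_sin_le_abs.trans (abs_of_nonneg ?_).le
  exact mul_nonneg (mul_nonneg k.cast_nonneg Real.pi_pos.le) (sub_nonneg.2 hx)

lemma abs_sineCoeff_le {x : ℝ} (hx : x ≤ 1) (n : ℕ) : |sineCoeff x n| ≤ 4 * (1 - x) := by
  have hn : (0 : ℝ) < (n : ℝ) + 1 := by positivity
  have hs := abs_sin_nat_mul_pi_mul_le (n + 1) hx
  push_cast at hs
  rw [sineCoeff, abs_mul, abs_mul, abs_two]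
  calc _ ≤ 2 * (((n : ℝ) + 1) * Real.pi * (1 - x)) * (2 / (((n : ℝ) + 1) * Real.pi)) := by
        gcongr
        exact abs_integral_sin_mul_pi_mul_le hn
    _ = 4 * (1 - x) := by
        have := Real.pi_ne_zero
        field_simp
        ring

lemma sineCoeff_zero_le {x : ℝ} (hx : x ∈ Set.Ioo (0 : ℝ) 1) :
    sineCoeff x 0 ≤ 4 * Real.sin (Real.pi * x) := by
  have hpos : 0 ≤ Real.sin (Real.pi * x) :=
    Real.sin_nonneg_of_nonneg_of_le_pi (mul_nonneg Real.pi_pos.le hx.1.le)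
      (mul_le_of_le_one_right Real.pi_pos.le hx.2.le)
  have h := (le_abs_self _).trans (abs_integral_sin_mul_pi_mul_le one_pos)
  have hpi : 2 / (1 * Real.pi) ≤ 2 := by
    rw [one_mul, div_le_iff₀ Real.pi_pos]
    linarith [Real.pi_gt_three]
  simp only [sineCoeff, Nat.cast_zero, zero_add, one_mul] at h hpi ⊢
  nlinarith

lemma summable_exp_neg_pi_sq_mul {r : ℝ} (hr : 0 < r) :
    Summable fun n : ℕ => Real.exp (-(Real.pi ^ 2 * ((n : ℝ) + 1) ^ 2 * r) / 2) := by
  have h := Real.summable_exp_nat_mul_of_ge (c := -(Real.pi ^ 2 * r / 2))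
    (neg_neg_of_pos (by have := Real.pi_pos; positivity))
    (f := fun n : ℕ => ((n : ℝ) + 1) ^ 2)
    (fun n => by nlinarith [n.cast_nonneg (α := ℝ)])
  refine h.congr fun n => ?_
  congr 1
  ring

lemma integral_w_eq {r : ℝ} (hr : 0 < r) (x : ℝ) :
    ∫ y in (0 : ℝ)..1, w r x y =
      ∑' n : ℕ, Real.exp (-(Real.pi ^ 2 * ((n : ℝ) + 1) ^ 2 * r) / 2) * sineCoeff x n := by
  have hsum := summable_exp_neg_pi_sq_mul hr
  have hbound : ∀ (n : ℕ) (y : ℝ), ‖Real.exp (-(Real.pi ^ 2 * ((n : ℝ) + 1) ^ 2 * r) / 2) *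
      Real.sin (((n : ℝ) + 1) * Real.pi * x) * Real.sin (((n : ℝ) + 1) * Real.pi * y)‖ ≤
      Real.exp (-(Real.pi ^ 2 * ((n : ℝ) + 1) ^ 2 * r) / 2) := by
    intro n y
    rw [norm_mul, norm_mul, Real.norm_of_nonneg (Real.exp_pos _).le, mul_assoc]
    exact mul_le_of_le_one_right (Real.exp_pos _).le
      (mul_le_one₀ (Real.abs_sin_le_one _) (norm_nonneg _) (Real.abs_sin_le_one _))
  have h := intervalIntegral.hasSum_integral_of_dominated_convergence
    (μ := MeasureTheory.volume) (a := (0 : ℝ)) (b := 1)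
    (F := fun (n : ℕ) y => Real.exp (-(Real.pi ^ 2 * ((n : ℝ) + 1) ^ 2 * r) / 2) *
      Real.sin (((n : ℝ) + 1) * Real.pi * x) * Real.sin (((n : ℝ) + 1) * Real.pi * y))
    (fun n _ => Real.exp (-(Real.pi ^ 2 * ((n : ℝ) + 1) ^ 2 * r) / 2))
    (fun n => Continuous.aestronglyMeasurable (by fun_prop))
    (fun n => .of_forall fun y _ => hbound n y)
    (.of_forall fun _ _ => hsum)
    intervalIntegrable_const
    (.of_forall fun y _ => (hsum.of_norm_bounded fun n => hbound n y).hasSum)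
  simp only [w]
  rw [intervalIntegral.integral_const_mul, ← h.tsum_eq, ← tsum_mul_left]
  refine tsum_congr fun n => ?_
  rw [intervalIntegral.integral_const_mul, sineCoeff]
  ring

lemma integral_exp_neg_mul_le {c s : ℝ} (hc : 0 < c) :
    ∫ r in (0 : ℝ)..s, Real.exp (-c * r) ≤ 1 / c := by
  rw [intervalIntegral.integral_comp_mul_left (fun r => Real.exp r) (neg_ne_zero.2 hc.ne'),
    integral_exp, mul_zero, Real.exp_zero, smul_eq_mul, inv_neg, one_div]
  have := mul_pos (inv_pos.2 hc) (Real.exp_pos (-c * s))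
  linarith

/-- The spectral gap `π² ((n + 1)² - 1) / 2` between the `(n + 1)`-st and the first eigenvalue. -/
noncomputable def spectralGap (n : ℕ) : ℝ := Real.pi ^ 2 * (((n : ℝ) + 1) ^ 2 - 1) / 2

lemma sq_le_spectralGap (n : ℕ) : (n : ℝ) ^ 2 ≤ spectralGap n := by
  have hpi : 2 ≤ Real.pi ^ 2 := by nlinarith [Real.pi_gt_three]
  have hn : (0 : ℝ) ≤ n := n.cast_nonneg
  rw [spectralGap]
  nlinarith [mul_nonneg (sub_nonneg.2 hpi) (by positivity : (0 : ℝ) ≤ (n : ℝ) ^ 2 + 2 * n)]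

lemma integral_exp_neg_spectralGap_mul_le {n : ℕ} (hn : n ≠ 0) (s : ℝ) :
    ∫ r in (0 : ℝ)..s, Real.exp (-spectralGap n * r) ≤ 1 / (n : ℝ) ^ 2 := by
  have hn' : (0 : ℝ) < (n : ℝ) ^ 2 := by positivity
  exact (integral_exp_neg_mul_le (hn'.trans_le (sq_le_spectralGap n))).trans
    (one_div_le_one_div_of_le hn' (sq_le_spectralGap n))

lemma exp_mul_integral_w_eq {r : ℝ} (hr : 0 < r) (x : ℝ) :
    Real.exp (Real.pi ^ 2 * r / 2) * (∫ y in (0 : ℝ)..1, w r x y) =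
      ∑' n : ℕ, Real.exp (-spectralGap n * r) * sineCoeff x n := by
  rw [integral_w_eq hr, ← tsum_mul_left]
  refine tsum_congr fun n => ?_
  rw [← mul_assoc, ← Real.exp_add, spectralGap]
  congr 2
  ring

lemma integral_exp_neg_spectralGap_mul_abs_le {x s : ℝ} (hx : x ≤ 1) {n : ℕ} (hn : n ≠ 0)
    (hs : 0 ≤ s) :
    (∫ r in (0 : ℝ)..s, Real.exp (-spectralGap n * r)) * |sineCoeff x n| ≤
      4 * (1 - x) * (1 / (n : ℝ) ^ 2) := by
  rw [mul_comm]
  exact mul_le_mul (abs_sineCoeff_le hx n) (integral_exp_neg_spectralGap_mul_le hn s)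
    (intervalIntegral.integral_nonneg hs fun _ _ => (Real.exp_pos _).le) (by linarith)

lemma hasSum_integral_exp_mul_integral_w {x s : ℝ} (hx : x ≤ 1) (hs : 0 ≤ s) :
    HasSum (fun n : ℕ => (∫ r in (0 : ℝ)..s, Real.exp (-spectralGap n * r)) * sineCoeff x n)
      (∫ r in (0 : ℝ)..s, Real.exp (Real.pi ^ 2 * r / 2) * (∫ y in (0 : ℝ)..1, w r x y)) := by
  have h := MeasureTheory.hasSum_integral_of_summable_integral_norm
    (μ := MeasureTheory.volume.restrict (Set.Ioc 0 s))
    (F := fun (n : ℕ) r => Real.exp (-spectralGap n * r) * sineCoeff x n)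
    (fun n => (Continuous.integrableOn_Ioc (by fun_prop)))
    (by
      simp only [norm_mul, Real.norm_eq_abs, Real.abs_exp, ← intervalIntegral.integral_of_le hs,
        intervalIntegral.integral_mul_const]
      rw [← summable_nat_add_iff 1]
      have hp : Summable fun n : ℕ => 4 * (1 - x) * (1 / (n : ℝ) ^ 2) :=
        (Real.summable_one_div_nat_pow.2 one_lt_two).mul_left _
      exact ((summable_nat_add_iff 1).2 hp).of_nonneg_of_le
        (fun n => mul_nonneg
          (intervalIntegral.integral_nonneg hs fun _ _ => (Real.exp_pos _).le) (abs_nonneg _))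
        (fun n => integral_exp_neg_spectralGap_mul_abs_le hx n.succ_ne_zero hs))
  rw [← MeasureTheory.setIntegral_congr_fun measurableSet_Ioc
    fun r hr => exp_mul_integral_w_eq hr.1 x] at h
  simpa only [← intervalIntegral.integral_of_le hs, intervalIntegral.integral_mul_const] using h

theorem integral_exp_mul_integral_w_le :
    ∃ C : ℝ, 0 < C ∧ ∀ s : ℝ, 0 < s → ∀ x : ℝ, x ∈ Set.Ioo (0 : ℝ) 1 →
      (∫ r in (0 : ℝ)..s, Real.exp (Real.pi ^ 2 * r / 2) * (∫ y in (0 : ℝ)..1, w r x y))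
        ≤ C * (s * Real.sin (Real.pi * x) + (1 - x)) := by
  have hp : Summable fun n : ℕ => 1 / (n : ℝ) ^ 2 := Real.summable_one_div_nat_pow.2 one_lt_two
  have hp0 : 0 ≤ ∑' n : ℕ, 1 / (n : ℝ) ^ 2 := tsum_nonneg fun n => by positivity
  refine ⟨4 + 4 * ∑' n : ℕ, 1 / (n : ℝ) ^ 2, by positivity, fun s hs x hx => ?_⟩
  have hsin : 0 ≤ Real.sin (Real.pi * x) :=
    Real.sin_nonneg_of_nonneg_of_le_pi (mul_nonneg Real.pi_pos.le hx.1.le)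
      (mul_le_of_le_one_right Real.pi_pos.le hx.2.le)
  have hle := hasSum_le (fun n => ?_) (hasSum_integral_exp_mul_integral_w hx.2.le hs.le)
    ((hasSum_ite_eq 0 (4 * (s * Real.sin (Real.pi * x)))).add (hp.hasSum.mul_left (4 * (1 - x))))
  · refine hle.trans ?_
    nlinarith [mul_nonneg hp0 (mul_nonneg hs.le hsin), hx.2]
  · rcases eq_or_ne n 0 with rfl | hn
    · have h := mul_le_mul_of_nonneg_left (sineCoeff_zero_le hx) hs.le
      simp [spectralGap]
      linarith
    · rw [if_neg hn, zero_add]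
      refine le_trans ?_ (integral_exp_neg_spectralGap_mul_abs_le hx.2.le hn hs.le)
      exact mul_le_mul_of_nonneg_left (le_abs_self _)
        (intervalIntegral.integral_nonneg hs.le fun _ _ => (Real.exp_pos _).le)
end

section
/- There exists a constant C > 0 such that for every x ∈ (0,1) and every y ∈ (0, 1/2], ∫_0^1 (sup_{y' ∈ [0,y]} w_r(x,y')) dr ≤ C·y·(1 − x). -/
open Real intervalIntegral

/-- The difference of the Gaussian profiles `z ↦ e^{-z²/(2s)}` centred at `y` and at `-y`. -/
noncomputable def gaussDiff (s u y : ℝ) : ℝ :=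
  exp (-(u - y) ^ 2 / (2 * s)) - exp (-(u + y) ^ 2 / (2 * s))

theorem gaussDiff_neg (s u y : ℝ) : gaussDiff s (-u) y = -gaussDiff s u y := by
  unfold gaussDiff
  rw [show (-u - y) ^ 2 = (u + y) ^ 2 by ring, show (-u + y) ^ 2 = (u - y) ^ 2 by ring]
  ring

theorem w_eq_cosKernel_sub {s : ℝ} (hs : 0 < s) (x y : ℝ) :
    w s x y = (HurwitzZeta.cosKernel ((x - y) / 2 : ℝ) (π * s / 2) -
      HurwitzZeta.cosKernel ((x + y) / 2 : ℝ) (π * s / 2)) / 2 := by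
  have ht : 0 < π * s / 2 := by positivity
  have h := (HurwitzZeta.hasSum_nat_cosKernel₀ ((x - y) / 2) ht).sub
    (HurwitzZeta.hasSum_nat_cosKernel₀ ((x + y) / 2) ht)
  rw [sub_sub_sub_cancel_right] at h
  have hterm (n : ℕ) : exp (-(π ^ 2 * ((n : ℝ) + 1) ^ 2 * s) / 2) *
      sin (((n : ℝ) + 1) * π * x) * sin (((n : ℝ) + 1) * π * y) =
      (2 * cos (2 * π * ((x - y) / 2) * (n + 1)) * exp (-π * (n + 1) ^ 2 * (π * s / 2)) -
        2 * cos (2 * π * ((x + y) / 2) * (n + 1)) * exp (-π * (n + 1) ^ 2 * (π * s / 2))) / 4 := by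
    rw [show 2 * π * ((x - y) / 2) * (n + 1) = (n + 1) * π * x - (n + 1) * π * y by ring,
      show 2 * π * ((x + y) / 2) * (n + 1) = (n + 1) * π * x + (n + 1) * π * y by ring,
      show -π * ((n : ℝ) + 1) ^ 2 * (π * s / 2) = -(π ^ 2 * ((n : ℝ) + 1) ^ 2 * s) / 2 by ring,
      cos_sub, cos_add]
    ring
  rw [w, tsum_congr hterm, (h.div_const 4).tsum_eq]
  ring

/-- The reflection formula for the killed heat kernel, with the images paired so that each
bracket vanishes at `x = 1`. -/
theorem hasSum_gaussDiff_sub {s : ℝ} (hs : 0 < s) (x y : ℝ) :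
    HasSum (fun k : ℕ ↦ gaussDiff s (2 * k + x) y - gaussDiff s (2 * k + 2 - x) y)
      (√(2 * π * s) * w s x y) := by
  have ht : 0 < π * s / 2 := by positivity
  have heven (a : ℝ) : HasSum (fun n : ℤ ↦ exp (-(2 * n + 2 * a) ^ 2 / (2 * s)))
      (√(π * s / 2) * HurwitzZeta.cosKernel a (π * s / 2)) := by
    convert HurwitzZeta.hasSum_int_evenKernel a (one_div_pos.2 ht) using 1
    · ext n
      congr 1
      field_simp
    · rw [HurwitzZeta.evenKernel_functional_equation, one_div_one_div, ← sqrt_eq_rpow,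
        one_div (π * s / 2), sqrt_inv, one_div, inv_inv]
  have h := ((heven ((x - y) / 2)).sub (heven ((x + y) / 2))).nat_add_neg_add_one
  have hsqrt : √(2 * π * s) = 2 * √(π * s / 2) := by
    rw [show 2 * π * s = 2 ^ 2 * (π * s / 2) by ring, sqrt_mul (by positivity),
      sqrt_sq (by norm_num)]
  have hw : √(2 * π * s) * w s x y =
      √(π * s / 2) * HurwitzZeta.cosKernel ((x - y) / 2 : ℝ) (π * s / 2) -
        √(π * s / 2) * HurwitzZeta.cosKernel ((x + y) / 2 : ℝ) (π * s / 2) := by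
    rw [w_eq_cosKernel_sub hs, hsqrt]
    ring
  rw [hw]
  refine h.congr_fun fun k ↦ ?_
  rw [sub_eq_add_neg (gaussDiff s (2 * k + x) y), ← gaussDiff_neg]
  unfold gaussDiff
  push_cast
  ring_nf

/-- `t ↦ tⁿ e^{-t}` is bounded by `n!` on the nonnegative reals. -/
theorem pow_mul_exp_neg_le_factorial {t : ℝ} (ht : 0 ≤ t) (n : ℕ) :
    t ^ n * exp (-t) ≤ n.factorial := by
  rw [exp_neg, ← div_eq_mul_inv, div_le_iff₀ (exp_pos t), mul_comm,
    ← div_le_iff₀ (by positivity)]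
  exact pow_div_factorial_le_exp t ht n

theorem gaussDiff_nonneg {s u y : ℝ} (hs : 0 < s) (hu : 0 ≤ u) (hy : 0 ≤ y) :
    0 ≤ gaussDiff s u y := by
  unfold gaussDiff
  rw [sub_nonneg]
  gcongr 2
  nlinarith [mul_nonneg hu hy]

theorem gaussDiff_le_one {s : ℝ} (hs : 0 < s) (u y : ℝ) : gaussDiff s u y ≤ 1 := by
  have h : exp (-(u - y) ^ 2 / (2 * s)) ≤ 1 :=
    exp_le_one_iff.2 (div_nonpos_of_nonpos_of_nonneg (by nlinarith [sq_nonneg (u - y)])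
      (by positivity))
  have := exp_pos (-(u + y) ^ 2 / (2 * s))
  unfold gaussDiff
  linarith

theorem gaussDiff_le_mul_exp {s : ℝ} (hs : 0 < s) (u y : ℝ) :
    gaussDiff s u y ≤ 2 * u * y / s * exp (-(u - y) ^ 2 / (2 * s)) := by
  have h : exp (-(u + y) ^ 2 / (2 * s)) =
      exp (-(u - y) ^ 2 / (2 * s)) * exp (-(2 * u * y / s)) := by
    rw [← exp_add]
    congr 1
    field_simp
    ring
  have := add_one_le_exp (-(2 * u * y / s))
  unfold gaussDiff
  rw [h]
  nlinarith [exp_pos (-(u - y) ^ 2 / (2 * s))]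

/-- Gaussian decay of `gaussDiff` away from the origin, in the form `y s / u³`. -/
theorem gaussDiff_mul_cube_le {s u y : ℝ} (hs : 0 < s) (hu : 0 < u) (hy : 0 ≤ y)
    (hyu : 4 * y ≤ u) : gaussDiff s u y * u ^ 3 ≤ 64 * y * s := by
  have hexp : exp (-(u - y) ^ 2 / (2 * s)) ≤ exp (-(u ^ 2 / (4 * s))) := by
    rw [exp_le_exp, ← neg_div, div_le_div_iff₀ (by positivity) (by positivity)]
    nlinarith [mul_le_mul_of_nonneg_right (show u ^ 2 ≤ 2 * (u - y) ^ 2 by nlinarith) hs.le]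
  have hpow := pow_mul_exp_neg_le_factorial (show 0 ≤ u ^ 2 / (4 * s) by positivity) 2
  calc gaussDiff s u y * u ^ 3
      ≤ (2 * u * y / s * exp (-(u ^ 2 / (4 * s)))) * u ^ 3 := by
        gcongr
        exact (gaussDiff_le_mul_exp hs u y).trans (by gcongr)
    _ = 32 * y * s * ((u ^ 2 / (4 * s)) ^ 2 * exp (-(u ^ 2 / (4 * s)))) := by
        field_simp
        ring
    _ ≤ 32 * y * s * (Nat.factorial 2 : ℕ) := by gcongr
    _ = 64 * y * s := by norm_num; ring

theorem gaussDiff_mul_add_sq_le {s x y y' : ℝ} (hs : 0 < s) (hx : 0 < x) (hy' : 0 ≤ y')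
    (hyy : y' ≤ y) : gaussDiff s x y' * (s + (x + y) ^ 2) ≤ 38 * y * (x + y) := by
  have hy : 0 ≤ y := hy'.trans hyy
  have hD0 := gaussDiff_nonneg hs hx.le hy'
  have hDs : gaussDiff s x y' * s ≤ 2 * x * y := by
    have h1 : exp (-(x - y') ^ 2 / (2 * s)) ≤ 1 :=
      exp_le_one_iff.2 (div_nonpos_of_nonpos_of_nonneg (by nlinarith [sq_nonneg (x - y')])
        (by positivity))
    rw [← le_div_iff₀ hs]
    calc gaussDiff s x y' ≤ 2 * x * y' / s * 1 :=
          (gaussDiff_le_mul_exp hs x y').trans (by gcongr)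
      _ ≤ 2 * x * y / s := by rw [mul_one]; gcongr
  rcases le_total x (2 * y) with h | h
  · nlinarith [mul_le_mul_of_nonneg_right (gaussDiff_le_one hs x y') (sq_nonneg (x + y)),
      mul_nonneg hx.le hy, mul_nonneg (show 0 ≤ 2 * y - x by linarith) hx.le]
  · have hexp : exp (-(x - y') ^ 2 / (2 * s)) ≤ exp (-(x ^ 2 / (8 * s))) := by
      rw [exp_le_exp, ← neg_div, div_le_div_iff₀ (by positivity) (by positivity)]
      nlinarith [mul_le_mul_of_nonneg_right (show x ^ 2 ≤ 4 * (x - y') ^ 2 by nlinarith) hs.le]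
    have hpow := pow_mul_exp_neg_le_factorial (show 0 ≤ x ^ 2 / (8 * s) by positivity) 1
    have hDx : gaussDiff s x y' * x ^ 2 ≤ 16 * x * y :=
      calc gaussDiff s x y' * x ^ 2
          ≤ (2 * x * y / s * exp (-(x ^ 2 / (8 * s)))) * x ^ 2 := by
            gcongr
            exact (gaussDiff_le_mul_exp hs x y').trans (by gcongr)
        _ = 16 * x * y * ((x ^ 2 / (8 * s)) ^ 1 * exp (-(x ^ 2 / (8 * s)))) := by
            field_simp
            ring
        _ ≤ 16 * x * y * (Nat.factorial 1 : ℕ) := by gcongr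
        _ = 16 * x * y := by norm_num
    have hm : (x + y) ^ 2 ≤ 9 / 4 * x ^ 2 := by nlinarith
    nlinarith [mul_le_mul_of_nonneg_left hm hD0, mul_nonneg hx.le hy]

theorem hasDerivAt_gauss (s z : ℝ) :
    HasDerivAt (fun z ↦ exp (-z ^ 2 / (2 * s))) (-(z / s) * exp (-z ^ 2 / (2 * s))) z := by
  refine ((hasDerivAt_pow 2 z).neg.div_const (2 * s)).exp.congr_deriv ?_
  simp only [Pi.neg_apply]
  field_simp
  norm_num
  ring

theorem hasDerivAt_gauss_deriv (s z : ℝ) :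
    HasDerivAt (fun z ↦ -(z / s) * exp (-z ^ 2 / (2 * s)))
      ((z ^ 2 / s ^ 2 - 1 / s) * exp (-z ^ 2 / (2 * s))) z := by
  refine (((hasDerivAt_id z).div_const s).neg.mul (hasDerivAt_gauss s z)).congr_deriv ?_
  simp only [id, Pi.neg_apply]
  ring

theorem abs_gauss_deriv_deriv_le {s z c : ℝ} (hs : 0 < s) (hc : 0 < c) (hz : c ≤ z) :
    |(z ^ 2 / s ^ 2 - 1 / s) * exp (-z ^ 2 / (2 * s))| ≤ 56 * s / c ^ 4 := by
  have hz0 : 0 < z := hc.trans_le hz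
  set t := z ^ 2 / (2 * s) with ht
  have ht0 : 0 < t := by positivity
  have h2 := pow_mul_exp_neg_le_factorial ht0.le 2
  have h3 := pow_mul_exp_neg_le_factorial ht0.le 3
  norm_num [Nat.factorial] at h2 h3
  calc |(z ^ 2 / s ^ 2 - 1 / s) * exp (-z ^ 2 / (2 * s))|
      = |z ^ 2 / s ^ 2 - 1 / s| * exp (-t) := by rw [abs_mul, abs_exp, ht, neg_div]
    _ ≤ (z ^ 2 / s ^ 2 + 1 / s) * exp (-t) := by
        gcongr
        refine (abs_sub _ _).trans_eq ?_
        rw [abs_of_pos (by positivity), abs_of_pos (by positivity)]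
    _ = (2 * (t ^ 3 * exp (-t)) + t ^ 2 * exp (-t)) * (4 * s / z ^ 4) := by
        rw [ht]
        field_simp
        ring
    _ ≤ (2 * 6 + 2) * (4 * s / z ^ 4) := by gcongr
    _ = 56 * s / z ^ 4 := by ring
    _ ≤ 56 * s / c ^ 4 := by gcongr

theorem abs_gaussDiff_sub_le {s a b y c : ℝ} (hs : 0 < s) (hc : 0 < c) (hy : 0 ≤ y)
    (hab : a ≤ b) (hca : c + y ≤ a) :
    |gaussDiff s b y - gaussDiff s a y| ≤ 56 * s / c ^ 4 * (2 * y) * (b - a) := by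
  have hinner : ∀ u ∈ Set.Icc a b,
      ‖-((u - y) / s) * exp (-(u - y) ^ 2 / (2 * s)) -
        -((u + y) / s) * exp (-(u + y) ^ 2 / (2 * s))‖ ≤ 56 * s / c ^ 4 * (2 * y) := by
    intro u hu
    have := (convex_Ici c).norm_image_sub_le_of_norm_hasDerivWithin_le
      (f := fun z ↦ -(z / s) * exp (-z ^ 2 / (2 * s)))
      (fun z _ ↦ (hasDerivAt_gauss_deriv s z).hasDerivWithinAt)
      (fun z hz ↦ abs_gauss_deriv_deriv_le hs hc hz)
      (show u + y ∈ Set.Ici c by simp; linarith [hu.1])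
      (show u - y ∈ Set.Ici c by simp; linarith [hu.1])
    refine this.trans_eq ?_
    rw [norm_eq_abs, show u - y - (u + y) = -(2 * y) by ring, abs_neg,
      abs_of_nonneg (by positivity)]
  have := (convex_Icc a b).norm_image_sub_le_of_norm_hasDerivWithin_le
    (f := fun u ↦ gaussDiff s u y)
    (fun u _ ↦ (((hasDerivAt_gauss s (u - y)).comp_sub_const u y).sub
      ((hasDerivAt_gauss s (u + y)).comp_add_const u y)).hasDerivWithinAt)
    hinner (Set.left_mem_Icc.2 hab) (Set.right_mem_Icc.2 hab)
  simpa only [norm_eq_abs, abs_of_nonneg (sub_nonneg.2 hab)] using this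

theorem one_le_sqrt_two_pi : 1 ≤ √(2 * π) := by
  rw [one_le_sqrt]
  linarith [pi_gt_three]

theorem w_le_of_sqrt_mul_le {s x y b : ℝ} (hs : 0 < s) (hb : 0 ≤ b)
    (h : √(2 * π * s) * w s x y ≤ b) : w s x y ≤ b / √s := by
  have hs' := sqrt_pos.2 hs
  rw [sqrt_mul (by positivity)] at h
  rw [le_div_iff₀ hs']
  by_contra! hlt
  nlinarith [one_le_sqrt_two_pi]

theorem w_le_of_bound {s x y b c : ℝ} (hs : 0 < s) (hs1 : s ≤ 1) (hb : 0 ≤ b) (hc : 0 ≤ c)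
    (h : √(2 * π * s) * w s x y ≤ b + c * s) : w s x y ≤ b / √s + c := by
  refine (w_le_of_sqrt_mul_le hs (by positivity) h).trans ?_
  rw [add_div, mul_div_assoc, div_sqrt]
  have : √s ≤ 1 := sqrt_le_one.2 hs1
  gcongr
  exact mul_le_of_le_one_right hc this

theorem summable_one_div_succ_sq : Summable fun k : ℕ ↦ 1 / ((k : ℝ) + 1) ^ 2 := by
  exact_mod_cast (summable_nat_add_iff 1).2 (Real.summable_one_div_nat_pow.2 one_lt_two)

theorem w_le_of_near_one {s x y : ℝ} (hs : 0 < s) (hs1 : s ≤ 1) (hx : 3 / 4 ≤ x) (hx1 : x ≤ 1)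
    (hy : 0 ≤ y) (hy2 : y ≤ 1 / 2) :
    w s x y ≤ 57344 * y * (1 - x) * ∑' k : ℕ, 1 / ((k : ℝ) + 1) ^ 2 := by
  have hx0 : 0 ≤ 1 - x := by linarith
  have hterm (k : ℕ) : gaussDiff s (2 * k + x) y - gaussDiff s (2 * k + 2 - x) y ≤
      57344 * y * (1 - x) * s * (1 / ((k : ℝ) + 1) ^ 2) := by
    have hk : (0 : ℝ) ≤ k := k.cast_nonneg
    have h := abs_gaussDiff_sub_le (c := (k + 1) / 4) hs (by positivity) hy
      (show 2 * (k : ℝ) + x ≤ 2 * k + 2 - x by linarith) (by linarith)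
    rw [abs_sub_comm] at h
    refine ((le_abs_self _).trans h).trans ?_
    have h4 : 1 / ((k : ℝ) + 1) ^ 4 ≤ 1 / ((k : ℝ) + 1) ^ 2 := by
      gcongr <;> linarith
    calc _ = 57344 * y * (1 - x) * s * (1 / ((k : ℝ) + 1) ^ 4) := by
          field_simp
          ring
      _ ≤ _ := by gcongr
  have hsum := hasSum_le hterm (hasSum_gaussDiff_sub hs x y)
    (summable_one_div_succ_sq.hasSum.mul_left _)
  have hS : 0 ≤ ∑' k : ℕ, 1 / ((k : ℝ) + 1) ^ 2 := tsum_nonneg fun k ↦ by positivity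
  have := w_le_of_bound (b := 0)
    (c := 57344 * y * (1 - x) * ∑' k : ℕ, 1 / ((k : ℝ) + 1) ^ 2) hs hs1 le_rfl
    (by positivity) (hsum.trans_eq (by ring))
  simpa using this

theorem w_le_of_lt_one {s x y y' : ℝ} (hs : 0 < s) (hs1 : s ≤ 1) (hx : 0 < x) (hx1 : x ≤ 1)
    (hy' : 0 ≤ y') (hyy : y' ≤ y) (hy2 : y ≤ 1 / 2) :
    w s x y' ≤ 38 * y * ((x + y) / (√s * (s + (x + y) ^ 2))) +
      64 * y * ∑' k : ℕ, 1 / ((k : ℝ) + 1) ^ 2 := by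
  have hy : 0 ≤ y := hy'.trans hyy
  have hterm (k : ℕ) : gaussDiff s (2 * k + x) y' - gaussDiff s (2 * k + 2 - x) y' ≤
      (if k = 0 then gaussDiff s x y' else 0) + 64 * y * s * (1 / ((k : ℝ) + 1) ^ 2) := by
    have hk : (0 : ℝ) ≤ k := k.cast_nonneg
    have h0 := gaussDiff_nonneg hs (show 0 ≤ 2 * (k : ℝ) + 2 - x by linarith) hy'
    refine (sub_le_self _ h0).trans ?_
    rcases Nat.eq_zero_or_pos k with rfl | hkpos
    · simp
      positivity
    · have hk1 : (1 : ℝ) ≤ k := by exact_mod_cast hkpos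
      have hu : (k : ℝ) + 1 ≤ 2 * k + x := by linarith
      have h := gaussDiff_mul_cube_le hs (show 0 < 2 * (k : ℝ) + x by linarith) hy'
        (by linarith)
      rw [← le_div_iff₀ (by positivity)] at h
      rw [if_neg hkpos.ne', zero_add, mul_one_div]
      refine h.trans ?_
      have : ((k : ℝ) + 1) ^ 2 ≤ (2 * k + x) ^ 3 := by
        calc ((k : ℝ) + 1) ^ 2 ≤ (k + 1) ^ 3 := pow_le_pow_right₀ (by linarith) (by norm_num)
          _ ≤ _ := by gcongr
      gcongr
  have hsum := hasSum_le hterm (hasSum_gaussDiff_sub hs x y')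
    ((hasSum_ite_eq 0 (gaussDiff s x y')).add (summable_one_div_succ_sq.hasSum.mul_left _))
  have hS : 0 ≤ ∑' k : ℕ, 1 / ((k : ℝ) + 1) ^ 2 := tsum_nonneg fun k ↦ by positivity
  have := w_le_of_bound (b := gaussDiff s x y')
    (c := 64 * y * ∑' k : ℕ, 1 / ((k : ℝ) + 1) ^ 2) hs hs1 (gaussDiff_nonneg hs hx.le hy')
    (by positivity) (hsum.trans_eq (by ring))
  refine this.trans ?_
  gcongr ?_ + _
  have hD := gaussDiff_mul_add_sq_le hs hx hy' hyy
  have hs' := sqrt_pos.2 hs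
  rw [← le_div_iff₀ (by positivity)] at hD
  calc gaussDiff s x y' / √s ≤ 38 * y * (x + y) / (s + (x + y) ^ 2) / √s := by gcongr
    _ = _ := by field_simp

theorem hasDerivAt_arctan_sqrt_div {m r : ℝ} (hm : 0 < m) (hr : 0 < r) :
    HasDerivAt (fun r ↦ 2 * arctan (√r / m)) (m / (√r * (r + m ^ 2))) r := by
  have hs := sqrt_pos.2 hr
  refine ((((hasDerivAt_sqrt hr.ne').div_const m).arctan).const_mul 2).congr_deriv ?_
  rw [div_pow, sq_sqrt hr.le]
  field_simp
  ring

theorem intervalIntegrable_div_sqrt_mul {m : ℝ} (hm : 0 < m) :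
    IntervalIntegrable (fun r ↦ m / (√r * (r + m ^ 2))) MeasureTheory.volume 0 1 := by
  rw [intervalIntegrable_iff_integrableOn_Ioc_of_le zero_le_one]
  refine integrableOn_deriv_of_nonneg (g := fun r ↦ 2 * arctan (√r / m)) (by fun_prop)
    (fun r hr ↦ hasDerivAt_arctan_sqrt_div hm hr.1) fun r hr ↦ ?_
  have := hr.1
  positivity

theorem integral_div_sqrt_mul_le {m : ℝ} (hm : 0 < m) :
    ∫ r in (0 : ℝ)..1, m / (√r * (r + m ^ 2)) ≤ π := by
  rw [integral_eq_sub_of_hasDerivAt_of_le zero_le_one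
    (f := fun r ↦ 2 * arctan (√r / m)) (by fun_prop)
    (fun r hr ↦ hasDerivAt_arctan_sqrt_div hm hr.1) (intervalIntegrable_div_sqrt_mul hm)]
  have := arctan_lt_pi_div_two (1 / m)
  simp only [sqrt_one, sqrt_zero, zero_div, arctan_zero]
  linarith

/-- An upper bound for an interval integral that does not require integrability of the integrand,
since nonintegrable functions have integral zero. -/
theorem integral_le_of_le_of_nonneg {f g : ℝ → ℝ} {a b c : ℝ} (hab : a ≤ b)
    (hg : IntervalIntegrable g MeasureTheory.volume a b)
    (hfg : ∀ r ∈ Set.Ioo a b, f r ≤ g r) (hgc : ∫ r in a..b, g r ≤ c) (hc : 0 ≤ c) :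
    ∫ r in a..b, f r ≤ c := by
  by_cases hf : IntervalIntegrable f MeasureTheory.volume a b
  · exact (integral_mono_on_of_le_Ioo hab hf hg hfg).trans hgc
  · rwa [integral_undef hf]

theorem integral_sup_w_le :
    ∃ C : ℝ, 0 < C ∧ ∀ x : ℝ, x ∈ Set.Ioo (0 : ℝ) 1 →
      ∀ y : ℝ, y ∈ Set.Ioc (0 : ℝ) (1 / 2) →
      (∫ r in (0 : ℝ)..1, ⨆ y' : Set.Icc (0 : ℝ) y, w r x (y' : ℝ))
        ≤ C * y * (1 - x) := by
  set S := ∑' k : ℕ, 1 / ((k : ℝ) + 1) ^ 2 with hSdef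
  have hS : 0 ≤ S := tsum_nonneg fun k ↦ by positivity
  refine ⟨57344 * S + 4 * (38 * π + 64 * S), by positivity, fun x hx y hy ↦ ?_⟩
  obtain ⟨hx0, hx1⟩ := hx
  obtain ⟨hy0, hy2⟩ := hy
  have hx1' : 0 < 1 - x := sub_pos.2 hx1
  have : Nonempty (Set.Icc (0 : ℝ) y) := ⟨⟨0, le_rfl, hy0.le⟩⟩
  rcases le_total (3 / 4) x with h | h
  · refine integral_le_of_le_of_nonneg zero_le_one
      (g := fun _ ↦ 57344 * y * (1 - x) * S) (by simp) (fun r hr ↦ ciSup_le fun y' ↦ ?_) ?_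
      (by positivity)
    · refine (w_le_of_near_one hr.1 hr.2.le h hx1.le y'.2.1 (y'.2.2.trans hy2)).trans ?_
      have := y'.2.2
      gcongr
    · rw [intervalIntegral.integral_const, sub_zero, one_smul]
      have : 0 ≤ 4 * (38 * π + 64 * S) * y * (1 - x) := by positivity
      linarith
  · have hm : 0 < x + y := by positivity
    have hint := (intervalIntegrable_div_sqrt_mul hm).const_mul (38 * y)
    refine integral_le_of_le_of_nonneg zero_le_one
      (hint.add (intervalIntegrable_const (c := 64 * y * S)))
      (fun r hr ↦ ciSup_le fun y' ↦
        w_le_of_lt_one hr.1 hr.2.le hx0 hx1.le y'.2.1 y'.2.2 hy2) ?_ (by positivity)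
    rw [intervalIntegral.integral_add hint intervalIntegrable_const,
      intervalIntegral.integral_const_mul, intervalIntegral.integral_const, sub_zero, one_smul]
    calc 38 * y * (∫ r in (0 : ℝ)..1, (x + y) / (√r * (r + (x + y) ^ 2))) + 64 * y * S
        ≤ 38 * y * π + 64 * y * S := by
          gcongr
          exact integral_div_sqrt_mul_le hm
      _ = 1 * ((38 * π + 64 * S) * y) := by ring
      _ ≤ 4 * (1 - x) * ((38 * π + 64 * S) * y) := by
          gcongr
          linarith
      _ ≤ (57344 * S + 4 * (38 * π + 64 * S)) * y * (1 - x) := by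
          have : 0 ≤ 57344 * S * y * (1 - x) := by positivity
          linarith
end

section
/- There exists a constant C > 0 such that for every r ≥ 1 and all x, y ∈ [0,1], sup_{y' ∈ [0,y]} w_r(x,y') ≤ C·e^{−π²r/2}·sin(πx)·y. -/
open Real

theorem abs_sin_nat_mul_le (n : ℕ) (a : ℝ) : |sin (n * a)| ≤ n * |sin a| := by
  induction n with
  | zero => simp
  | succ n ih =>
    have h : sin ((n + 1 : ℕ) * a) = sin (n * a) * cos a + cos (n * a) * sin a := by
      push_cast
      rw [add_mul, one_mul, sin_add]
    rw [h]
    calc |sin (n * a) * cos a + cos (n * a) * sin a|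
        ≤ |sin (n * a)| * |cos a| + |cos (n * a)| * |sin a| := by
          rw [← abs_mul, ← abs_mul]
          exact abs_add_le _ _
      _ ≤ |sin (n * a)| * 1 + 1 * |sin a| := by
          gcongr
          · exact abs_cos_le_one _
          · exact abs_cos_le_one _
      _ ≤ (n + 1 : ℕ) * |sin a| := by
          push_cast
          linarith

theorem summable_succ_sq_mul_exp_neg : Summable fun n : ℕ => ((n : ℝ) + 1) ^ 2 * exp (-n) := by
  have h := (summable_nat_add_iff 1).2 (Real.summable_pow_mul_exp_neg_nat_mul 2 one_pos)
  refine (h.mul_right (exp 1)).congr fun n => ?_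
  push_cast
  rw [mul_assoc, ← exp_add]
  ring_nf

theorem exp_succ_sq_le {r : ℝ} (hr : 1 ≤ r) (n : ℕ) :
    exp (-(π ^ 2 * ((n : ℝ) + 1) ^ 2 * r) / 2) ≤ exp (-(π ^ 2 * r) / 2) * exp (-n) := by
  rw [← exp_add, exp_le_exp]
  have hn : (0 : ℝ) ≤ n := n.cast_nonneg
  have hπ : 1 ≤ π ^ 2 * r := by nlinarith [pi_gt_three]
  nlinarith [mul_nonneg (sub_nonneg.2 hπ) (by positivity : (0 : ℝ) ≤ (n : ℝ) ^ 2 + 2 * n)]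

/-- The spectral expansion of `w` is dominated termwise by a multiple of its first mode. -/
theorem w_le_of_one_le {r x y : ℝ} (hr : 1 ≤ r) (hx : x ∈ Set.Icc (0 : ℝ) 1) (hy : 0 ≤ y) :
    w r x y ≤ 2 * π * (∑' n : ℕ, ((n : ℝ) + 1) ^ 2 * exp (-n)) *
      exp (-(π ^ 2 * r) / 2) * sin (π * x) * y := by
  have hs : 0 ≤ sin (π * x) :=
    sin_nonneg_of_nonneg_of_le_pi (mul_nonneg pi_pos.le hx.1)
      (mul_le_of_le_one_right pi_pos.le hx.2)
  have key := tsum_of_norm_bounded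
    (f := fun n : ℕ => exp (-(π ^ 2 * ((n : ℝ) + 1) ^ 2 * r) / 2) *
      sin (((n : ℝ) + 1) * π * x) * sin (((n : ℝ) + 1) * π * y))
    (summable_succ_sq_mul_exp_neg.hasSum.mul_left
      (exp (-(π ^ 2 * r) / 2) * sin (π * x) * (π * y))) fun n => by
    have h1 : |sin (((n : ℝ) + 1) * π * x)| ≤ ((n : ℝ) + 1) * sin (π * x) := by
      have h := abs_sin_nat_mul_le (n + 1) (π * x)
      rwa [abs_of_nonneg hs, ← mul_assoc, Nat.cast_add_one] at h
    have h2 : |sin (((n : ℝ) + 1) * π * y)| ≤ ((n : ℝ) + 1) * π * y := by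
      have h := abs_sin_le_abs (x := ((n : ℝ) + 1) * π * y)
      rwa [abs_of_nonneg (a := ((n : ℝ) + 1) * π * y) (by positivity)] at h
    rw [norm_mul, norm_mul, norm_of_nonneg (exp_pos _).le, norm_eq_abs, norm_eq_abs]
    calc _ ≤ exp (-(π ^ 2 * r) / 2) * exp (-n) * (((n : ℝ) + 1) * sin (π * x)) *
          (((n : ℝ) + 1) * π * y) := by
          gcongr
          exact exp_succ_sq_le hr n
      _ = _ := by ring
  calc w r x y ≤ 2 * _ := mul_le_mul_of_nonneg_left ((le_norm_self _).trans key) two_pos.le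
    _ = _ := by ring

theorem sup_w_le_of_one_le :
    ∃ C : ℝ, 0 < C ∧ ∀ r : ℝ, 1 ≤ r → ∀ x y : ℝ,
      x ∈ Set.Icc (0 : ℝ) 1 → y ∈ Set.Icc (0 : ℝ) 1 →
      (⨆ y' : Set.Icc (0 : ℝ) y, w r x (y' : ℝ))
        ≤ C * Real.exp (-(Real.pi ^ 2 * r) / 2) * Real.sin (Real.pi * x) * y := by
  have hS : 0 < ∑' n : ℕ, ((n : ℝ) + 1) ^ 2 * exp (-n) :=
    summable_succ_sq_mul_exp_neg.tsum_pos (fun n => by positivity) 0 (by positivity)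
  refine ⟨2 * π * ∑' n : ℕ, ((n : ℝ) + 1) ^ 2 * exp (-n), by positivity, ?_⟩
  intro r hr x y hx hy
  have hs : 0 ≤ sin (π * x) :=
    sin_nonneg_of_nonneg_of_le_pi (mul_nonneg pi_pos.le hx.1)
      (mul_le_of_le_one_right pi_pos.le hx.2)
  have : Nonempty (Set.Icc (0 : ℝ) y) := ⟨⟨0, le_rfl, hy.1⟩⟩
  refine ciSup_le fun y' => (w_le_of_one_le hr hx y'.2.1).trans ?_
  exact mul_le_mul_of_nonneg_left y'.2.2 (by positivity)
end

section
/- For every x > 0, the function L ↦ L·sin(πx/L)·e^{x−L} is strictly decreasing on the interval [x + 2, ∞); that is, if x + 2 ≤ L₁ < L₂ then L₂·sin(πx/L₂)·e^{x−L₂} < L₁·sin(πx/L₁)·e^{x−L₁}. -/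
open Real

/-- The sign condition behind the monotonicity: with `φ = π - π x / L`, the derivative of the
weight in `L` is negative as soon as `2 * π ≤ L * φ`. -/
theorem pi_sub_mul_cos_lt {L φ : ℝ} (hφ : 0 < φ) (hφ' : φ < π) (hL : 2 * π ≤ L * φ) :
    (π - φ) * cos φ < (L - 1) * sin φ := by
  have hs : 0 < sin φ := sin_pos_of_pos_of_lt_pi hφ hφ'
  have hL1 : 0 < L - 1 := by
    by_contra! h
    nlinarith
  rcases le_or_gt (cos φ) 0 with hc | hc
  · nlinarith [mul_pos hL1 hs]
  · have hφ2 : φ < π / 2 := by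
      by_contra! h
      linarith [cos_nonpos_of_pi_div_two_le_of_le h (by linarith)]
    have ht : φ * cos φ < sin φ := by
      have := lt_tan hφ hφ2
      rwa [tan_eq_sin_div_cos, lt_div_iff₀ hc] at this
    have h : π - φ < (L - 1) * φ := by linarith [pi_pos]
    calc (π - φ) * cos φ < (L - 1) * φ * cos φ := mul_lt_mul_of_pos_right h hc
      _ = (L - 1) * (φ * cos φ) := by ring
      _ < (L - 1) * sin φ := mul_lt_mul_of_pos_left ht hL1

theorem hasDerivAt_z_weight (x : ℝ) {L : ℝ} (hL : L ≠ 0) :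
    HasDerivAt (fun L => L * sin (π * x / L) * exp (x - L))
      ((sin (π * x / L) - π * x / L * cos (π * x / L) - L * sin (π * x / L)) * exp (x - L)) L := by
  have h := ((hasDerivAt_id L).mul
    (((hasDerivAt_const L (π * x)).div (hasDerivAt_id L) hL).sin)).mul
    (((hasDerivAt_const L x).sub (hasDerivAt_id L)).exp)
  refine h.congr_deriv ?_
  simp only [id, Pi.mul_apply, Pi.div_apply, Pi.sub_apply]
  field_simp
  ring

theorem z_weight_strictAnti (x : ℝ) (hx : 0 < x) :
    ∀ L₁ L₂ : ℝ, x + 2 ≤ L₁ → L₁ < L₂ →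
      L₂ * Real.sin (Real.pi * x / L₂) * Real.exp (x - L₂) <
        L₁ * Real.sin (Real.pi * x / L₁) * Real.exp (x - L₁) := by
  have hanti : StrictAntiOn (fun L : ℝ => L * sin (π * x / L) * exp (x - L)) (Set.Ici (x + 2)) := by
    refine strictAntiOn_of_deriv_neg (convex_Ici _) (fun L hL => ?_) (fun L hL => ?_)
    · have hL : x + 2 ≤ L := hL
      exact (hasDerivAt_z_weight x (by linarith)).continuousAt.continuousWithinAt
    · have hL : x + 2 ≤ L := interior_subset hL
      have hL0 : 0 < L := by linarith
      rw [(hasDerivAt_z_weight x hL0.ne').deriv]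
      refine mul_neg_of_neg_of_pos ?_ (exp_pos _)
      have hθ : 0 < π * x / L := by positivity
      have hmul : L * (π - π * x / L) = π * (L - x) := by field_simp
      have hbound : 2 * π ≤ L * (π - π * x / L) := by
        rw [hmul]
        nlinarith [pi_pos]
      have hφ : 0 < π - π * x / L :=
        pos_of_mul_pos_right (lt_of_lt_of_le two_pi_pos hbound) hL0.le
      have h := pi_sub_mul_cos_lt hφ (by linarith) hbound
      rw [cos_pi_sub, sin_pi_sub] at h
      linarith
  intro L₁ L₂ h₁ h₂
  exact hanti h₁ (h₁.trans h₂.le) h₂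
end

section
/- Let c = (3π²/2)^{1/3} and, for t > 0, let L_t = c·t^{1/3} and z_t(x) = L_t·sin(πx/L_t)·e^{x−L_t} for x ∈ [0, L_t]. Let k > 0, let (t_n) be a sequence of positive reals with t_n → ∞, and let (x_n) be a sequence with x_n > 0 for all n and L_{t_n} − x_n → ∞. Then (for all sufficiently large n the quantity z_{t_n − k·t_n^{2/3}}(x_n) is defined, and) lim_{n→∞} z_{t_n − k·t_n^{2/3}}(x_n) / z_{t_n}(x_n) = e^{ck/3}. -/
open Real Filter

/-- The weight `z_t(x) = c t^{1/3} sin(πx/(c t^{1/3})) e^{x - c t^{1/3}}` with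
`c = (3π²/2)^{1/3}`, assigned to a particle at position `x` when the branching
Brownian motion with absorption is to survive for time `t`. -/
noncomputable def zWeight (t x : ℝ) : ℝ :=
  (3 * Real.pi ^ 2 / 2) ^ ((1 : ℝ) / 3) * t ^ ((1 : ℝ) / 3) *
    Real.sin (Real.pi * x /
      ((3 * Real.pi ^ 2 / 2) ^ ((1 : ℝ) / 3) * t ^ ((1 : ℝ) / 3))) *
    Real.exp (x - (3 * Real.pi ^ 2 / 2) ^ ((1 : ℝ) / 3) * t ^ ((1 : ℝ) / 3))

open Topology in
/-- `s - (s³ - k s²)^{1/3} → k / 3` as `s → ∞`, written with `s = t^{1/3}`. -/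
theorem tendsto_rpow_third_sub_rpow_third_shift (k : ℝ) :
    Tendsto (fun t : ℝ => t ^ ((1 : ℝ) / 3) - (t - k * t ^ ((2 : ℝ) / 3)) ^ ((1 : ℝ) / 3))
      atTop (𝓝 (k / 3)) := by
  have hd : HasDerivAt (fun u : ℝ => (1 - k * u) ^ ((1 : ℝ) / 3)) (-(k / 3)) 0 := by
    have h1 : HasDerivAt (fun u : ℝ => 1 - k * u) (-k) 0 := by
      simpa using ((hasDerivAt_id (0 : ℝ)).const_mul k).const_sub 1
    convert h1.rpow_const (p := (1 : ℝ) / 3) (by norm_num) using 1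
    norm_num
    ring
  have hs : Tendsto (fun t : ℝ => t ^ ((1 : ℝ) / 3)) atTop atTop :=
    tendsto_rpow_atTop (by norm_num)
  have hu : Tendsto (fun t : ℝ => (t ^ ((1 : ℝ) / 3))⁻¹) atTop (𝓝[≠] 0) :=
    (tendsto_inv_atTop_nhdsGT_zero.comp hs).mono_right
      (nhdsWithin_mono 0 fun y (hy : 0 < y) => hy.ne')
  have hlim := ((hasDerivAt_iff_tendsto_slope.mp hd).comp hu).neg
  rw [neg_neg] at hlim
  refine hlim.congr' ?_
  filter_upwards [eventually_gt_atTop 0, hs.eventually_gt_atTop k] with t ht hk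
  have hs0 : 0 < t ^ ((1 : ℝ) / 3) := by positivity
  have hcube : t = (t ^ ((1 : ℝ) / 3)) ^ (3 : ℕ) := by
    rw [← rpow_natCast, ← rpow_mul ht.le]; norm_num
  have hsq : t ^ ((2 : ℝ) / 3) = (t ^ ((1 : ℝ) / 3)) ^ (2 : ℕ) := by
    rw [← rpow_natCast, ← rpow_mul ht.le]; norm_num
  have hfac : t - k * t ^ ((2 : ℝ) / 3) = t * (1 - k * (t ^ ((1 : ℝ) / 3))⁻¹) := by
    rw [hsq]
    nth_rewrite 1 [hcube]
    nth_rewrite 3 [hcube]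
    field_simp
  have hnonneg : 0 ≤ 1 - k * (t ^ ((1 : ℝ) / 3))⁻¹ := by
    rw [← div_eq_mul_inv, sub_nonneg, div_le_one hs0]
    exact hk.le
  rw [hfac, mul_rpow ht.le hnonneg]
  simp only [Function.comp_apply, slope_def_field, mul_zero, sub_zero, one_rpow]
  field_simp
  ring

/-- Jordan's inequality on both halves of `(0, π)`, in reciprocal form. -/
theorem inv_sin_le_of_mem_Ioo {a : ℝ} (h0 : 0 < a) (hpi : a < π) :
    (Real.sin a)⁻¹ ≤ π / 2 * (a⁻¹ + (π - a)⁻¹) := by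
  have hb : 0 < π - a := sub_pos.mpr hpi
  have key : ∀ b : ℝ, 0 < b → b ≤ π / 2 → (Real.sin b)⁻¹ ≤ π / 2 * b⁻¹ := fun b hb hb2 => by
    calc (Real.sin b)⁻¹ ≤ (2 / π * b)⁻¹ := inv_anti₀ (by positivity) (mul_le_sin hb.le hb2)
      _ = π / 2 * b⁻¹ := by rw [mul_inv, inv_div]
  rw [mul_add]
  rcases le_total a (π / 2) with h | h
  · have : 0 < π / 2 * (π - a)⁻¹ := by positivity
    linarith [key a h0 h]
  · have : 0 < π / 2 * a⁻¹ := by positivity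
    have h2 := key (π - a) hb (by linarith)
    rw [Real.sin_pi_sub] at h2
    linarith

open Topology in
/-- If `0 < x < L` with `L - x → ∞`, a bounded change of `L` (here: one with a limit) does not
change the asymptotics of `sin (π x / L)`. -/
theorem tendsto_sin_ratio_of_tendsto_sub {ι : Type*} {l : Filter ι} {x L M : ι → ℝ} {d : ℝ}
    (hx : ∀ i, 0 < x i) (hL : Tendsto (fun i => L i - x i) l atTop)
    (hd : Tendsto (fun i => L i - M i) l (𝓝 d)) :
    Tendsto (fun i => Real.sin (π * x i / M i) / Real.sin (π * x i / L i)) l (𝓝 1) := by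
  have hM : Tendsto (fun i => M i - x i) l atTop :=
    (hL.atTop_add hd.neg).congr fun i => by ring
  have hM' : Tendsto M l atTop :=
    tendsto_atTop_mono (fun i => by linarith [hx i]) hM
  have hdM : Tendsto (fun i => |L i - M i| / M i) l (𝓝 0) := hd.abs.div_atTop hM'
  have hdL : Tendsto (fun i => |L i - M i| / (L i - x i)) l (𝓝 0) := hd.abs.div_atTop hL
  set h : ι → ℝ := fun i => π * x i / M i - π * x i / L i
  have hev : ∀ᶠ i in l, 0 < L i - x i ∧ 0 < M i - x i :=
    (hL.eventually_gt_atTop 0).and (hM.eventually_gt_atTop 0)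
  have hh : ∀ᶠ i in l, |h i| = π * (x i / L i) * (|L i - M i| / M i) := by
    filter_upwards [hev] with i ⟨h1, h2⟩
    have hxi := hx i
    have hLi : 0 < L i := by linarith
    have hMi : 0 < M i := by linarith
    have : h i = π * (x i / L i) * ((L i - M i) / M i) := by
      simp only [h]; field_simp
    rw [this, abs_mul, abs_div, abs_of_pos hMi, abs_of_pos (by positivity : 0 < π * (x i / L i))]
  have hh0 : Tendsto h l (𝓝 0) := by
    have hb : Tendsto (fun i => π * (|L i - M i| / M i)) l (𝓝 0) := by
      simpa using hdM.const_mul π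
    refine squeeze_zero_norm' ?_ hb
    filter_upwards [hh, hev] with i hi ⟨h1, h2⟩
    have hxi := hx i
    have hLi : 0 < L i := by linarith
    have hMi : 0 < M i := by linarith
    rw [norm_eq_abs, hi]
    have : x i / L i ≤ 1 := (div_le_one hLi).mpr (by linarith)
    gcongr
    nlinarith [pi_pos]
  have hcot : Tendsto (fun i => Real.cos (π * x i / L i) *
      (Real.sin (h i) / Real.sin (π * x i / L i))) l (𝓝 0) := by
    have hb : Tendsto (fun i => π / 2 * (|L i - M i| / M i + |L i - M i| / (L i - x i))) l
        (𝓝 0) := by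
      simpa using (hdM.add hdL).const_mul (π / 2)
    refine squeeze_zero_norm' ?_ hb
    filter_upwards [hh, hev] with i hi ⟨h1, h2⟩
    have hxi := hx i
    have hLi : 0 < L i := by linarith
    have hMi : 0 < M i := by linarith
    have ha0 : 0 < π * x i / L i := by positivity
    have hapi : π * x i / L i < π := by
      rw [div_lt_iff₀ hLi]
      exact mul_lt_mul_of_pos_left (by linarith) pi_pos
    have hsin : 0 < Real.sin (π * x i / L i) := sin_pos_of_pos_of_lt_pi ha0 hapi
    rw [norm_eq_abs, abs_mul, abs_div, abs_of_pos hsin]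
    calc |Real.cos (π * x i / L i)| * (|Real.sin (h i)| / Real.sin (π * x i / L i))
        ≤ 1 * (|h i| * (π / 2 * ((π * x i / L i)⁻¹ + (π - π * x i / L i)⁻¹))) := by
          rw [div_eq_mul_inv |Real.sin (h i)|]
          exact mul_le_mul (abs_cos_le_one _)
            (mul_le_mul abs_sin_le_abs (inv_sin_le_of_mem_Ioo ha0 hapi) (by positivity)
              (abs_nonneg _)) (by positivity) zero_le_one
      _ = π / 2 * (|L i - M i| / M i + x i / M i * (|L i - M i| / (L i - x i))) := by
          have : π - π * x i / L i = π * (L i - x i) / L i := by field_simp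
          rw [this, hi]
          field_simp
      _ ≤ π / 2 * (|L i - M i| / M i + |L i - M i| / (L i - x i)) := by
          gcongr
          exact mul_le_of_le_one_left (by positivity) ((div_le_one hMi).mpr (by linarith))
  have hcos : Tendsto (fun i => Real.cos (h i)) l (𝓝 1) := by
    simpa [Function.comp_def] using (Real.continuous_cos.tendsto 0).comp hh0
  have hsum := hcos.add hcot
  rw [add_zero] at hsum
  refine hsum.congr' ?_
  filter_upwards [hev] with i ⟨h1, h2⟩
  have hxi := hx i
  have hLi : 0 < L i := by linarith
  have hsin : 0 < Real.sin (π * x i / L i) := by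
    refine sin_pos_of_pos_of_lt_pi (by positivity) ?_
    rw [div_lt_iff₀ hLi]
    exact mul_lt_mul_of_pos_left (by linarith) pi_pos
  have hadd : π * x i / M i = π * x i / L i + h i := by simp only [h]; ring
  rw [hadd, Real.sin_add]
  field_simp

theorem zWeight_shift_ratio_limit (k : ℝ) (hk : 0 < k) (t x : ℕ → ℝ)
    (ht : Tendsto t atTop atTop) (hx : ∀ n, 0 < x n)
    (hLx : Tendsto (fun n =>
        (3 * Real.pi ^ 2 / 2) ^ ((1 : ℝ) / 3) * (t n) ^ ((1 : ℝ) / 3) - x n)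
      atTop atTop) :
    (∀ᶠ n in atTop, 0 < t n - k * (t n) ^ ((2 : ℝ) / 3) ∧
        x n ≤ (3 * Real.pi ^ 2 / 2) ^ ((1 : ℝ) / 3) *
          (t n - k * (t n) ^ ((2 : ℝ) / 3)) ^ ((1 : ℝ) / 3)) ∧
      Tendsto (fun n =>
          zWeight (t n - k * (t n) ^ ((2 : ℝ) / 3)) (x n) / zWeight (t n) (x n))
        atTop
        (nhds (Real.exp ((3 * Real.pi ^ 2 / 2) ^ ((1 : ℝ) / 3) * k / 3))) := by
  set c : ℝ := (3 * Real.pi ^ 2 / 2) ^ ((1 : ℝ) / 3)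
  set L : ℕ → ℝ := fun n => c * (t n) ^ ((1 : ℝ) / 3)
  set M : ℕ → ℝ := fun n => c * (t n - k * (t n) ^ ((2 : ℝ) / 3)) ^ ((1 : ℝ) / 3)
  have hd : Tendsto (fun n => L n - M n) atTop (nhds (c * k / 3)) := by
    have := ((tendsto_rpow_third_sub_rpow_third_shift k).comp ht).const_mul c
    rw [← mul_div_assoc] at this
    exact this.congr fun n => by simp only [L, M, Function.comp_apply]; ring
  have hMx : Tendsto (fun n => M n - x n) atTop atTop :=
    (hLx.atTop_add hd.neg).congr fun n => by ring
  have hL : Tendsto L atTop atTop :=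
    tendsto_atTop_mono (fun n => by linarith [hx n]) hLx
  constructor
  · have hs : Tendsto (fun n => (t n) ^ ((1 : ℝ) / 3)) atTop atTop :=
      (tendsto_rpow_atTop (by norm_num)).comp ht
    filter_upwards [ht.eventually_gt_atTop 0, hs.eventually_gt_atTop k,
      hMx.eventually_gt_atTop 0] with n htn hkn hMn
    refine ⟨?_, by linarith⟩
    have hsplit : t n = (t n) ^ ((1 : ℝ) / 3) * (t n) ^ ((2 : ℝ) / 3) := by
      rw [← rpow_add htn]; norm_num
    have : k * (t n) ^ ((2 : ℝ) / 3) < (t n) ^ ((1 : ℝ) / 3) * (t n) ^ ((2 : ℝ) / 3) := by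
      gcongr
    linarith
  · have hML : Tendsto (fun n => M n / L n) atTop (nhds 1) := by
      have h1 := (hd.div_atTop hL).const_sub 1
      rw [sub_zero] at h1
      refine h1.congr' ?_
      filter_upwards [hL.eventually_gt_atTop 0] with n hn
      field_simp
      ring
    have hexp := (Real.continuous_exp.tendsto _).comp hd
    have hlim := (hML.mul (tendsto_sin_ratio_of_tendsto_sub hx hLx hd)).mul hexp
    rw [one_mul, one_mul] at hlim
    refine hlim.congr fun n => ?_
    have he : Real.exp (L n - M n) = Real.exp (x n - M n) / Real.exp (x n - L n) := by
      rw [← Real.exp_sub]; congr 1; ring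
    change M n / L n * _ * Real.exp (L n - M n) =
      M n * Real.sin (π * x n / M n) * Real.exp (x n - M n) /
        (L n * Real.sin (π * x n / L n) * Real.exp (x n - L n))
    rw [he, div_mul_div_comm, div_mul_div_comm]
end
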